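/- Let ṅ, n̈ ≥ 1, let ṗ, p̈ ∈ [1/2,∞], ṗ₁, p̈₁, ṗ₂, p̈₂ ∈ [1,∞], and ȧ, ä, ȧ₁, ä₁, ȧ₂, ä₂ ∈ [0,∞) satisfy 1/ṗ = 1/ṗ₁ + 1/ṗ₂, 1/p̈ = 1/p̈₁ + 1/p̈₂, ȧ/ṗ = ȧ₁/ṗ₁ + ȧ₂/ṗ₂, and ä/p̈ = ä₁/p̈₁ + ä₂/p̈₂. Set p̄ := min{1, ṗ} and p* := min{1, ṗ, p̈}. Suppose ṡ > max{0, ṅ(1/p̄ − 1)} or ṡ ∈ 2ℕ, and s̈ > max{0, n̈(1/p* − 1)} or s̈ ∈ 2ℕ. Then there exists C > 0, depending only on the stated parameters, such that for all f, g ∈ 𝒮(ℝ^{ṅ+n̈}): ‖J^{ṡ}J^{s̈}(fg)‖_{L^{p̈}_{ä} L^{ṗ}_{ȧ}} ≤ C ( ‖J^{ṡ}J^{s̈} f‖_{L^{p̈₁}_{ä₁} L^{ṗ₁}_{ȧ₁}} ‖g‖_{L^{p̈₂}_{ä₂} L^{ṗ₂}_{ȧ₂}} + ‖J^{ṡ}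 f‖_{L^{p̈₁}_{ä₁} L^{ṗ₁}_{ȧ₁}} ‖J^{s̈} g‖_{L^{p̈₂}_{ä₂} L^{ṗ₂}_{ȧ₂}} + ‖J^{s̈} f‖_{L^{p̈₁}_{ä₁} L^{ṗ₁}_{ȧ₁}} ‖J^{ṡ} g‖_{L^{p̈₂}_{ä₂} L^{ṗ₂}_{ȧ₂}} + ‖f‖_{L^{p̈₁}_{ä₁} L^{ṗ₁}_{ȧ₁}} ‖J^{ṡ}J^{s̈} g‖_{L^{p̈₂}_{ä₂} L^{ṗ₂}_{ȧ₂}} ). -/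

import Mathlib

open MeasureTheory Real Complex
open scoped ENNReal NNReal RealInnerProductSpace

noncomputable section

abbrev Eu (n : ℕ) := EuclideanSpace ℝ (Fin n)

/-- The polynomial weight `⟨x⟩^a = (1+|x|²)^{a/2}` as an `ℝ≥0∞`-valued function. -/
def jweight {n : ℕ} (a : ℝ) (x : Eu n) : ℝ≥0∞ :=
  ENNReal.ofReal ((1 + ‖x‖ ^ 2) ^ (a / 2))

/-- Weighted Lebesgue (quasi-)norm `‖f‖_{L^p_{⟨x⟩^a}}`; for `p = ∞` the essential sup norm. -/
def wNorm {n : ℕ} {F : Type*} [NormedAddCommGroup F] (p : ℝ≥0∞) (a : ℝ)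
    (f : Eu n → F) : ℝ≥0∞ :=
  if p = ∞ then essSup (fun x => (‖f x‖₊ : ℝ≥0∞)) volume
  else (∫⁻ x, (‖f x‖₊ : ℝ≥0∞) ^ p.toReal * jweight a x) ^ (1 / p.toReal)

/-- The Fourier transform `f̂(ξ) = ∫ f(x) e^{-i x·ξ} dx`. -/
def FT {n : ℕ} (f : Eu n → ℂ) (ξ : Eu n) : ℂ :=
  ∫ x, f x * Complex.exp (-(Complex.I * ((⟪x, ξ⟫ : ℝ) : ℂ)))

/-- The inhomogeneous fractional derivative (Bessel potential) `J^s`. -/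
def Js {n : ℕ} (s : ℝ) (f : Eu n → ℂ) (x : Eu n) : ℂ :=
  ((((2 * Real.pi) ^ n)⁻¹ : ℝ) : ℂ) *
    ∫ ξ, (((1 + ‖ξ‖ ^ 2) ^ (s / 2) : ℝ) : ℂ) * FT f ξ *
      Complex.exp (Complex.I * ((⟪x, ξ⟫ : ℝ) : ℂ))
/-- The weighted mixed norm `‖F‖_{L^{Q}_{B} L^{q}_{b}}`: the inner exponent/weight pair
`(q, b)` is applied in the first variable `ẋ ∈ ℝ^{ṅ}`, and the outer pair `(Q, B)`
in the second variable `ẍ ∈ ℝ^{n̈}`. -/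
def mixedNorm {m k : ℕ} (Q : ℝ≥0∞) (B : ℝ) (q : ℝ≥0∞) (b : ℝ)
    (f : Eu m × Eu k → ℂ) : ℝ≥0∞ :=
  let g : Eu k → ℝ≥0∞ := fun y =>
    if q = ∞ then essSup (fun x => (‖f (x, y)‖₊ : ℝ≥0∞)) volume
    else (∫⁻ x, (‖f (x, y)‖₊ : ℝ≥0∞) ^ q.toReal * jweight b x) ^ (1 / q.toReal)
  if Q = ∞ then essSup g volume
  else (∫⁻ y, g y ^ Q.toReal * jweight B y) ^ (1 / Q.toReal)

/-- The Bessel potential `J^{ṡ}` acting in the first variable only. -/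
def JsFst {m k : ℕ} (s : ℝ) (f : Eu m × Eu k → ℂ) (x : Eu m × Eu k) : ℂ :=
  ((((2 * Real.pi) ^ m)⁻¹ : ℝ) : ℂ) *
    ∫ ξ : Eu m, (((1 + ‖ξ‖ ^ 2) ^ (s / 2) : ℝ) : ℂ) *
      (∫ y : Eu m, f (y, x.2) * Complex.exp (-(Complex.I * ((⟪y, ξ⟫ : ℝ) : ℂ)))) *
      Complex.exp (Complex.I * ((⟪x.1, ξ⟫ : ℝ) : ℂ))

/-- The Bessel potential `J^{s̈}` acting in the second variable only. -/
def JsSnd {m k : ℕ} (s : ℝ) (f : Eu m × Eu k → ℂ) (x : Eu m × Eu k) : ℂ :=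
  ((((2 * Real.pi) ^ k)⁻¹ : ℝ) : ℂ) *
    ∫ η : Eu k, (((1 + ‖η‖ ^ 2) ^ (s / 2) : ℝ) : ℂ) *
      (∫ z : Eu k, f (x.1, z) * Complex.exp (-(Complex.I * ((⟪z, η⟫ : ℝ) : ℂ)))) *
      Complex.exp (Complex.I * ((⟪x.2, η⟫ : ℝ) : ℂ))

def Lq {n : ℕ} (a : ℝ) (q : ℝ≥0∞) (h : Eu n → ℝ≥0∞) : ℝ≥0∞ :=
  if q = ∞ then essSup h volume
  else (∫⁻ x, h x ^ q.toReal * jweight a x) ^ (1 / q.toReal)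

theorem mixedNorm_eq {m k : ℕ} (Q : ℝ≥0∞) (B : ℝ) (q : ℝ≥0∞) (b : ℝ)
    (f : Eu m × Eu k → ℂ) :
    mixedNorm Q B q b f = Lq B Q (fun y => Lq b q (fun x => ‖f (x, y)‖ₑ)) := rfl

theorem measurable_jweight {n : ℕ} (a : ℝ) : Measurable (jweight a : Eu n → ℝ≥0∞) := by
  unfold jweight
  apply ENNReal.measurable_ofReal.comp
  fun_prop

theorem jweight_ne_top {n : ℕ} (a : ℝ) (x : Eu n) : jweight a x ≠ ∞ := ENNReal.ofReal_ne_top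

theorem one_add_sq_pos {n : ℕ} (x : Eu n) : 0 < 1 + ‖x‖ ^ 2 := by positivity

theorem jweight_ne_zero {n : ℕ} (a : ℝ) (x : Eu n) : jweight a x ≠ 0 := by
  unfold jweight
  simp only [ne_eq, ENNReal.ofReal_eq_zero, not_le]
  exact Real.rpow_pos_of_pos (one_add_sq_pos x) _

theorem jweight_rpow {n : ℕ} (a c : ℝ) (x : Eu n) : jweight a x ^ c = jweight (a * c) x := by
  unfold jweight
  rw [ENNReal.ofReal_rpow_of_pos (Real.rpow_pos_of_pos (one_add_sq_pos x) _),
    ← Real.rpow_mul (one_add_sq_pos x).le]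
  ring_nf

theorem jweight_add {n : ℕ} (a c : ℝ) (x : Eu n) :
    jweight a x * jweight c x = jweight (a + c) x := by
  unfold jweight
  rw [← ENNReal.ofReal_mul (by positivity), ← Real.rpow_add (one_add_sq_pos x)]
  ring_nf

theorem Lq_mono {n : ℕ} {a : ℝ} {q : ℝ≥0∞} {h h' : Eu n → ℝ≥0∞} (H : ∀ x, h x ≤ h' x) :
    Lq a q h ≤ Lq a q h' := by
  unfold Lq
  split_ifs
  · exact essSup_mono_ae (Filter.Eventually.of_forall H)
  · gcongr
    exact H _

theorem Lq_pow {n : ℕ} (a : ℝ) {q : ℝ≥0∞} (hq : q ≠ 0) {r : ℝ} (hr : 0 < r)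
    (h : Eu n → ℝ≥0∞) :
    Lq a q h ^ r = Lq a (q / ENNReal.ofReal r) (fun x => h x ^ r) := by
  unfold Lq
  by_cases hT : q = ∞
  · subst hT
    rw [if_pos rfl, if_pos (ENNReal.top_div_of_ne_top ENNReal.ofReal_ne_top)]
    exact OrderIso.essSup_apply h volume (ENNReal.orderIsoRpow r hr)
  · have h1 : q / ENNReal.ofReal r ≠ ∞ :=
      ENNReal.div_ne_top hT (by simpa using hr)
    rw [if_neg hT, if_neg h1, ENNReal.toReal_div, ENNReal.toReal_ofReal hr.le, ← ENNReal.rpow_mul]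
    have hq' : 0 < q.toReal := ENNReal.toReal_pos hq hT
    congr 1
    · congr 1
      funext x
      rw [← ENNReal.rpow_mul]
      congr 2
      field_simp
    · field_simp

theorem Lq_const_mul {n : ℕ} (a : ℝ) {q : ℝ≥0∞} (hq : q ≠ 0) {c : ℝ≥0∞} (hc : c ≠ ∞)
    (h : Eu n → ℝ≥0∞) : Lq a q (fun x => c * h x) = c * Lq a q h := by
  unfold Lq
  split_ifs with hT
  · exact ENNReal.essSup_const_mul
  · have hq' : 0 < q.toReal := ENNReal.toReal_pos hq hT
    simp_rw [ENNReal.mul_rpow_of_nonneg _ _ hq'.le, mul_assoc]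
    rw [lintegral_const_mul' _ _ (ENNReal.rpow_ne_top_of_nonneg hq'.le hc),
      ENNReal.mul_rpow_of_nonneg _ _ (by positivity), ← ENNReal.rpow_mul,
      mul_one_div_cancel hq'.ne', ENNReal.rpow_one]

theorem measurable_essSup {n : ℕ} {Ω : Type*} [MeasurableSpace Ω] {F : Eu n → Ω → ℝ≥0∞}
    (hF : Measurable (Function.uncurry F)) :
    Measurable (fun y => essSup (fun x => F x y) volume) := by
  apply measurable_of_Iic
  intro c
  have : (fun y => essSup (fun x => F x y) volume) ⁻¹' Set.Iic c
      = {y | volume ((fun x => (y, x)) ⁻¹' {p : Ω × Eu n | c < F p.2 p.1}) = 0} := by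
    ext y
    simp only [Set.mem_preimage, Set.mem_Iic, Set.mem_ofPred_eq]
    constructor
    · intro hh
      have := ae_le_essSup (f := fun x => F x y) (μ := volume)
      rw [← nonpos_iff_eq_zero]
      refine le_trans (measure_mono ?_) (le_of_eq this)
      intro x hx
      simp at hx ⊢
      exact hh.trans_lt hx
    · intro hh
      refine essSup_le_of_ae_le c ?_
      rw [Filter.EventuallyLE, ae_iff]
      simpa using hh
  rw [this]
  apply measurableSet_eq_fun _ measurable_const
  apply measurable_measure_prodMk_left
  apply measurableSet_lt measurable_const
  exact hF.comp measurable_swap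

theorem measurable_Lq {n : ℕ} {Ω : Type*} [MeasurableSpace Ω] (a : ℝ) (q : ℝ≥0∞)
    {F : Eu n → Ω → ℝ≥0∞} (hF : Measurable (Function.uncurry F)) :
    Measurable (fun y => Lq a q (fun x => F x y)) := by
  unfold Lq
  split_ifs
  · exact measurable_essSup hF
  · apply Measurable.pow_const
    apply Measurable.lintegral_prod_right' (f := fun (p : Ω × Eu n) => F p.2 p.1 ^ q.toReal * jweight a p.2)
    apply Measurable.mul
    · exact (hF.comp measurable_swap).pow_const _
    · exact (measurable_jweight a).comp measurable_snd

theorem mink {α β : Type*} [MeasurableSpace α] [MeasurableSpace β] (μ : Measure α) [SigmaFinite μ]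
    (ν : Measure β) [SFinite ν] {p : ℝ} (hp : 1 ≤ p) {F : α → β → ℝ≥0∞}
    (hF : Measurable (Function.uncurry F)) :
    (∫⁻ x, (∫⁻ y, F x y ∂ν) ^ p ∂μ) ^ (1 / p) ≤ ∫⁻ y, (∫⁻ x, F x y ^ p ∂μ) ^ (1 / p) ∂ν := by
  rcases hp.eq_or_lt with rfl | hp
  · simp only [ENNReal.rpow_one, div_one]
    rw [lintegral_lintegral_swap hF.aemeasurable]
  have hp0 : 0 < p := by linarith
  set I := ∫⁻ y, (∫⁻ x, F x y ^ p ∂μ) ^ (1 / p) ∂ν with hI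
  set G : α → ℝ≥0∞ := fun x => ∫⁻ y, F x y ∂ν with hG
  have hGm : Measurable G := hF.lintegral_prod_right'
  set Gn : ℕ → α → ℝ≥0∞ := fun n => (spanningSets μ n).indicator (fun x => min (G x) n) with hGn
  have hGnm : ∀ n, Measurable (Gn n) := fun n =>
    (hGm.min measurable_const).indicator (measurableSet_spanningSets μ n)
  have hle : ∀ n x, Gn n x ≤ G x := by
    intro n x
    simp only [hGn, Set.indicator]
    split_ifs <;> simp
  have key : ∀ n, (∫⁻ x, Gn n x ^ p ∂μ) ≤ I ^ p := by
    intro n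
    set A := ∫⁻ x, Gn n x ^ p ∂μ with hA
    have hAfin : A ≠ ∞ := by
      have : A ≤ ∫⁻ x, (spanningSets μ n).indicator (fun _ => (n : ℝ≥0∞) ^ p) x ∂μ := by
        apply lintegral_mono
        intro x
        simp only [hGn, Set.indicator]
        split_ifs
        · gcongr; exact min_le_right _ _
        · simp [hp0]
      rw [lintegral_indicator (measurableSet_spanningSets μ n), lintegral_const] at this
      refine ne_top_of_le_ne_top ?_ this
      apply ENNReal.mul_ne_top
      · exact ENNReal.rpow_ne_top_of_nonneg hp0.le (by simp)
      · simpa using (measure_spanningSets_lt_top μ n).ne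
    have hpq : (p / (p - 1)).HolderConjugate p := (Real.HolderConjugate.conjExponent hp).symm
    have h1 : A ≤ A ^ (1 / (p / (p - 1))) * I := by
      calc A = ∫⁻ x, Gn n x ^ (p - 1) * Gn n x ∂μ := by
            rw [hA]; congr 1; funext x
            conv_rhs => rw [← ENNReal.rpow_one (Gn n x), ← ENNReal.rpow_mul, ENNReal.rpow_one]
            nth_rewrite 3 [← ENNReal.rpow_one (Gn n x)]
            rw [one_mul, ← ENNReal.rpow_add_of_nonneg _ _ (by linarith) (by norm_num)]
            ring_nf
        _ ≤ ∫⁻ x, Gn n x ^ (p - 1) * G x ∂μ := by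
            gcongr with x; exact hle n x
        _ = ∫⁻ x, ∫⁻ y, Gn n x ^ (p - 1) * F x y ∂ν ∂μ := by
            congr 1; funext x
            rw [lintegral_const_mul]
            exact hF.comp measurable_prodMk_left
        _ = ∫⁻ y, ∫⁻ x, Gn n x ^ (p - 1) * F x y ∂μ ∂ν := by
            rw [lintegral_lintegral_swap]
            apply Measurable.aemeasurable
            exact (((hGnm n).pow_const _).comp measurable_fst).mul hF
        _ ≤ ∫⁻ y, A ^ (1 / (p / (p - 1))) * (∫⁻ x, F x y ^ p ∂μ) ^ (1 / p) ∂ν := by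
            apply lintegral_mono
            intro y
            have := ENNReal.lintegral_mul_le_Lp_mul_Lq μ hpq
              (f := fun x => Gn n x ^ (p - 1)) (g := fun x => F x y)
              ((hGnm n).pow_const _).aemeasurable (hF.comp measurable_prodMk_right).aemeasurable
            refine this.trans (le_of_eq ?_)
            congr 2
            rw [hA]; congr 1; funext x
            rw [← ENNReal.rpow_mul]; congr 1
            have : p - 1 ≠ 0 := by linarith
            field_simp
        _ = _ := by
            rw [lintegral_const_mul]
            apply Measurable.pow_const
            exact (hF.pow_const p).lintegral_prod_left'
    by_cases hA0 : A = 0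
    · rw [hA0]; exact zero_le
    have h2 : A = A ^ (1 / (p / (p - 1))) * A ^ (1 / p) := by
      rw [← ENNReal.rpow_add _ _ hA0 hAfin]
      nth_rewrite 1 [← ENNReal.rpow_one A]
      congr 1
      field_simp
      ring
    have h3 : A ^ (1 / p) ≤ I := by
      have h4 : A ^ (1 / (p / (p - 1))) ≠ 0 := by
        intro h; rw [h, zero_mul] at h2; exact hA0 h2
      have h5 : A ^ (1 / (p / (p - 1))) ≠ ∞ := ENNReal.rpow_ne_top_of_nonneg
        (by have : 0 < p - 1 := by linarith
            positivity) hAfin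
      rw [← ENNReal.mul_le_mul_iff_right h4 h5]
      exact h2.symm.le.trans h1
    calc A = (A ^ (1 / p)) ^ p := by
          rw [← ENNReal.rpow_mul, one_div_mul_cancel hp0.ne', ENNReal.rpow_one]
      _ ≤ I ^ p := by gcongr
  have hlim : Filter.Tendsto (fun n => ∫⁻ x, Gn n x ^ p ∂μ) Filter.atTop
      (nhds (∫⁻ x, G x ^ p ∂μ)) := by
    apply lintegral_tendsto_of_tendsto_of_monotone
    · exact fun n => ((hGnm n).pow_const _).aemeasurable
    · refine Filter.Eventually.of_forall fun x n n' hn => ?_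
      dsimp only
      gcongr
      simp only [hGn, Set.indicator]
      split_ifs with h1 h2
      · exact min_le_min le_rfl (by exact_mod_cast hn)
      · exact absurd (monotone_spanningSets μ hn h1) h2
      · exact zero_le
      · exact le_rfl
    · refine Filter.Eventually.of_forall fun x => ?_
      refine ((ENNReal.continuous_rpow_const (y := p)).tendsto _).comp ?_
      have : Filter.Tendsto (fun n : ℕ => min (G x) (n : ℝ≥0∞)) Filter.atTop (nhds (min (G x) ∞)) :=
        Filter.Tendsto.min tendsto_const_nhds ENNReal.tendsto_nat_nhds_top
      rw [min_eq_left le_top] at this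
      refine this.congr' ?_
      filter_upwards [Filter.eventually_ge_atTop (spanningSetsIndex μ x)] with n hn
      simp only [hGn]
      rw [Set.indicator_of_mem]
      exact mem_spanningSets_of_index_le μ x hn
  have hfin := le_of_tendsto' hlim key
  calc (∫⁻ x, G x ^ p ∂μ) ^ (1 / p) ≤ (I ^ p) ^ (1 / p) := by gcongr
    _ = I := by rw [← ENNReal.rpow_mul, mul_one_div_cancel hp0.ne', ENNReal.rpow_one]

theorem toReal_one_le {q : ℝ≥0∞} (hq : 1 ≤ q) (hT : q ≠ ∞) : 1 ≤ q.toReal := by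
  rw [← ENNReal.toReal_one]
  exact (ENNReal.toReal_le_toReal (by simp) hT).2 hq

theorem Lq_mink {n : ℕ} {β : Type*} [MeasurableSpace β] (ν : Measure β) [SFinite ν] (a : ℝ)
    {q : ℝ≥0∞} (hq : 1 ≤ q) {F : Eu n → β → ℝ≥0∞} (hF : Measurable (Function.uncurry F)) :
    Lq a q (fun x => ∫⁻ y, F x y ∂ν) ≤ ∫⁻ y, Lq a q (fun x => F x y) ∂ν := by
  by_cases hT : q = ∞
  · unfold Lq
    simp only [hT, if_true]
    refine essSup_le_of_ae_le _ ?_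
    have h1 : ∀ᵐ y ∂ν, ∀ᵐ x ∂(volume : Measure (Eu n)), F x y ≤ essSup (fun x => F x y) volume :=
      Filter.Eventually.of_forall fun y => ae_le_essSup
    have hm : MeasurableSet {p : β × Eu n | F p.2 p.1 ≤ essSup (fun x => F x p.1) volume} :=
      measurableSet_le (hF.comp measurable_swap) ((measurable_essSup hF).comp measurable_fst)
    have h2 := (Measure.ae_prod_iff_ae_ae (μ := ν) (ν := (volume : Measure (Eu n)))
      (p := fun p => F p.2 p.1 ≤ essSup (fun x => F x p.1) volume) hm).2 h1
    have h3 := Measure.ae_ae_of_ae_prod (Measure.ae_ae_comm (μ := ν) (ν := (volume : Measure (Eu n)))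
      (p := fun y x => F x y ≤ essSup (fun x => F x y) volume) hm |>.1 h1 |> fun h =>
        (Measure.ae_prod_iff_ae_ae (μ := (volume : Measure (Eu n))) (ν := ν)
          (p := fun p => F p.1 p.2 ≤ essSup (fun x => F x p.2) volume)
          (measurable_swap hm)).2 h)
    filter_upwards [h3] with x hx
    exact lintegral_mono_ae hx
  · unfold Lq
    simp only [hT, if_false]
    have hs : SigmaFinite ((volume : Measure (Eu n)).withDensity (jweight a)) :=
      SigmaFinite.withDensity_of_ne_top' (jweight_ne_top a)
    have key : ∀ h : Eu n → ℝ≥0∞, Measurable h → ∫⁻ x, h x ^ q.toReal * jweight a x =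
        ∫⁻ x, h x ^ q.toReal ∂((volume : Measure (Eu n)).withDensity (jweight a)) := by
      intro h hh
      rw [lintegral_withDensity_eq_lintegral_mul _ (measurable_jweight a) (hh.pow_const _)]
      simp [mul_comm]
    rw [key (fun x => ∫⁻ y, F x y ∂ν) hF.lintegral_prod_right']
    refine (mink _ ν (toReal_one_le hq hT) hF).trans (le_of_eq ?_)
    congr 1; funext y
    rw [key]
    exact hF.comp measurable_prodMk_right

theorem Lq_holder_top {n : ℕ} {p : ℝ≥0∞} (hp : p ≠ 0) (hT : p ≠ ∞) (a : ℝ) {F G : Eu n → ℝ≥0∞}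
    (hG : Measurable G) :
    (∫⁻ x, (F x * G x) ^ p.toReal * jweight a x) ^ (1 / p.toReal) ≤
      essSup F volume * (∫⁻ x, G x ^ p.toReal * jweight a x) ^ (1 / p.toReal) := by
  have hp' : 0 < p.toReal := ENNReal.toReal_pos hp hT
  have h1 : ∫⁻ x, (F x * G x) ^ p.toReal * jweight a x ≤
      (essSup F volume) ^ p.toReal * ∫⁻ x, G x ^ p.toReal * jweight a x := by
    have hm : Measurable fun x => G x ^ p.toReal * jweight a x :=
      (hG.pow_const _).mul (measurable_jweight a)
    rw [← lintegral_const_mul _ hm]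
    apply lintegral_mono_ae
    filter_upwards [ae_le_essSup (f := F) (μ := volume)] with x hx
    rw [ENNReal.mul_rpow_of_nonneg _ _ hp'.le, mul_assoc]
    gcongr
  calc _ ≤ ((essSup F volume) ^ p.toReal * ∫⁻ x, G x ^ p.toReal * jweight a x) ^ (1 / p.toReal) := by
        gcongr
    _ = _ := by
      rw [ENNReal.mul_rpow_of_nonneg _ _ (by positivity), ← ENNReal.rpow_mul,
        mul_one_div_cancel hp'.ne', ENNReal.rpow_one]

theorem Lq_holder {n : ℕ} {p p₁ p₂ : ℝ≥0∞} {a a₁ a₂ : ℝ} (hp : p ≠ 0) (hp1 : 1 ≤ p₁) (hp2 : 1 ≤ p₂)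
    (ha : 0 ≤ a) (ha1 : 0 ≤ a₁) (ha2 : 0 ≤ a₂)
    (he : 1 / p = 1 / p₁ + 1 / p₂)
    (hw : ENNReal.ofReal a / p = ENNReal.ofReal a₁ / p₁ + ENNReal.ofReal a₂ / p₂)
    {F G : Eu n → ℝ≥0∞} (hF : Measurable F) (hG : Measurable G) :
    Lq a p (fun x => F x * G x) ≤ Lq a₁ p₁ F * Lq a₂ p₂ G := by
  have hp10 : p₁ ≠ 0 := (lt_of_lt_of_le one_pos hp1).ne'
  have hp20 : p₂ ≠ 0 := (lt_of_lt_of_le one_pos hp2).ne'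
  by_cases hT : p = ∞
  · subst hT
    have he := he.symm
    simp at he
    rw [he.1, he.2]
    simp only [Lq, if_true]
    exact ENNReal.essSup_mul_le F G
  have hcancel : ∀ {b : ℝ}, 0 ≤ b → ENNReal.ofReal a / p = ENNReal.ofReal b / p → a = b := by
    intro b hb h
    have := (ENNReal.mul_left_inj (by simpa using hT) (by simpa using hp)).1 h
    exact (ENNReal.ofReal_eq_ofReal_iff ha hb).1 this
  by_cases h1T : p₁ = ∞
  · subst h1T
    have h2 : p = p₂ := by simpa using he
    subst h2
    have h3 : a = a₂ := hcancel ha2 (by simpa using hw)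
    subst h3
    simp only [Lq, if_true, hT, if_false]
    exact Lq_holder_top hp hT a hG
  by_cases h2T : p₂ = ∞
  · subst h2T
    have h2 : p = p₁ := by simpa using he
    subst h2
    have h3 : a = a₁ := hcancel ha1 (by simpa using hw)
    subst h3
    simp only [Lq, if_true, hT, if_false]
    rw [mul_comm]
    simp_rw [mul_comm (F _)]
    exact Lq_holder_top hp hT a hF
  have q0 : 0 < p.toReal := ENNReal.toReal_pos hp hT
  have q1 : 0 < p₁.toReal := ENNReal.toReal_pos hp10 h1T
  have q2 : 0 < p₂.toReal := ENNReal.toReal_pos hp20 h2T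
  have he' : 1 / p.toReal = 1 / p₁.toReal + 1 / p₂.toReal := by
    have := congrArg ENNReal.toReal he
    rwa [ENNReal.toReal_add (by simpa using hp10) (by simpa using hp20), ENNReal.toReal_div,
      ENNReal.toReal_div, ENNReal.toReal_div, ENNReal.toReal_one] at this
  have hw' : a / p.toReal = a₁ / p₁.toReal + a₂ / p₂.toReal := by
    have := congrArg ENNReal.toReal hw
    rwa [ENNReal.toReal_add (ENNReal.div_ne_top ENNReal.ofReal_ne_top hp10)
      (ENNReal.div_ne_top ENNReal.ofReal_ne_top hp20), ENNReal.toReal_div,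
      ENNReal.toReal_div, ENNReal.toReal_div, ENNReal.toReal_ofReal ha, ENNReal.toReal_ofReal ha1,
      ENNReal.toReal_ofReal ha2] at this
  have hlt : p.toReal < p₁.toReal := by
    have : 1 / p₁.toReal < 1 / p.toReal := by rw [he']; linarith [one_div_pos.2 q2]
    exact (one_div_lt_one_div q1 q0).1 this
  simp only [Lq, hT, h1T, h2T, if_false]
  have key := ENNReal.lintegral_Lp_mul_le_Lq_mul_Lr q0 hlt he' (volume : Measure (Eu n))
    (f := fun x => F x * jweight (a₁ / p₁.toReal) x) (g := fun x => G x * jweight (a₂ / p₂.toReal) x)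
    (hF.mul (measurable_jweight _)).aemeasurable (hG.mul (measurable_jweight _)).aemeasurable
  refine le_trans (le_of_eq ?_) (key.trans (le_of_eq ?_))
  · congr 2
    funext x
    simp only [Pi.mul_apply]
    rw [mul_mul_mul_comm, jweight_add, ← hw', ENNReal.mul_rpow_of_nonneg _ (jweight _ _) q0.le, jweight_rpow,
      div_mul_cancel₀ _ q0.ne']
  · congr 3
    · funext x
      rw [ENNReal.mul_rpow_of_nonneg _ _ q1.le, jweight_rpow, div_mul_cancel₀ _ q1.ne']
    · funext x
      rw [ENNReal.mul_rpow_of_nonneg _ _ q2.le, jweight_rpow, div_mul_cancel₀ _ q2.ne']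

/-- weight for translations -/
def tw {n : ℕ} (A : ℝ) (y : Eu n) : ℝ≥0∞ := ENNReal.ofReal ((2 * (1 + ‖y‖)) ^ A)

theorem jweight_trans {n : ℕ} {a A : ℝ} (ha : 0 ≤ a) (hA : a ≤ A) (x y : Eu n) :
    jweight a (x + y) ≤ tw A y * jweight a x := by
  unfold jweight tw
  rw [← ENNReal.ofReal_mul (by positivity)]
  apply ENNReal.ofReal_le_ofReal
  have h1 : 1 + ‖x + y‖ ^ 2 ≤ (2 * (1 + ‖y‖)) ^ 2 * (1 + ‖x‖ ^ 2) := by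
    have := norm_add_le x y
    have h0 := norm_nonneg (x + y)
    have hx := norm_nonneg x
    have hy := norm_nonneg y
    have : ‖x + y‖ ^ 2 ≤ (‖x‖ + ‖y‖) ^ 2 := by gcongr
    nlinarith [sq_nonneg (‖x‖ - ‖y‖), mul_nonneg hx hy, mul_nonneg (sq_nonneg ‖x‖) hy,
      mul_nonneg (sq_nonneg ‖x‖) (sq_nonneg ‖y‖)]
  calc (1 + ‖x + y‖ ^ 2) ^ (a / 2) ≤ ((2 * (1 + ‖y‖)) ^ 2 * (1 + ‖x‖ ^ 2)) ^ (a / 2) := by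
        gcongr
    _ = (2 * (1 + ‖y‖)) ^ a * (1 + ‖x‖ ^ 2) ^ (a / 2) := by
        rw [Real.mul_rpow (by positivity) (by positivity), ← Real.rpow_natCast,
          ← Real.rpow_mul (by positivity)]
        congr 2
        push_cast; ring
    _ ≤ _ := by
        gcongr
        linarith [norm_nonneg y]

theorem one_le_tw {n : ℕ} {A : ℝ} (hA : 0 ≤ A) (y : Eu n) : 1 ≤ tw A y := by
  unfold tw
  rw [ENNReal.one_le_ofReal]
  exact Real.one_le_rpow (by linarith [norm_nonneg y]) hA

theorem tw_ne_top {n : ℕ} {A : ℝ} (y : Eu n) : tw A y ≠ ∞ := ENNReal.ofReal_ne_top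

theorem measurable_tw {n : ℕ} (A : ℝ) : Measurable (tw A : Eu n → ℝ≥0∞) := by
  unfold tw
  apply ENNReal.measurable_ofReal.comp
  fun_prop

theorem Lq_trans {n : ℕ} {a A : ℝ} (ha : 0 ≤ a) (hA : a ≤ A) {q : ℝ≥0∞} (hq : 1 ≤ q)
    {h : Eu n → ℝ≥0∞} (hh : Measurable h) (y : Eu n) :
    Lq a q (fun x => h (x - y)) ≤ tw A y * Lq a q h := by
  unfold Lq
  split_ifs with hT
  · have h1 := essSup_map_measure (μ := (volume : Measure (Eu n))) (f := fun x => x - y) (g := h)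
      hh.aemeasurable (by fun_prop)
    rw [(measurePreserving_sub_right volume y).map_eq] at h1
    calc _ = essSup h volume := h1.symm
      _ ≤ _ := le_mul_of_one_le_left zero_le (one_le_tw (ha.trans hA) y)
  · have q1 := toReal_one_le hq hT
    have q0 : 0 < q.toReal := by linarith
    have h1 : ∫⁻ x, h (x - y) ^ q.toReal * jweight a x ≤
        tw A y * ∫⁻ x, h x ^ q.toReal * jweight a x := by
      have hm : Measurable fun x => h x ^ q.toReal * jweight a x :=
        (hh.pow_const _).mul (measurable_jweight a)
      rw [← lintegral_const_mul _ hm,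
        ← lintegral_sub_right_eq_self (fun x => tw A y * (h x ^ q.toReal * jweight a x)) y]
      apply lintegral_mono
      intro x
      have := jweight_trans ha hA (x - y) y
      rw [sub_add_cancel] at this
      calc _ ≤ h (x - y) ^ q.toReal * (tw A y * jweight a (x - y)) := by
            dsimp only; gcongr
        _ = _ := by ring
    calc _ ≤ (tw A y * ∫⁻ x, h x ^ q.toReal * jweight a x) ^ (1 / q.toReal) := by gcongr
      _ = tw A y ^ (1 / q.toReal) * (∫⁻ x, h x ^ q.toReal * jweight a x) ^ (1 / q.toReal) :=
        ENNReal.mul_rpow_of_nonneg _ _ (by positivity)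
      _ ≤ tw A y ^ (1 : ℝ) * (∫⁻ x, h x ^ q.toReal * jweight a x) ^ (1 / q.toReal) := by
        gcongr
        · exact one_le_tw (ha.trans hA) y
        · rw [div_le_one q0]; exact q1
      _ = _ := by rw [ENNReal.rpow_one]

def MN {m k : ℕ} (Q : ℝ≥0∞) (B : ℝ) (q : ℝ≥0∞) (b : ℝ) (H : Eu m → Eu k → ℝ≥0∞) : ℝ≥0∞ :=
  Lq B Q (fun y => Lq b q (fun x => H x y))

def Av1 {m k : ℕ} (τ : Measure (Eu m)) (H : Eu m → Eu k → ℝ≥0∞) (x : Eu m) (y : Eu k) : ℝ≥0∞ :=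
  ∫⁻ w, H (x - w) y ∂τ

def Av2 {m k : ℕ} (τ : Measure (Eu k)) (H : Eu m → Eu k → ℝ≥0∞) (x : Eu m) (y : Eu k) : ℝ≥0∞ :=
  ∫⁻ w, H x (y - w) ∂τ

theorem measurable_Av1 {m k : ℕ} (τ : Measure (Eu m)) [SFinite τ] {H : Eu m → Eu k → ℝ≥0∞}
    (hH : Measurable (Function.uncurry H)) : Measurable (Function.uncurry (Av1 τ H)) := by
  apply Measurable.lintegral_prod_right' (f := fun p : (Eu m × Eu k) × Eu m =>
    H (p.1.1 - p.2) p.1.2)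
  exact hH.comp (((measurable_fst.comp measurable_fst).sub measurable_snd).prodMk
    (measurable_snd.comp measurable_fst))

theorem measurable_Av2 {m k : ℕ} (τ : Measure (Eu k)) [SFinite τ] {H : Eu m → Eu k → ℝ≥0∞}
    (hH : Measurable (Function.uncurry H)) : Measurable (Function.uncurry (Av2 τ H)) := by
  apply Measurable.lintegral_prod_right' (f := fun p : (Eu m × Eu k) × Eu k =>
    H p.1.1 (p.1.2 - p.2))
  exact hH.comp ((measurable_fst.comp measurable_fst).prodMk
    ((measurable_snd.comp measurable_fst).sub measurable_snd))

theorem MN_mono {m k : ℕ} {Q : ℝ≥0∞} {B : ℝ} {q : ℝ≥0∞} {b : ℝ} {H H' : Eu m → Eu k → ℝ≥0∞}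
    (h : ∀ x y, H x y ≤ H' x y) : MN Q B q b H ≤ MN Q B q b H' :=
  Lq_mono fun y => Lq_mono fun x => h x y

theorem MN_pow {m k : ℕ} {Q : ℝ≥0∞} {B : ℝ} {q : ℝ≥0∞} {b : ℝ} (hQ : Q ≠ 0) (hq : q ≠ 0)
    {r : ℝ} (hr : 0 < r) (H : Eu m → Eu k → ℝ≥0∞) :
    MN Q B q b H ^ r = MN (Q / ENNReal.ofReal r) B (q / ENNReal.ofReal r) b
      (fun x y => H x y ^ r) := by
  unfold MN
  rw [Lq_pow B hQ hr]
  simp_rw [Lq_pow b hq hr]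

theorem MN_const_mul {m k : ℕ} {Q : ℝ≥0∞} {B : ℝ} {q : ℝ≥0∞} {b : ℝ} (hQ : Q ≠ 0) (hq : q ≠ 0)
    {c : ℝ≥0∞} (hc : c ≠ ∞) (H : Eu m → Eu k → ℝ≥0∞) :
    MN Q B q b (fun x y => c * H x y) = c * MN Q B q b H := by
  unfold MN
  simp_rw [Lq_const_mul b hq hc, Lq_const_mul B hQ hc]

theorem MN_mink {m k : ℕ} {Q : ℝ≥0∞} {B : ℝ} {q : ℝ≥0∞} {b : ℝ} (hQ : 1 ≤ Q) (hq : 1 ≤ q)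
    {β : Type*} [MeasurableSpace β] (ν : Measure β) [SFinite ν] {F : β → Eu m → Eu k → ℝ≥0∞}
    (hF : Measurable (fun p : β × Eu m × Eu k => F p.1 p.2.1 p.2.2)) :
    MN Q B q b (fun x y => ∫⁻ w, F w x y ∂ν) ≤ ∫⁻ w, MN Q B q b (F w) ∂ν := by
  unfold MN
  calc _ ≤ Lq B Q (fun y => ∫⁻ w, Lq b q (fun x => F w x y) ∂ν) := by
        apply Lq_mono
        intro y
        apply Lq_mink ν b hq (F := fun x w => F w x y)
        exact hF.comp (measurable_snd.prodMk (measurable_fst.prodMk measurable_const))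
    _ ≤ _ := by
        apply Lq_mink ν B hQ (F := fun y w => Lq b q (fun x => F w x y))
        apply measurable_Lq b q (F := fun x (p : Eu k × β) => F p.2 x p.1)
        exact hF.comp ((measurable_snd.comp measurable_snd).prodMk
          (measurable_fst.prodMk (measurable_fst.comp measurable_snd)))

theorem Lq_Av {n : ℕ} {q : ℝ≥0∞} {b A : ℝ} (hq : 1 ≤ q) (hb : 0 ≤ b) (hA : b ≤ A)
    (τ : Measure (Eu n)) [SFinite τ] {h : Eu n → ℝ≥0∞} (hh : Measurable h) :
    Lq b q (fun x => ∫⁻ w, h (x - w) ∂τ) ≤ (∫⁻ w, tw A w ∂τ) * Lq b q h := by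
  calc _ ≤ ∫⁻ w, Lq b q (fun x => h (x - w)) ∂τ :=
        Lq_mink τ b hq (F := fun x w => h (x - w)) (hh.comp (measurable_fst.sub measurable_snd))
    _ ≤ ∫⁻ w, tw A w * Lq b q h ∂τ := lintegral_mono fun w => Lq_trans hb hA hq hh w
    _ = _ := lintegral_mul_const _ (measurable_tw A)

theorem MN_Av2 {m k : ℕ} {Q : ℝ≥0∞} {B A : ℝ} {q : ℝ≥0∞} {b : ℝ} (hQ : 1 ≤ Q) (hq : 1 ≤ q)
    (hB : 0 ≤ B) (hA : B ≤ A)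
    (τ : Measure (Eu k)) [SFinite τ] {H : Eu m → Eu k → ℝ≥0∞}
    (hH : Measurable (Function.uncurry H)) :
    MN Q B q b (Av2 τ H) ≤ (∫⁻ w, tw A w ∂τ) * MN Q B q b H := by
  calc _ ≤ ∫⁻ w, MN Q B q b (fun x y => H x (y - w)) ∂τ := by
        apply MN_mink hQ hq τ (F := fun w x y => H x (y - w))
        exact hH.comp ((measurable_fst.comp measurable_snd).prodMk
          ((measurable_snd.comp measurable_snd).sub measurable_fst))
    _ ≤ ∫⁻ w, tw A w * MN Q B q b H ∂τ := by
        apply lintegral_mono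
        intro w
        unfold MN
        apply Lq_trans hB hA hQ (h := fun y => Lq b q (fun x => H x y))
        exact measurable_Lq b q hH
    _ = _ := lintegral_mul_const _ (measurable_tw A)

structure Good {n : ℕ} (A r : ℝ) (C0 C : ℝ≥0∞) (τ0 τ1 τ2 : Measure (Eu n)) (τt : Measure (Eu n))
    (δ : ℝ) : Prop where
  sf0 : SFinite τ0
  sf1 : SFinite τ1
  sf2 : SFinite τ2
  sft : SFinite τt
  m0 : ∫⁻ w, tw A w ∂τ0 ≤ C
  m1 : ∫⁻ w, tw A w ∂τ1 ≤ C
  m2 : ∫⁻ w, tw A w ∂τ2 ≤ C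
  mt : ∫⁻ w, tw A w ∂τt ≤ C
  sv : ∀ H : Eu n → ℝ≥0∞, Measurable H → (∀ x h, ‖h‖ ≤ δ → H (x + h) ≤ C0 * C0 * H x) →
    ∀ x, (∫⁻ w, H (x - w) ∂τ0) ^ r ≤ C * ∫⁻ w, H (x - w) ^ r ∂τt
  s1 : ∀ H : Eu n → ℝ≥0∞, Measurable H → ∀ x h, ‖h‖ ≤ δ →
    ∫⁻ w, H (x + h - w) ∂τ1 ≤ C0 * ∫⁻ w, H (x - w) ∂τ1
  s2 : ∀ H : Eu n → ℝ≥0∞, Measurable H → ∀ x h, ‖h‖ ≤ δ →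
    ∫⁻ w, H (x + h - w) ∂τ2 ≤ C0 * ∫⁻ w, H (x - w) ∂τ2

theorem rpow_le_imp {r : ℝ} (hr : 0 < r) {x y c : ℝ≥0∞} (h : x ^ r ≤ c * y ^ r) :
    x ≤ c ^ (1 / r) * y := by
  have := ENNReal.rpow_le_rpow h (z := 1 / r) (by positivity)
  rwa [ENNReal.mul_rpow_of_nonneg _ _ (by positivity), ← ENNReal.rpow_mul, ← ENNReal.rpow_mul,
    mul_one_div_cancel hr.ne', ENNReal.rpow_one, ENNReal.rpow_one] at this

theorem one_le_div_ofReal {q : ℝ≥0∞} {r : ℝ} (hr : 0 < r) (h : ENNReal.ofReal r ≤ q) :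
    1 ≤ q / ENNReal.ofReal r := by
  rw [ENNReal.le_div_iff_mul_le (by simp [hr]) (by simp)]
  simpa using h

theorem ne_zero_of_ofReal_le {q : ℝ≥0∞} {r : ℝ} (hr : 0 < r) (h : ENNReal.ofReal r ≤ q) : q ≠ 0 :=
  (lt_of_lt_of_le (by simpa using hr) h).ne'

theorem MN_sv1 {m k : ℕ} {Q : ℝ≥0∞} {B A : ℝ} {q : ℝ≥0∞} {b r : ℝ} (hr : 0 < r)
    (hq : ENNReal.ofReal r ≤ q) (hQ : Q ≠ 0) (hb : 0 ≤ b) (hA : b ≤ A) {C0 C : ℝ≥0∞} (hC : C ≠ ∞)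
    {τ0 τ1 τ2 τt : Measure (Eu m)} {δ : ℝ} (G : Good A r C0 C τ0 τ1 τ2 τt δ)
    {K : Eu m → Eu k → ℝ≥0∞} (hK : Measurable (Function.uncurry K))
    (hsv : ∀ y x h, ‖h‖ ≤ δ → K (x + h) y ≤ C0 * C0 * K x y) :
    MN Q B q b (Av1 τ0 K) ≤ (C * C) ^ (1 / r) * MN Q B q b K := by
  have hq0 := ne_zero_of_ofReal_le hr hq
  have := G.sft
  have hCC : (C * C) ^ (1 / r) ≠ ∞ :=
    ENNReal.rpow_ne_top_of_nonneg (by positivity) (ENNReal.mul_ne_top hC hC)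
  rw [← MN_const_mul hQ hq0 hCC]
  apply Lq_mono
  intro y
  rw [Lq_const_mul b hq0 hCC]
  apply rpow_le_imp hr
  have hKy : Measurable fun x => K x y := hK.comp measurable_prodMk_right
  rw [Lq_pow b hq0 hr, Lq_pow b hq0 hr]
  calc _ ≤ Lq b (q / ENNReal.ofReal r) (fun x => C * ∫⁻ w, K (x - w) y ^ r ∂τt) :=
        Lq_mono fun x => G.sv (fun x => K x y) hKy (hsv y) x
    _ = C * Lq b (q / ENNReal.ofReal r) (fun x => ∫⁻ w, K (x - w) y ^ r ∂τt) :=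
        Lq_const_mul b (lt_of_lt_of_le one_pos (one_le_div_ofReal hr hq)).ne' hC _
    _ ≤ C * (C * Lq b (q / ENNReal.ofReal r) (fun x => K x y ^ r)) := by
        gcongr
        refine (Lq_Av (one_le_div_ofReal hr hq) hb hA τt (hKy.pow_const r)).trans ?_
        gcongr
        exact G.mt
    _ = _ := by rw [mul_assoc]

theorem MN_sv2 {m k : ℕ} {Q : ℝ≥0∞} {B A : ℝ} {q : ℝ≥0∞} {b r : ℝ} (hr : 0 < r)
    (hq : ENNReal.ofReal r ≤ q) (hQ : ENNReal.ofReal r ≤ Q) (hB : 0 ≤ B) (hA : B ≤ A)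
    {C0 C : ℝ≥0∞} (hC : C ≠ ∞)
    {τ0 τ1 τ2 τt : Measure (Eu k)} {δ : ℝ} (G : Good A r C0 C τ0 τ1 τ2 τt δ)
    {K : Eu m → Eu k → ℝ≥0∞} (hK : Measurable (Function.uncurry K))
    (hsv : ∀ x y h, ‖h‖ ≤ δ → K x (y + h) ≤ C0 * C0 * K x y) :
    MN Q B q b (Av2 τ0 K) ≤ (C * C) ^ (1 / r) * MN Q B q b K := by
  have hq0 := ne_zero_of_ofReal_le hr hq
  have hQ0 := ne_zero_of_ofReal_le hr hQ
  have hq1 := one_le_div_ofReal hr hq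
  have hQ1 := one_le_div_ofReal hr hQ
  have := G.sft
  apply rpow_le_imp hr
  rw [MN_pow hQ0 hq0 hr, MN_pow hQ0 hq0 hr]
  calc _ ≤ MN (Q / ENNReal.ofReal r) B (q / ENNReal.ofReal r) b
        (fun x y => C * Av2 τt (fun x y => K x y ^ r) x y) :=
        MN_mono fun x y => G.sv (fun y => K x y) (hK.comp measurable_prodMk_left) (hsv x) y
    _ = C * MN (Q / ENNReal.ofReal r) B (q / ENNReal.ofReal r) b
        (Av2 τt (fun x y => K x y ^ r)) :=
        MN_const_mul (lt_of_lt_of_le one_pos hQ1).ne' (lt_of_lt_of_le one_pos hq1).ne' hC _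
    _ ≤ C * (C * MN (Q / ENNReal.ofReal r) B (q / ENNReal.ofReal r) b (fun x y => K x y ^ r)) := by
        gcongr
        refine (MN_Av2 hQ1 hq1 hB hA τt (hK.pow_const r)).trans ?_
        gcongr
        exact G.mt
    _ = _ := by rw [mul_assoc]

theorem MN_Av12 {m k : ℕ} {Q : ℝ≥0∞} {B A : ℝ} {q : ℝ≥0∞} {b : ℝ} (hQ : 1 ≤ Q) (hq : 1 ≤ q)
    (hB : 0 ≤ B) (hA : B ≤ A) (hb : 0 ≤ b) (hA' : b ≤ A) {C : ℝ≥0∞} (hC : C ≠ ∞)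
    (τ : Measure (Eu m)) [SFinite τ] (τ' : Measure (Eu k)) [SFinite τ']
    (h : ∫⁻ w, tw A w ∂τ ≤ C) (h' : ∫⁻ w, tw A w ∂τ' ≤ C) {H : Eu m → Eu k → ℝ≥0∞}
    (hH : Measurable (Function.uncurry H)) :
    MN Q B q b (Av1 τ (Av2 τ' H)) ≤ C * C * MN Q B q b H := by
  have hm := measurable_Av2 τ' hH
  have hq0 : q ≠ 0 := (lt_of_lt_of_le one_pos hq).ne'
  have hQ0 : Q ≠ 0 := (lt_of_lt_of_le one_pos hQ).ne'
  calc _ ≤ MN Q B q b (fun x y => C * Av2 τ' H x y) := by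
        apply Lq_mono
        intro y
        rw [Lq_const_mul b hq0 hC]
        refine (Lq_Av hq hb hA' τ (h := fun x => Av2 τ' H x y)
          (hm.comp measurable_prodMk_right)).trans ?_
        gcongr
    _ = C * MN Q B q b (Av2 τ' H) := MN_const_mul hQ0 hq0 hC _
    _ ≤ C * (C * MN Q B q b H) := by
        gcongr
        refine (MN_Av2 hQ hq hB hA τ' hH).trans ?_
        gcongr
    _ = _ := by rw [mul_assoc]

theorem MN_holder {m k : ℕ} {p p₁ p₂ P P₁ P₂ : ℝ≥0∞} {a a₁ a₂ B B₁ B₂ : ℝ}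
    (hp : p ≠ 0) (hp1 : 1 ≤ p₁) (hp2 : 1 ≤ p₂)
    (ha : 0 ≤ a) (ha1 : 0 ≤ a₁) (ha2 : 0 ≤ a₂)
    (he : 1 / p = 1 / p₁ + 1 / p₂)
    (hw : ENNReal.ofReal a / p = ENNReal.ofReal a₁ / p₁ + ENNReal.ofReal a₂ / p₂)
    (hP : P ≠ 0) (hP1 : 1 ≤ P₁) (hP2 : 1 ≤ P₂)
    (hB : 0 ≤ B) (hB1 : 0 ≤ B₁) (hB2 : 0 ≤ B₂)
    (hE : 1 / P = 1 / P₁ + 1 / P₂)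
    (hW : ENNReal.ofReal B / P = ENNReal.ofReal B₁ / P₁ + ENNReal.ofReal B₂ / P₂)
    {F G : Eu m → Eu k → ℝ≥0∞}
    (hF : Measurable (Function.uncurry F)) (hG : Measurable (Function.uncurry G)) :
    MN P B p a (fun x y => F x y * G x y) ≤ MN P₁ B₁ p₁ a₁ F * MN P₂ B₂ p₂ a₂ G := by
  refine le_trans (Lq_mono fun y => ?_) (Lq_holder hP hP1 hP2 hB hB1 hB2 hE hW
    (measurable_Lq a₁ p₁ hF) (measurable_Lq a₂ p₂ hG))
  exact Lq_holder hp hp1 hp2 ha ha1 ha2 he hw (hF.comp measurable_prodMk_right)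
    (hG.comp measurable_prodMk_right)

theorem NP {m k : ℕ} {p p₁ p₂ P P₁ P₂ : ℝ≥0∞} {a a₁ a₂ B B₁ B₂ : ℝ}
    (hp1 : 1 ≤ p₁) (hp2 : 1 ≤ p₂)
    (ha : 0 ≤ a) (ha1 : 0 ≤ a₁) (ha2 : 0 ≤ a₂)
    (he : 1 / p = 1 / p₁ + 1 / p₂)
    (hw : ENNReal.ofReal a / p = ENNReal.ofReal a₁ / p₁ + ENNReal.ofReal a₂ / p₂)
    (hP1 : 1 ≤ P₁) (hP2 : 1 ≤ P₂)
    (hB : 0 ≤ B) (hB1 : 0 ≤ B₁) (hB2 : 0 ≤ B₂)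
    (hE : 1 / P = 1 / P₁ + 1 / P₂)
    (hW : ENNReal.ofReal B / P = ENNReal.ofReal B₁ / P₁ + ENNReal.ofReal B₂ / P₂)
    {r r' A : ℝ} (hr : 0 < r) (hr' : 0 < r') (hrp : ENNReal.ofReal r ≤ p)
    (hrp' : ENNReal.ofReal r' ≤ p) (hrP' : ENNReal.ofReal r' ≤ P)
    (hA : a ≤ A) (hA1 : a₁ ≤ A) (hA2 : a₂ ≤ A) (hBA : B ≤ A) (hBA1 : B₁ ≤ A) (hBA2 : B₂ ≤ A)
    {C0 C : ℝ≥0∞} (hC0 : C0 ≠ ∞) (hC : C ≠ ∞)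
    {τ0 τ1 τ2 τt : Measure (Eu m)} {δ : ℝ} (G1 : Good A r C0 C τ0 τ1 τ2 τt δ)
    {τ0' τ1' τ2' τt' : Measure (Eu k)} {δ' : ℝ} (G2 : Good A r' C0 C τ0' τ1' τ2' τt' δ')
    {F G : Eu m → Eu k → ℝ≥0∞}
    (hF : Measurable (Function.uncurry F)) (hG : Measurable (Function.uncurry G)) :
    MN P B p a (Av1 τ0 (Av2 τ0' (fun x y => Av1 τ1 (Av2 τ1' F) x y * Av1 τ2 (Av2 τ2' G) x y))) ≤
      (C * C) ^ (1 / r) * (C * C) ^ (1 / r') * (C * C * (C * C)) *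
        (MN P₁ B₁ p₁ a₁ F * MN P₂ B₂ p₂ a₂ G) := by
  have := G1.sf0; have := G1.sf1; have := G1.sf2
  have := G2.sf0; have := G2.sf1; have := G2.sf2
  have mF := measurable_Av1 τ1 (measurable_Av2 τ1' hF)
  have mG := measurable_Av1 τ2 (measurable_Av2 τ2' hG)
  have mFG : Measurable (Function.uncurry
    (fun x y => Av1 τ1 (Av2 τ1' F) x y * Av1 τ2 (Av2 τ2' G) x y)) := mF.mul mG
  have hP0 := ne_zero_of_ofReal_le hr' hrP'
  have hp0 := ne_zero_of_ofReal_le hr hrp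
  have hCC : C0 * C0 ≠ ∞ := ENNReal.mul_ne_top hC0 hC0
  have sx : ∀ y x h, ‖h‖ ≤ δ → Av1 τ1 (Av2 τ1' F) (x + h) y * Av1 τ2 (Av2 τ2' G) (x + h) y ≤
      C0 * C0 * (Av1 τ1 (Av2 τ1' F) x y * Av1 τ2 (Av2 τ2' G) x y) := by
    intro y x h hh
    rw [mul_mul_mul_comm]
    exact mul_le_mul' (G1.s1 (fun x => Av2 τ1' F x y)
      ((measurable_Av2 τ1' hF).comp measurable_prodMk_right) x h hh)
      (G1.s2 (fun x => Av2 τ2' G x y)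
      ((measurable_Av2 τ2' hG).comp measurable_prodMk_right) x h hh)
  have sy : ∀ x y h, ‖h‖ ≤ δ' → Av1 τ1 (Av2 τ1' F) x (y + h) * Av1 τ2 (Av2 τ2' G) x (y + h) ≤
      C0 * C0 * (Av1 τ1 (Av2 τ1' F) x y * Av1 τ2 (Av2 τ2' G) x y) := by
    intro x y h hh
    rw [mul_mul_mul_comm]
    unfold Av1
    rw [← lintegral_const_mul' _ _ hC0, ← lintegral_const_mul' _ _ hC0]
    refine mul_le_mul' (lintegral_mono fun w => ?_) (lintegral_mono fun w => ?_)
    · exact G2.s1 (fun y => F (x - w) y) (hF.comp measurable_prodMk_left) y h hh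
    · exact G2.s2 (fun y => G (x - w) y) (hG.comp measurable_prodMk_left) y h hh
  calc _ ≤ (C * C) ^ (1 / r) * MN P B p a (Av2 τ0' (fun x y => Av1 τ1 (Av2 τ1' F) x y *
          Av1 τ2 (Av2 τ2' G) x y)) := by
        apply MN_sv1 hr hrp hP0 ha hA hC G1 (measurable_Av2 τ0' mFG)
        intro y x h hh
        unfold Av2
        rw [← lintegral_const_mul' _ _ hCC]
        exact lintegral_mono fun w => sx (y - w) x h hh
    _ ≤ (C * C) ^ (1 / r) * ((C * C) ^ (1 / r') * MN P B p a (fun x y => Av1 τ1 (Av2 τ1' F) x y *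
          Av1 τ2 (Av2 τ2' G) x y)) := by
        gcongr
        exact MN_sv2 hr' hrp' hrP' hB hBA hC G2 mFG sy
    _ ≤ (C * C) ^ (1 / r) * ((C * C) ^ (1 / r') *
          (MN P₁ B₁ p₁ a₁ (Av1 τ1 (Av2 τ1' F)) * MN P₂ B₂ p₂ a₂ (Av1 τ2 (Av2 τ2' G)))) := by
        gcongr
        exact MN_holder hp0 hp1 hp2 ha ha1 ha2 he hw hP0 hP1 hP2 hB hB1 hB2 hE hW mF mG
    _ ≤ (C * C) ^ (1 / r) * ((C * C) ^ (1 / r') *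
          ((C * C * MN P₁ B₁ p₁ a₁ F) * (C * C * MN P₂ B₂ p₂ a₂ G))) := by
        gcongr
        · exact MN_Av12 hP1 hp1 hB1 hBA1 ha1 hA1 hC τ1 τ1' G1.m1 G2.m1 hF
        · exact MN_Av12 hP2 hp2 hB2 hBA2 ha2 hA2 hC τ2 τ2' G1.m2 G2.m2 hG
    _ = _ := by ring

def Psi {n : ℕ} (ρ N : ℝ) (j : ℕ) (x : Eu n) : ℝ :=
  ((2 : ℝ) ^ j) ^ n * (1 + 2 ^ j * ‖x‖) ^ (-ρ) * (1 + ‖x‖) ^ (-N)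

theorem Psi_pos {n : ℕ} (ρ N : ℝ) (j : ℕ) (x : Eu n) : 0 < Psi ρ N j x := by
  unfold Psi; positivity

theorem continuous_Psi {n : ℕ} (ρ N : ℝ) (j : ℕ) : Continuous (Psi ρ N j : Eu n → ℝ) := by
  unfold Psi
  refine Continuous.mul (Continuous.mul continuous_const ?_) ?_
  · exact Continuous.rpow_const (by fun_prop) (fun x => Or.inl (by positivity))
  · exact Continuous.rpow_const (by fun_prop) (fun x => Or.inl (by positivity))

def psE {n : ℕ} (ρ N : ℝ) (j : ℕ) (x : Eu n) : ℝ≥0∞ := ENNReal.ofReal (Psi ρ N j x)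

theorem measurable_psE {n : ℕ} (ρ N : ℝ) (j : ℕ) : Measurable (psE ρ N j : Eu n → ℝ≥0∞) :=
  ENNReal.measurable_ofReal.comp (continuous_Psi ρ N j).measurable

theorem psE_ne_top {n : ℕ} (ρ N : ℝ) (j : ℕ) (x : Eu n) : psE ρ N j x ≠ ∞ := ENNReal.ofReal_ne_top

def tauP (n : ℕ) (ρ N : ℝ) (j : ℕ) : Measure (Eu n) := volume.withDensity (psE ρ N j)

instance {n : ℕ} (ρ N : ℝ) (j : ℕ) : SFinite (tauP n ρ N j) := by unfold tauP; infer_instance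

theorem lintegral_tauP {n : ℕ} (ρ N : ℝ) (j : ℕ) {H : Eu n → ℝ≥0∞} (hH : Measurable H) :
    ∫⁻ w, H w ∂(tauP n ρ N j) = ∫⁻ w, psE ρ N j w * H w := by
  unfold tauP
  rw [lintegral_withDensity_eq_lintegral_mul _ (measurable_psE _ _ _) hH]
  rfl

theorem pow_scale {i j : ℕ} (hij : i ≤ j) {t : ℝ} (h : t ≤ ((2 : ℝ) ^ j)⁻¹) : 2 ^ i * t ≤ 1 := by
  have h1 : (2 : ℝ) ^ i ≤ 2 ^ j := pow_le_pow_right₀ (by norm_num) hij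
  calc (2 : ℝ) ^ i * t ≤ 2 ^ i * ((2 : ℝ) ^ j)⁻¹ := by gcongr
    _ ≤ 2 ^ j * ((2 : ℝ) ^ j)⁻¹ := by gcongr
    _ = 1 := by field_simp

theorem base_peetre {n : ℕ} {c : ℝ} (hc : 0 ≤ c) (x h : Eu n) (hh : c * ‖h‖ ≤ 1) :
    1 + c * ‖x‖ ≤ 2 * (1 + c * ‖x + h‖) := by
  have : ‖x‖ ≤ ‖x + h‖ + ‖h‖ := by
    calc ‖x‖ = ‖x + h - h‖ := by simp
      _ ≤ _ := norm_sub_le _ _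
  have h0 : 0 ≤ c * ‖x + h‖ := by positivity
  nlinarith [mul_le_mul_of_nonneg_left this hc]

theorem rpow_neg_le {a b ρ : ℝ} (ha : 0 < a) (hb : 0 < b) (hρ : 0 ≤ ρ) (h : a ≤ 2 * b) :
    b ^ (-ρ) ≤ 2 ^ ρ * a ^ (-ρ) := by
  rw [Real.rpow_neg hb.le, Real.rpow_neg ha.le]
  rw [inv_le_comm₀ (by positivity) (by positivity), mul_inv, inv_inv, inv_mul_le_iff₀ (by positivity),
    ← Real.mul_rpow (by norm_num) hb.le]
  gcongr

theorem Psi_peetre {n : ℕ} {ρ N : ℝ} (hρ : 0 ≤ ρ) (hN : 0 ≤ N) {i j : ℕ} (hij : i ≤ j)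
    (x h : Eu n) (hh : ‖h‖ ≤ ((2 : ℝ) ^ j)⁻¹) :
    Psi ρ N i (x + h) ≤ 2 ^ (ρ + N) * Psi ρ N i x := by
  have h1 := rpow_neg_le (by positivity) (by positivity) hρ
    (base_peetre (by positivity) x h (pow_scale hij hh))
  have h2 := rpow_neg_le (by positivity) (by positivity) hN
    (base_peetre (c := 1) (by positivity) x h (by simpa using pow_scale (Nat.zero_le j) hh))
  simp only [one_mul] at h2
  unfold Psi
  rw [Real.rpow_add (by norm_num)]
  calc _ ≤ ((2 : ℝ) ^ i) ^ n * (2 ^ ρ * (1 + 2 ^ i * ‖x‖) ^ (-ρ)) * (2 ^ N * (1 + ‖x‖) ^ (-N)) := by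
        gcongr
    _ = _ := by ring

theorem psE_peetre {n : ℕ} {ρ N : ℝ} (hρ : 0 ≤ ρ) (hN : 0 ≤ N) {i j : ℕ} (hij : i ≤ j)
    (x h : Eu n) (hh : ‖h‖ ≤ ((2 : ℝ) ^ j)⁻¹) :
    psE ρ N i (x + h) ≤ ENNReal.ofReal (2 ^ (ρ + N)) * psE ρ N i x := by
  unfold psE
  rw [← ENNReal.ofReal_mul (by positivity)]
  exact ENNReal.ofReal_le_ofReal (Psi_peetre hρ hN hij x h hh)

theorem int_scaled {n : ℕ} {ρ : ℝ} (hρ : (n : ℝ) < ρ) (j : ℕ) :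
    ∫⁻ x : Eu n, ENNReal.ofReal (((2 : ℝ) ^ j) ^ n * (1 + 2 ^ j * ‖x‖) ^ (-ρ)) =
      ENNReal.ofReal (∫ x : Eu n, (1 + ‖x‖) ^ (-ρ)) := by
  have hi : Integrable (fun x : Eu n => (1 + ‖x‖) ^ (-ρ)) :=
    integrable_one_add_norm (by simpa using hρ)
  have hi2 := hi.comp_smul (R := (2 : ℝ) ^ j) (by positivity)
  have he : (fun x : Eu n => (1 + ‖((2:ℝ) ^ j) • x‖) ^ (-ρ)) =
      fun x : Eu n => (1 + 2 ^ j * ‖x‖) ^ (-ρ) := by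
    ext x; rw [norm_smul]; simp
  rw [he] at hi2
  rw [← ofReal_integral_eq_lintegral_ofReal (hi2.const_mul _)
    (Filter.Eventually.of_forall fun x => by positivity), integral_const_mul, ← he,
    Measure.integral_comp_smul_of_nonneg volume (fun x : Eu n => (1 + ‖x‖) ^ (-ρ)) _
      (hR := by positivity)]
  congr 1
  simp

theorem tauP_moment {n : ℕ} {ρ N A : ℝ} (hA : 0 ≤ A) (hAN : A ≤ N) (hρ : (n : ℝ) < ρ) (j : ℕ) :
    ∫⁻ w, tw A w ∂(tauP n ρ N j) ≤
      ENNReal.ofReal (2 ^ A) * ENNReal.ofReal (∫ x : Eu n, (1 + ‖x‖) ^ (-ρ)) := by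
  rw [lintegral_tauP _ _ _ (measurable_tw A), ← int_scaled hρ j]
  rw [← lintegral_const_mul' _ _ ENNReal.ofReal_ne_top]
  apply lintegral_mono
  intro w
  unfold psE tw Psi
  dsimp only
  rw [← ENNReal.ofReal_mul (by positivity), ← ENNReal.ofReal_mul (by positivity)]
  apply ENNReal.ofReal_le_ofReal
  rw [Real.mul_rpow (by positivity) (by positivity)]
  have : (1 + ‖w‖) ^ (-N) * (1 + ‖w‖) ^ A ≤ 1 := by
    rw [← Real.rpow_add (by positivity)]
    exact Real.rpow_le_one_of_one_le_of_nonpos (by linarith [norm_nonneg w]) (by linarith)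
  calc _ = (2 ^ A * (((2 : ℝ) ^ j) ^ n * (1 + 2 ^ j * ‖w‖) ^ (-ρ))) * ((1 + ‖w‖) ^ (-N) * (1 + ‖w‖) ^ A) := by
        ring
    _ ≤ _ := mul_le_of_le_one_right (by positivity) this

theorem tauP_shift {n : ℕ} {ρ N : ℝ} (hρ : 0 ≤ ρ) (hN : 0 ≤ N) {i j : ℕ} (hij : i ≤ j)
    {C0 : ℝ≥0∞} (hC0 : ENNReal.ofReal (2 ^ (ρ + N)) ≤ C0)
    (H : Eu n → ℝ≥0∞) (hH : Measurable H) (x h : Eu n) (hh : ‖h‖ ≤ ((2 : ℝ) ^ j)⁻¹) :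
    ∫⁻ w, H (x + h - w) ∂(tauP n ρ N i) ≤ C0 * ∫⁻ w, H (x - w) ∂(tauP n ρ N i) := by
  have hm : Measurable fun w => psE ρ N i w * H (x - w) :=
    (measurable_psE _ _ _).mul (hH.comp (by fun_prop))
  have m1 : Measurable fun w => H (x + h - w) := hH.comp (by fun_prop)
  have m2 : Measurable fun w => H (x - w) := hH.comp (by fun_prop)
  rw [lintegral_tauP _ _ _ m1, lintegral_tauP _ _ _ m2]
  rw [← lintegral_add_right_eq_self _ h, ← lintegral_const_mul _ hm]
  apply lintegral_mono
  intro w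
  dsimp only
  have : x + h - (w + h) = x - w := by abel
  rw [this, ← mul_assoc]
  gcongr
  exact (psE_peetre hρ hN hij w h hh).trans (by gcongr)

theorem sv_core {n : ℕ} {r δ : ℝ} (hr : 0 < r) (hr1 : r ≤ 1) (hδ : 0 < δ) {c : ℝ≥0∞}
    (G : Eu n → ℝ≥0∞) (hG : Measurable G) (hs : ∀ x h, ‖h‖ ≤ δ → G (x + h) ≤ c * G x) :
    (∫⁻ w, G w) ^ r ≤ (c ^ r / volume (Metric.closedBall (0 : Eu n) δ)) ^ (1 - r) * ∫⁻ w, G w ^ r := by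
  set V := volume (Metric.closedBall (0 : Eu n) δ) with hV
  set I := ∫⁻ w, G w ^ r with hI
  have hV0 : V ≠ 0 := (Metric.measure_closedBall_pos _ _ hδ).ne'
  have hVT : V ≠ ∞ := measure_closedBall_lt_top.ne
  have h1 : ∀ w, G w ^ r ≤ c ^ r / V * I := by
    intro w
    have : G w ^ r * V ≤ c ^ r * I := by
      calc G w ^ r * V = ∫⁻ h in Metric.closedBall (0 : Eu n) δ, G w ^ r := by
            rw [setLIntegral_const]
        _ ≤ ∫⁻ h in Metric.closedBall (0 : Eu n) δ, c ^ r * G (w + h) ^ r := by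
            apply setLIntegral_mono' Metric.isClosed_closedBall.measurableSet
            intro h hh
            rw [← ENNReal.mul_rpow_of_nonneg _ _ hr.le]
            gcongr
            have := hs (w + h) (-h) (by simpa using hh)
            simpa using this
        _ ≤ ∫⁻ h, c ^ r * G (w + h) ^ r := setLIntegral_le_lintegral _ _
        _ = c ^ r * I := by
            rw [lintegral_const_mul _ (by fun_prop), lintegral_add_left_eq_self (fun h => G h ^ r) w]
    rw [← ENNReal.mul_div_right_comm]
    rwa [ENNReal.le_div_iff_mul_le (Or.inl hV0) (Or.inl hVT)]
  have h2 : ∫⁻ w, G w ≤ I * (c ^ r / V * I) ^ ((1 - r) / r) := by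
    rw [← lintegral_mul_const _ (by fun_prop)]
    apply lintegral_mono
    intro w
    have : G w = G w ^ r * (G w ^ r) ^ ((1 - r) / r) := by
      rw [← ENNReal.rpow_mul, ← ENNReal.rpow_add_of_nonneg _ _ hr.le (by
        have : r * ((1 - r) / r) = 1 - r := by field_simp
        rw [this]; linarith)]
      rw [show r + r * ((1 - r) / r) = 1 by field_simp; ring, ENNReal.rpow_one]
    dsimp only
    conv_lhs => rw [this]
    gcongr
    exact h1 w
  calc (∫⁻ w, G w) ^ r ≤ (I * (c ^ r / V * I) ^ ((1 - r) / r)) ^ r := by gcongr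
    _ = I ^ r * ((c ^ r / V) ^ (1 - r) * I ^ (1 - r)) := by
        rw [ENNReal.mul_rpow_of_nonneg _ _ hr.le, ← ENNReal.rpow_mul,
          show (1 - r) / r * r = 1 - r by field_simp,
          ENNReal.mul_rpow_of_nonneg _ _ (by linarith : 0 ≤ 1 - r)]
    _ = (c ^ r / V) ^ (1 - r) * (I ^ r * I ^ (1 - r)) := by ring
    _ = _ := by
        rw [← ENNReal.rpow_add_of_nonneg _ _ hr.le (by linarith)]
        rw [show r + (1 - r) = 1 by ring, ENNReal.rpow_one]

theorem psE_rpow {n : ℕ} (ρ N r : ℝ) (hr : 0 < r) (j : ℕ) (w : Eu n) :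
    ENNReal.ofReal ((((2 : ℝ) ^ j) ^ n) ^ (1 - r)) * psE ρ N j w ^ r = psE (ρ * r) (N * r) j w := by
  unfold psE
  rw [ENNReal.ofReal_rpow_of_pos (Psi_pos _ _ _ _), ← ENNReal.ofReal_mul (by positivity)]
  congr 1
  unfold Psi
  rw [Real.mul_rpow (by positivity) (by positivity), Real.mul_rpow (by positivity) (by positivity),
    ← Real.rpow_mul (by positivity), ← Real.rpow_mul (by positivity), ← mul_assoc, ← mul_assoc,
    ← Real.rpow_add (by positivity)]
  rw [show 1 - r + r = 1 by ring, Real.rpow_one]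
  congr 3 <;> ring

theorem Good_Psi {n : ℕ} {A r ρ N : ℝ} (hA : 0 ≤ A) (hr : 0 < r) (hr1 : r ≤ 1)
    (hρ : (n : ℝ) < ρ * r) (hN : A ≤ N * r) {C0 : ℝ≥0∞} (hC0 : ENNReal.ofReal (2 ^ (ρ + N)) ≤ C0)
    (hC0T : C0 ≠ ∞) :
    ∃ C : ℝ≥0∞, C ≠ ∞ ∧ ∀ J i1 i2 : ℕ, i1 ≤ J → i2 ≤ J →
      Good A r C0 C (tauP n ρ N J) (tauP n ρ N i1) (tauP n ρ N i2) (tauP n (ρ * r) (N * r) J)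
        ((2 : ℝ) ^ J)⁻¹ := by
  have hρ0 : 0 ≤ ρ := by
    by_contra h
    have : ρ * r ≤ 0 := mul_nonpos_of_nonpos_of_nonneg (by linarith) hr.le
    linarith [Nat.cast_nonneg (α := ℝ) n]
  have hN0 : 0 ≤ N := by
    by_contra h
    have : N * r < 0 := mul_neg_of_neg_of_pos (by linarith) hr
    linarith
  have hρn : (n : ℝ) < ρ := hρ.trans_le (mul_le_of_le_one_right hρ0 hr1)
  have hNA : A ≤ N := hN.trans (mul_le_of_le_one_right hN0 hr1)
  set v := volume (Metric.closedBall (0 : Eu n) 1) with hv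
  have hv0 : v ≠ 0 := (Metric.measure_closedBall_pos _ _ one_pos).ne'
  have hvT : v ≠ ∞ := measure_closedBall_lt_top.ne
  set c := C0 * C0 * C0 with hc
  have hcT : c ≠ ∞ := by finiteness
  set C1 := ENNReal.ofReal (2 ^ A) * ENNReal.ofReal (∫ x : Eu n, (1 + ‖x‖) ^ (-ρ)) with hC1
  set C2 := ENNReal.ofReal (2 ^ A) * ENNReal.ofReal (∫ x : Eu n, (1 + ‖x‖) ^ (-(ρ * r))) with hC2
  set C3 := (c ^ r / v) ^ (1 - r) with hC3
  have hC3T : C3 ≠ ∞ := by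
    apply ENNReal.rpow_ne_top_of_nonneg (by linarith)
    exact ENNReal.div_ne_top (ENNReal.rpow_ne_top_of_nonneg hr.le hcT) hv0
  refine ⟨C1 + C2 + C3, by finiteness, ?_⟩
  intro J i1 i2 h1 h2
  have ha : C1 ≤ C1 + C2 + C3 := by rw [add_assoc]; exact le_self_add
  have hb : C2 ≤ C1 + C2 + C3 := by rw [add_right_comm]; exact le_add_self
  have hc3 : C3 ≤ C1 + C2 + C3 := le_add_self
  refine ⟨inferInstance, inferInstance, inferInstance, inferInstance,
    (tauP_moment hA hNA hρn J).trans ha, (tauP_moment hA hNA hρn i1).trans ha,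
    (tauP_moment hA hNA hρn i2).trans ha, (tauP_moment hA hN hρ J).trans hb, ?_,
    tauP_shift hρ0 hN0 h1 hC0, tauP_shift hρ0 hN0 h2 hC0⟩
  intro H hH hs x
  have hδ : 0 < ((2 : ℝ) ^ J)⁻¹ := by positivity
  have hcore := sv_core hr hr1 hδ (c := c) (fun w => psE ρ N J w * H (x - w))
    ((measurable_psE _ _ _).mul (hH.comp (by fun_prop))) (by
      intro w h hh
      have e1 := psE_peetre hρ0 hN0 le_rfl w h hh
      have e2 := hs (x - w) (-h) (by simpa using hh)
      have e3 : x - (w + h) = x - w + -h := by abel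
      rw [e3]
      calc _ ≤ (C0 * psE ρ N J w) * (C0 * C0 * H (x - w)) := by
            gcongr; exact e1.trans (by gcongr)
        _ = _ := by rw [hc]; ring)
  have m2 : Measurable fun w => H (x - w) := hH.comp (by fun_prop)
  rw [lintegral_tauP _ _ _ m2, lintegral_tauP _ _ _ (m2.pow_const r)]
  refine hcore.trans (le_trans ?_ (mul_le_mul_left hc3 _))
  have hm : Measurable fun w => (psE ρ N J w * H (x - w)) ^ r :=
    ((measurable_psE _ _ _).mul (hH.comp (by fun_prop))).pow_const r
  have hm2 : Measurable fun w => psE (ρ * r) (N * r) J w * H (x - w) ^ r :=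
    (measurable_psE _ _ _).mul ((hH.comp (by fun_prop)).pow_const r)
  rw [← lintegral_const_mul _ hm, ← lintegral_const_mul _ hm2]
  apply lintegral_mono
  intro w
  dsimp only
  rw [← psE_rpow _ _ _ hr, ENNReal.mul_rpow_of_nonneg (psE ρ N J w) _ hr.le]
  rw [Measure.addHaar_closedBall _ _ hδ.le]
  have hb1 : volume (Metric.ball (0 : Eu n) 1) = v := by
    rw [hv, Measure.addHaar_closedBall _ _ zero_le_one]; simp
  rw [hb1, finrank_euclideanSpace_fin]
  have key : (c ^ r / (ENNReal.ofReal ((((2 : ℝ) ^ J)⁻¹) ^ n) * v)) ^ (1 - r) =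
      C3 * ENNReal.ofReal ((((2 : ℝ) ^ J) ^ n) ^ (1 - r)) := by
    rw [hC3, ← ENNReal.ofReal_rpow_of_pos (by positivity), ← ENNReal.mul_rpow_of_nonneg _ _ (by linarith)]
    congr 1
    rw [inv_pow, ENNReal.ofReal_inv_of_pos (by positivity), div_eq_mul_inv, div_eq_mul_inv,
      ENNReal.mul_inv (Or.inr hvT) (Or.inr hv0), inv_inv]
    ring
  rw [key]
  apply le_of_eq; ring

theorem Good_mono {n : ℕ} {A r : ℝ} {C0 C C' : ℝ≥0∞} (hC : C ≤ C')
    {τ0 τ1 τ2 τt : Measure (Eu n)} {δ : ℝ} (h : Good A r C0 C τ0 τ1 τ2 τt δ) :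
    Good A r C0 C' τ0 τ1 τ2 τt δ :=
  ⟨h.sf0, h.sf1, h.sf2, h.sft, h.m0.trans hC, h.m1.trans hC, h.m2.trans hC, h.mt.trans hC,
    fun H hH hs x => (h.sv H hH hs x).trans (by gcongr), h.s1, h.s2⟩

theorem Good_dirac {n : ℕ} {A r : ℝ} (hA : 0 ≤ A) {C0 : ℝ≥0∞} (hC0 : 1 ≤ C0) :
    Good A r C0 (ENNReal.ofReal (2 ^ A)) (Measure.dirac (0 : Eu n)) (Measure.dirac 0)
      (Measure.dirac 0) (Measure.dirac 0) 0 := by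
  have h1 : ∫⁻ w, tw A w ∂(Measure.dirac (0 : Eu n)) ≤ ENNReal.ofReal (2 ^ A) := by
    rw [lintegral_dirac' _ (measurable_tw A)]; simp [tw]
  have hs : ∀ H : Eu n → ℝ≥0∞, Measurable H → ∀ x h, ‖h‖ ≤ (0:ℝ) →
    ∫⁻ w, H (x + h - w) ∂(Measure.dirac (0 : Eu n)) ≤
      C0 * ∫⁻ w, H (x - w) ∂(Measure.dirac (0 : Eu n)) := by
    intro H hH x h hh
    have : h = 0 := by simpa using hh
    subst this
    rw [add_zero]
    exact le_mul_of_one_le_left zero_le hC0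
  refine ⟨inferInstance, inferInstance, inferInstance, inferInstance, h1, h1, h1, h1, ?_, hs, hs⟩
  intro H hH _ x
  have hm1 : Measurable fun w => H (x - w) := hH.comp (by fun_prop)
  rw [lintegral_dirac' _ hm1, lintegral_dirac' _ (hm1.pow_const r)]
  apply le_mul_of_one_le_left zero_le
  rw [ENNReal.one_le_ofReal]
  exact Real.one_le_rpow (by norm_num) hA

theorem psE_half {n : ℕ} {ρ N : ℝ} (hρ : 0 ≤ ρ) (hN : 0 ≤ N) (j : ℕ) (z w : Eu n)
    (h : ‖z‖ ≤ 2 * ‖w‖) : psE ρ N j w ≤ ENNReal.ofReal (2 ^ (ρ + N)) * psE ρ N j z := by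
  unfold psE
  rw [← ENNReal.ofReal_mul (by positivity)]
  apply ENNReal.ofReal_le_ofReal
  have h1 := rpow_neg_le (a := 1 + 2 ^ j * ‖z‖) (b := 1 + 2 ^ j * ‖w‖) (by positivity)
    (by positivity) hρ (by nlinarith [mul_le_mul_of_nonneg_left h (by positivity : (0:ℝ) ≤ 2 ^ j)])
  have h2 := rpow_neg_le (a := 1 + ‖z‖) (b := 1 + ‖w‖) (by positivity)
    (by positivity) hN (by linarith)
  unfold Psi
  rw [Real.rpow_add (by norm_num)]
  calc _ ≤ ((2 : ℝ) ^ j) ^ n * (2 ^ ρ * (1 + 2 ^ j * ‖z‖) ^ (-ρ)) * (2 ^ N * (1 + ‖z‖) ^ (-N)) := by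
        gcongr
    _ = _ := by ring

theorem psE_mass {n : ℕ} {ρ N : ℝ} (hN : 0 ≤ N) (hρ : (n : ℝ) < ρ) (j : ℕ) :
    ∫⁻ w : Eu n, psE ρ N j w ≤ ENNReal.ofReal (∫ x : Eu n, (1 + ‖x‖) ^ (-ρ)) := by
  have := tauP_moment (A := 0) le_rfl hN hρ j
  rw [lintegral_tauP _ _ _ (measurable_tw 0)] at this
  simpa [tw] using this

theorem psE_conv {n : ℕ} {ρ N : ℝ} (hN : 0 ≤ N) (hρ : (n : ℝ) < ρ) :
    ∃ C : ℝ≥0∞, C ≠ ∞ ∧ ∀ (j : ℕ) (z : Eu n),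
      ∫⁻ w, psE ρ N j w * psE ρ N j (z - w) ≤ C * psE ρ N j z := by
  have hρ0 : 0 ≤ ρ := (Nat.cast_nonneg n).trans hρ.le
  set c := ENNReal.ofReal (2 ^ (ρ + N)) with hc
  set M := ENNReal.ofReal (∫ x : Eu n, (1 + ‖x‖) ^ (-ρ)) with hM
  refine ⟨c * (M + M), by finiteness, fun j z => ?_⟩
  have hm := measurable_psE (n := n) ρ N j
  have hm' : Measurable fun w => psE ρ N j (z - w) := hm.comp (by fun_prop)
  calc _ ≤ ∫⁻ w, (c * psE ρ N j z) * (psE ρ N j w + psE ρ N j (z - w)) := by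
        apply lintegral_mono
        intro w
        dsimp only
        by_cases h : ‖z‖ ≤ 2 * ‖w‖
        · calc _ ≤ (c * psE ρ N j z) * psE ρ N j (z - w) := by
                gcongr; exact psE_half hρ0 hN j z w h
            _ ≤ _ := by gcongr; exact le_add_self
        · have h' : ‖z‖ ≤ 2 * ‖z - w‖ := by
            have : ‖z‖ ≤ ‖z - w‖ + ‖w‖ := by
              calc ‖z‖ = ‖z - w + w‖ := by simp
                _ ≤ _ := norm_add_le _ _
            push Not at h
            linarith
          calc _ ≤ psE ρ N j w * (c * psE ρ N j z) := by
                gcongr; exact psE_half hρ0 hN j z _ h'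
            _ = (c * psE ρ N j z) * psE ρ N j w := mul_comm _ _
            _ ≤ _ := by gcongr; exact le_self_add
    _ = (c * psE ρ N j z) * ((∫⁻ w : Eu n, psE ρ N j w) + ∫⁻ w : Eu n, psE ρ N j (z - w)) := by
        rw [lintegral_const_mul' _ _ (by finiteness [psE_ne_top ρ N j z]), lintegral_add_left hm]
    _ = (c * psE ρ N j z) * ((∫⁻ w : Eu n, psE ρ N j w) + ∫⁻ w : Eu n, psE ρ N j w) := by
        rw [lintegral_sub_left_eq_self (fun w => psE ρ N j w)]
    _ ≤ (c * psE ρ N j z) * (M + M) := by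
        gcongr <;> exact psE_mass hN hρ j
    _ = _ := by ring

theorem psE_P3 {n : ℕ} {ρ N : ℝ} (hρ : 0 ≤ ρ) (hN : 0 ≤ N) :
    ∃ C : ℝ≥0∞, C ≠ ∞ ∧ ∀ (i j : ℕ) (y z : Eu n), i ≤ j →
      psE ρ N i y * psE ρ N j z ≤
        C * ∫⁻ w, psE ρ N j w * (psE ρ N i (y - w) * psE ρ N j (z - w)) := by
  set c := ENNReal.ofReal (2 ^ (ρ + N)) with hc
  set v := volume (Metric.closedBall (0 : Eu n) 1) with hv
  have hv0 : v ≠ 0 := (Metric.measure_closedBall_pos _ _ one_pos).ne'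
  have hvT : v ≠ ∞ := measure_closedBall_lt_top.ne
  refine ⟨c * c * c / v, ENNReal.div_ne_top (by finiteness) hv0, fun i j y z hij => ?_⟩
  have hδ : 0 < ((2 : ℝ) ^ j)⁻¹ := by positivity
  have hV : ENNReal.ofReal (((2 : ℝ) ^ j) ^ n) *
      volume (Metric.closedBall (0 : Eu n) ((2 : ℝ) ^ j)⁻¹) = v := by
    rw [Measure.addHaar_closedBall _ _ hδ.le]
    have hb1 : volume (Metric.ball (0 : Eu n) 1) = v := by
      rw [hv, Measure.addHaar_closedBall _ _ zero_le_one]; simp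
    rw [hb1, finrank_euclideanSpace_fin, ← mul_assoc, ← ENNReal.ofReal_mul (by positivity),
      ← mul_pow, mul_inv_cancel₀ (by positivity)]
    simp
  rw [← ENNReal.mul_div_right_comm, ENNReal.le_div_iff_mul_le (Or.inl hv0) (Or.inl hvT), ← hV]
  have hm : Measurable fun w => psE ρ N j w * (psE ρ N i (y - w) * psE ρ N j (z - w)) :=
    (measurable_psE _ _ _).mul (((measurable_psE _ _ _).comp (by fun_prop)).mul
      ((measurable_psE _ _ _).comp (by fun_prop)))
  calc _ = ∫⁻ w in Metric.closedBall (0 : Eu n) ((2 : ℝ) ^ j)⁻¹,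
          psE ρ N i y * psE ρ N j z * ENNReal.ofReal (((2 : ℝ) ^ j) ^ n) := by
        rw [setLIntegral_const]; ring
    _ ≤ ∫⁻ w in Metric.closedBall (0 : Eu n) ((2 : ℝ) ^ j)⁻¹, c * c * c *
          (psE ρ N j w * (psE ρ N i (y - w) * psE ρ N j (z - w))) := by
        apply setLIntegral_mono' Metric.isClosed_closedBall.measurableSet
        intro w hw
        have hw' : ‖w‖ ≤ ((2 : ℝ) ^ j)⁻¹ := by simpa using hw
        have e1 := psE_peetre hρ hN hij (y - w) w hw'
        have e2 := psE_peetre hρ hN le_rfl (z - w) w hw'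
        have e3 := psE_peetre hρ hN le_rfl w (-w) (by simpa using hw')
        rw [sub_add_cancel] at e1 e2
        rw [add_neg_cancel] at e3
        have e4 : psE ρ N j (0 : Eu n) = ENNReal.ofReal (((2 : ℝ) ^ j) ^ n) := by
          simp [psE, Psi]
        rw [e4] at e3
        calc _ ≤ (c * psE ρ N i (y - w)) * (c * psE ρ N j (z - w)) * (c * psE ρ N j w) := by
              gcongr
          _ = _ := by ring
    _ ≤ ∫⁻ w, c * c * c * (psE ρ N j w * (psE ρ N i (y - w) * psE ρ N j (z - w))) :=
        setLIntegral_le_lintegral _ _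
    _ = _ := by rw [lintegral_const_mul _ hm]

theorem seminorm_sum_apply' {E ι : Type*} [AddCommGroup E] [Module ℝ E] (s : Finset ι)
    (p : ι → Seminorm ℝ E) (x : E) : (∑ m ∈ s, p m) x = ∑ m ∈ s, p m x := by
  classical
  induction s using Finset.induction_on with
  | empty => simp
  | insert a s ha ih => rw [Finset.sum_insert ha, Finset.sum_insert ha, Seminorm.add_apply, ih]

open scoped SchwartzMap FourierTransform ContDiff in
theorem slice_schwartz {n : ℕ} (G : ℝ × Eu n → ℂ) (hG : ContDiff ℝ ∞ G) (hs : HasCompactSupport G)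
    (R : ℕ) : ∃ M : ℝ, 0 ≤ M ∧ ∀ t : ℝ, ∃ K : 𝓢(Eu n, ℂ),
      (∀ x, (1 + ‖x‖) ^ R * ‖K x‖ ≤ M) ∧ (∀ x, (1 + ‖x‖) ^ R * ‖fderiv ℝ K x‖ ≤ M) ∧
      ∀ ξ, 𝓕 (K : Eu n → ℂ) ξ = G (t, ξ) := by
  set GS : 𝓢(ℝ × Eu n, ℂ) := hs.toSchwartzMap hG with hGS
  have hsl : ∀ t : ℝ, ∃ g : 𝓢(Eu n, ℂ), (∀ ξ, g ξ = G (t, ξ)) ∧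
      ∀ a b, SchwartzMap.seminorm ℝ a b g ≤ SchwartzMap.seminorm ℝ a b GS := by
    intro t
    have hc : HasCompactSupport fun ξ : Eu n => G (t, ξ) := by
      have hcl : Topology.IsClosedEmbedding (fun ξ : Eu n => ((t, ξ) : ℝ × Eu n)) :=
        Topology.IsClosedEmbedding.of_continuous_injective_isClosedMap (by fun_prop)
          (fun a b h => by simpa using h) (by
            intro s hs'
            have : (fun ξ : Eu n => ((t, ξ) : ℝ × Eu n)) '' s = {t} ×ˢ s := by
              ext ⟨a, b⟩; simp; tauto
            rw [this]
            exact isClosed_singleton.prod hs')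
      exact hs.comp_isClosedEmbedding hcl
    have hd : ContDiff ℝ ∞ fun ξ : Eu n => G (t, ξ) := hG.comp (by fun_prop)
    refine ⟨hc.toSchwartzMap hd, fun ξ => rfl, fun a b => ?_⟩
    apply SchwartzMap.seminorm_le_bound
    · positivity
    intro ξ
    have h1 : iteratedFDeriv ℝ b (⇑(hc.toSchwartzMap hd)) ξ =
        (iteratedFDeriv ℝ b G (t, ξ)).compContinuousLinearMap
          fun _ => ContinuousLinearMap.inr ℝ ℝ (Eu n) := by
      have h2 := (ContinuousLinearMap.inr ℝ ℝ (Eu n)).iteratedFDeriv_comp_right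
        (f := fun z => G (z + (t, 0))) (n := ∞) (hG.comp (by fun_prop)) ξ (i := b)
        (by exact_mod_cast le_top)
      rw [iteratedFDeriv_comp_add_right] at h2
      have e1 : ((fun z => G (z + (t, 0))) ∘ ⇑(ContinuousLinearMap.inr ℝ ℝ (Eu n))) =
          ⇑(hc.toSchwartzMap hd) := by
        ext ξ'
        simp
      rw [e1] at h2
      simpa using h2
    have h3 : ‖iteratedFDeriv ℝ b (⇑(hc.toSchwartzMap hd)) ξ‖ ≤ ‖iteratedFDeriv ℝ b G (t, ξ)‖ := by
      rw [h1]
      refine (ContinuousMultilinearMap.norm_compContinuousLinearMap_le _ _).trans ?_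
      apply mul_le_of_le_one_right (norm_nonneg _)
      apply Finset.prod_le_one
      · intros; positivity
      · intros; exact ContinuousLinearMap.norm_inr_le_one ℝ ℝ (Eu n)
    have h4 : ‖ξ‖ ≤ ‖((t, ξ) : ℝ × Eu n)‖ := le_max_right _ _
    calc _ ≤ ‖((t, ξ) : ℝ × Eu n)‖ ^ a * ‖iteratedFDeriv ℝ b G (t, ξ)‖ := by gcongr
      _ ≤ _ := SchwartzMap.le_seminorm ℝ a b GS (t, ξ)
  let q : Seminorm ℝ 𝓢(Eu n, ℂ) :=
    (Finset.Iic ((R, 1) : ℕ × ℕ)).sup fun m => SchwartzMap.seminorm ℝ m.1 m.2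
  let T : 𝓢(Eu n, ℂ) →L[ℝ] 𝓢(Eu n, ℂ) := (FourierTransform.fourierInvCLM ℂ 𝓢(Eu n, ℂ)).restrictScalars ℝ
  have hq : Continuous q := by
    apply Seminorm.continuous_of_le (q := ∑ m ∈ Finset.Iic ((R, 1) : ℕ × ℕ), SchwartzMap.seminorm ℝ m.1 m.2)
    · have : ⇑(∑ m ∈ Finset.Iic ((R, 1) : ℕ × ℕ), SchwartzMap.seminorm ℝ m.1 m.2 : Seminorm ℝ 𝓢(Eu n, ℂ)) =
        fun f => ∑ m ∈ Finset.Iic ((R, 1) : ℕ × ℕ), SchwartzMap.seminorm ℝ m.1 m.2 f := by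
        ext f
        rw [seminorm_sum_apply']
      rw [this]
      exact continuous_finsetSum _ fun m _ =>
        (schwartz_withSeminorms ℝ (Eu n) ℂ).continuous_seminorm m
    · exact Seminorm.finset_sup_le_sum _ _
  obtain ⟨s, C, -, hC⟩ := Seminorm.bound_of_continuous (schwartz_withSeminorms ℝ (Eu n) ℂ)
    (q.comp T.toLinearMap) (hq.comp T.continuous)
  set S0 := ∑ m ∈ s, SchwartzMap.seminorm ℝ m.1 m.2 GS with hS0
  have hS0n : 0 ≤ S0 := Finset.sum_nonneg fun _ _ => by positivity
  refine ⟨2 ^ R * (C * S0), by positivity, fun t => ?_⟩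
  obtain ⟨g, hg, hgs⟩ := hsl t
  have hb : q (T g) ≤ C * S0 := by
    refine (hC g).trans ?_
    change C * (s.sup (schwartzSeminormFamily ℝ (Eu n) ℂ)) g ≤ _
    gcongr
    refine ((Seminorm.finset_sup_le_sum _ s) g).trans ?_
    rw [seminorm_sum_apply']
    exact Finset.sum_le_sum fun m _ => hgs m.1 m.2
  refine ⟨T g, fun x => ?_, fun x => ?_, fun ξ => ?_⟩
  · have := SchwartzMap.one_add_le_sup_seminorm_apply (𝕜 := ℝ) (m := (R, 1)) (k := R) (n := 0)
      le_rfl (by simp) (T g) x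
    rw [norm_iteratedFDeriv_zero] at this
    exact this.trans (by dsimp only; gcongr)
  · have := SchwartzMap.one_add_le_sup_seminorm_apply (𝕜 := ℝ) (m := (R, 1)) (k := R) (n := 1)
      le_rfl le_rfl (T g) x
    rw [norm_iteratedFDeriv_one] at this
    exact this.trans (by dsimp only; gcongr)
  · rw [← SchwartzMap.fourier_coe]
    change (𝓕 (𝓕⁻ g)) ξ = _
    rw [FourierTransform.fourier_fourierInv_eq, hg]

theorem diff_bound {n : ℕ} {K : Eu n → ℂ} (hK : Differentiable ℝ K) {R : ℕ} {M : ℝ}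
    (h0 : ∀ x, (1 + ‖x‖) ^ R * ‖K x‖ ≤ M) (h1 : ∀ x, (1 + ‖x‖) ^ R * ‖fderiv ℝ K x‖ ≤ M)
    {γ : ℝ} (hγ : 0 ≤ γ) (hγ1 : γ ≤ 1) (x h : Eu n) :
    ‖K (x - h) - K x‖ ≤ 2 ^ R * M * ‖h‖ ^ γ * (((1 + ‖x - h‖) ^ R)⁻¹ + ((1 + ‖x‖) ^ R)⁻¹) := by
  have hM : 0 ≤ M := le_trans (by positivity) (h0 0)
  have h0' : ∀ x, ‖K x‖ ≤ M * ((1 + ‖x‖) ^ R)⁻¹ := fun x => by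
    rw [← div_eq_mul_inv, le_div_iff₀ (by positivity), mul_comm]; exact h0 x
  have h2R : (1 : ℝ) ≤ 2 ^ R := one_le_pow₀ (by norm_num)
  rcases le_total ‖h‖ 1 with hh | hh
  · have hmv : ‖K (x - h) - K x‖ ≤ 2 ^ R * M * ((1 + ‖x‖) ^ R)⁻¹ * ‖x - h - x‖ := by
      apply Convex.norm_image_sub_le_of_norm_fderiv_le (𝕜 := ℝ) (s := Metric.closedBall x 1)
        (fun y _ => hK y) ?_ (convex_closedBall _ _) (by simp) (by simpa using hh)
      intro y hy
      have hy' : ‖y - x‖ ≤ 1 := by simpa [dist_eq_norm] using hy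
      have h3 : 1 + ‖x‖ ≤ 2 * (1 + ‖y‖) := by
        have : ‖x‖ ≤ ‖y‖ + ‖y - x‖ := by
          calc ‖x‖ = ‖y - (y - x)‖ := by simp
            _ ≤ _ := norm_sub_le _ _
        linarith [norm_nonneg y]
      have h4 : (1 + ‖x‖) ^ R ≤ 2 ^ R * (1 + ‖y‖) ^ R := by
        rw [← mul_pow]; gcongr
      rw [← div_eq_mul_inv, le_div_iff₀ (by positivity)]
      calc ‖fderiv ℝ K y‖ * (1 + ‖x‖) ^ R ≤ ‖fderiv ℝ K y‖ * (2 ^ R * (1 + ‖y‖) ^ R) := by gcongr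
        _ = 2 ^ R * ((1 + ‖y‖) ^ R * ‖fderiv ℝ K y‖) := by ring
        _ ≤ _ := by gcongr; exact h1 y
    have h5 : ‖x - h - x‖ ≤ ‖h‖ ^ γ := by
      have : ‖x - h - x‖ = ‖h‖ := by rw [show x - h - x = -h by abel, norm_neg]
      rw [this]
      calc ‖h‖ = ‖h‖ ^ (1 : ℝ) := (Real.rpow_one _).symm
        _ ≤ _ := by
          rcases eq_or_lt_of_le (norm_nonneg h) with h6 | h6
          · rw [← h6]; simp; positivity
          · exact Real.rpow_le_rpow_of_exponent_ge h6 hh hγ1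
    calc _ ≤ 2 ^ R * M * ((1 + ‖x‖) ^ R)⁻¹ * ‖h‖ ^ γ := hmv.trans (by gcongr)
      _ = 2 ^ R * M * ‖h‖ ^ γ * (0 + ((1 + ‖x‖) ^ R)⁻¹) := by ring
      _ ≤ _ := by gcongr; positivity
  · have h6 : 1 ≤ ‖h‖ ^ γ := Real.one_le_rpow hh hγ
    calc _ ≤ ‖K (x - h)‖ + ‖K x‖ := norm_sub_le _ _
      _ ≤ 1 * M * 1 * (((1 + ‖x - h‖) ^ R)⁻¹ + ((1 + ‖x‖) ^ R)⁻¹) := by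
        have := h0' (x - h); have := h0' x; linarith
      _ ≤ _ := by gcongr

structure IsKer {n : ℕ} (ρ N γ B : ℝ) (i : ℕ) (k : Eu n → ℂ) (g : Eu n → ℂ) : Prop where
  cont : Continuous k
  bd : ∀ x, ‖k x‖ ≤ B * Psi ρ N i x
  df : ∀ x h, ‖k (x - h) - k x‖ ≤ B * (2 ^ i * ‖h‖) ^ γ * (Psi ρ N i (x - h) + Psi ρ N i x)
  ft : ∀ ξ, FT k ξ = g ξ

theorem pow_inv_le_Psi {n : ℕ} {ρ N : ℝ} (hN : 0 ≤ N) {R : ℕ} (hR : ρ + N ≤ R) (i : ℕ) (x : Eu n) :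
    ((2 : ℝ) ^ i) ^ n * ((1 + 2 ^ i * ‖x‖) ^ R)⁻¹ ≤ Psi ρ N i x := by
  unfold Psi
  rw [mul_assoc]
  gcongr
  have h1 : (1 : ℝ) ≤ 2 ^ i := one_le_pow₀ (by norm_num)
  calc ((1 + 2 ^ i * ‖x‖) ^ R)⁻¹ = (1 + 2 ^ i * ‖x‖) ^ (-(R : ℝ)) := by
        rw [Real.rpow_neg (by positivity), Real.rpow_natCast]
    _ ≤ (1 + 2 ^ i * ‖x‖) ^ (-ρ + -N) := by
        apply Real.rpow_le_rpow_of_exponent_le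
        · have : 0 ≤ 2 ^ i * ‖x‖ := by positivity
          linarith
        · linarith
    _ = (1 + 2 ^ i * ‖x‖) ^ (-ρ) * (1 + 2 ^ i * ‖x‖) ^ (-N) := by
        rw [Real.rpow_add (by positivity)]
    _ ≤ _ := by
        gcongr ?_ * ?_
        apply Real.rpow_le_rpow_of_nonpos (by positivity) _ (by linarith)
        nlinarith [norm_nonneg x]

open scoped SchwartzMap FourierTransform ContDiff in
theorem ker_scale {n : ℕ} (G : ℝ × Eu n → ℂ) (hG : ContDiff ℝ ∞ G) (hs : HasCompactSupport G)
    {ρ N γ : ℝ} (hN : 0 ≤ N) (hγ : 0 ≤ γ) (hγ1 : γ ≤ 1) :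
    ∃ B : ℝ, 0 ≤ B ∧ ∀ (t : ℝ) (i : ℕ), ∃ k : Eu n → ℂ,
      IsKer ρ N γ B i k (fun ξ => G (t, ((2 : ℝ) ^ i)⁻¹ • ξ)) := by
  obtain ⟨R, hR⟩ := exists_nat_ge (ρ + N)
  obtain ⟨M, hM, hK⟩ := slice_schwartz G hG hs R
  have h2π : (1 : ℝ) ≤ 2 * π := by linarith [Real.pi_gt_three]
  have h2πp : (0 : ℝ) < 2 * π := by linarith
  set B := 2 ^ R * M * (2 * π) ^ R with hB
  refine ⟨B, by positivity, fun t i => ?_⟩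
  obtain ⟨K, hK0, hK1, hKF⟩ := hK t
  set c : ℝ := 2 ^ i / (2 * π) with hc
  have hcp : 0 < c := by positivity
  have hcn : c ^ n ≤ (2 ^ i) ^ n := by
    gcongr; rw [hc, div_le_iff₀ h2πp]
    nlinarith [pow_pos (by norm_num : (0:ℝ) < 2) i]
  have hbase : ∀ x : Eu n, ((1 + ‖c • x‖) ^ R)⁻¹ ≤ (2 * π) ^ R * ((1 + 2 ^ i * ‖x‖) ^ R)⁻¹ := by
    intro x
    rw [← inv_le_inv₀ (by positivity) (by positivity), inv_inv, mul_inv, inv_inv,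
      inv_mul_le_iff₀ (by positivity), ← mul_pow]
    gcongr
    rw [norm_smul, Real.norm_of_nonneg hcp.le]
    have : 2 * π * (c * ‖x‖) = 2 ^ i * ‖x‖ := by rw [hc]; field_simp
    nlinarith
  refine ⟨fun x => ((c ^ n : ℝ) : ℂ) * K (c • x), ?_, ?_, ?_, ?_⟩
  · have := K.continuous
    fun_prop
  · intro x
    have h1 : ‖K (c • x)‖ ≤ M * ((1 + ‖c • x‖) ^ R)⁻¹ := by
      rw [← div_eq_mul_inv, le_div_iff₀ (by positivity), mul_comm]; exact hK0 _
    rw [norm_mul, Complex.norm_real, Real.norm_of_nonneg (by positivity)]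
    have h2R : (1 : ℝ) ≤ 2 ^ R := one_le_pow₀ (by norm_num)
    calc _ ≤ (2 ^ i) ^ n * (M * ((2 * π) ^ R * ((1 + 2 ^ i * ‖x‖) ^ R)⁻¹)) := by
          gcongr; exact h1.trans (by gcongr; exact hbase x)
      _ = (1 * M * (2 * π) ^ R) * ((2 ^ i) ^ n * ((1 + 2 ^ i * ‖x‖) ^ R)⁻¹) := by ring
      _ ≤ _ := by rw [hB]; gcongr; exact pow_inv_le_Psi hN hR i x
  · intro x h
    have h1 := diff_bound (K.differentiable) hK0 hK1 hγ hγ1 (c • x) (c • h)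
    rw [← mul_sub, norm_mul, Complex.norm_real, Real.norm_of_nonneg (by positivity), smul_sub]
    have h2 : ‖c • h‖ ^ γ ≤ (2 ^ i * ‖h‖) ^ γ := by
      gcongr
      rw [norm_smul, Real.norm_of_nonneg hcp.le]
      gcongr
      rw [hc, div_le_iff₀ h2πp]
      nlinarith [pow_pos (by norm_num : (0:ℝ) < 2) i]
    rw [← smul_sub] at h1 ⊢
    calc _ ≤ (2 ^ i) ^ n * (2 ^ R * M * (2 ^ i * ‖h‖) ^ γ *
            ((2 * π) ^ R * ((1 + 2 ^ i * ‖x - h‖) ^ R)⁻¹ + (2 * π) ^ R * ((1 + 2 ^ i * ‖x‖) ^ R)⁻¹)) := by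
          gcongr; exact h1.trans (by gcongr <;> exact hbase _)
      _ = B * (2 ^ i * ‖h‖) ^ γ * ((2 ^ i) ^ n * ((1 + 2 ^ i * ‖x - h‖) ^ R)⁻¹ +
            (2 ^ i) ^ n * ((1 + 2 ^ i * ‖x‖) ^ R)⁻¹) := by rw [hB]; ring
      _ ≤ _ := by gcongr <;> exact pow_inv_le_Psi hN hR i _
  · intro ξ
    rw [← hKF, Real.fourier_eq']
    unfold FT
    have h1 := Measure.integral_comp_smul_of_nonneg (volume : Measure (Eu n))
      (fun v => Complex.exp (↑(-2 * Real.pi * inner ℝ v (((2 : ℝ) ^ i)⁻¹ • ξ)) * Complex.I) • K v) c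
      (hR := hcp.le)
    rw [finrank_euclideanSpace_fin] at h1
    have h2 : ∫ v, Complex.exp (↑(-2 * Real.pi * inner ℝ v (((2 : ℝ) ^ i)⁻¹ • ξ)) * Complex.I) • K v =
        c ^ n • ∫ x, Complex.exp (↑(-2 * Real.pi * inner ℝ (c • x) (((2 : ℝ) ^ i)⁻¹ • ξ)) * Complex.I) •
          K (c • x) := by
      rw [h1, smul_smul, mul_inv_cancel₀ (by positivity), one_smul]
    rw [h2, ← integral_smul]
    apply integral_congr_ae
    filter_upwards with x
    rw [inner_smul_left, inner_smul_right]
    have h3 : -2 * π * ((starRingEnd ℝ) c * (((2:ℝ) ^ i)⁻¹ * inner ℝ x ξ)) = - inner ℝ x ξ := by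
      rw [hc]; simp only [conj_trivial]; field_simp
    rw [h3]
    simp only [smul_eq_mul, Complex.real_smul]
    rw [show -(Complex.I * ((inner ℝ x ξ : ℝ) : ℂ)) = ((-(inner ℝ x ξ) : ℝ) : ℂ) * Complex.I by
      push_cast; ring]
    ring

theorem IsKer.smul {n : ℕ} {ρ N γ B : ℝ} {i : ℕ} {k g : Eu n → ℂ} (h : IsKer ρ N γ B i k g) (c : ℝ)
    (hc : 0 ≤ c) : IsKer ρ N γ (c * B) i (fun x => (c : ℂ) * k x) (fun ξ => (c : ℂ) * g ξ) := by
  refine ⟨by have := h.cont; fun_prop, fun x => ?_, fun x y => ?_, fun ξ => ?_⟩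
  · rw [norm_mul, Complex.norm_real, Real.norm_of_nonneg hc, mul_assoc]
    gcongr; exact h.bd x
  · rw [← mul_sub, norm_mul, Complex.norm_real, Real.norm_of_nonneg hc, mul_assoc, mul_assoc]
    gcongr; rw [← mul_assoc]; exact h.df x y
  · rw [← h.ft]
    unfold FT
    rw [← integral_const_mul]
    simp only [mul_assoc]

theorem IsKer.mono {n : ℕ} {ρ N γ B B' : ℝ} {i : ℕ} {k g : Eu n → ℂ} (h : IsKer ρ N γ B i k g)
    (hB : B ≤ B') : IsKer ρ N γ B' i k g := by
  refine ⟨h.cont, fun x => (h.bd x).trans ?_, fun x y => (h.df x y).trans ?_, h.ft⟩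
  · have := Psi_pos ρ N i x; gcongr
  · have := Psi_pos ρ N i x; have := Psi_pos ρ N i (x - y); gcongr

def chiB (E : Type*) [NormedAddCommGroup E] : ContDiffBump (0 : E) := ⟨1, 2, one_pos, one_lt_two⟩

def chi {n : ℕ} (ξ : Eu n) : ℝ := chiB (Eu n) ξ

def md {n : ℕ} : ℕ → Eu n → ℝ
  | 0, ξ => chi ξ
  | i + 1, ξ => chi (((2 : ℝ) ^ (i + 1))⁻¹ • ξ) - chi (((2 : ℝ) ^ i)⁻¹ • ξ)

def lam {n : ℕ} (ξ : Eu n) : ℝ := 1 + ‖ξ‖ ^ 2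

theorem lam_pos {n : ℕ} (ξ : Eu n) : 0 < lam ξ := by unfold lam; positivity

theorem chi_one {n : ℕ} {ξ : Eu n} (h : ‖ξ‖ ≤ 1) : chi ξ = 1 :=
  (chiB (Eu n)).one_of_mem_closedBall (by simpa [chiB] using h)

theorem chi_zero {n : ℕ} {ξ : Eu n} (h : 2 ≤ ‖ξ‖) : chi ξ = 0 :=
  (chiB (Eu n)).zero_of_le_dist (by simpa [chiB] using h)

theorem chi_nonneg {n : ℕ} (ξ : Eu n) : 0 ≤ chi ξ := (chiB (Eu n)).nonneg

theorem chi_le_one {n : ℕ} (ξ : Eu n) : chi ξ ≤ 1 := (chiB (Eu n)).le_one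

open scoped ContDiff in
theorem chi_smooth {n : ℕ} : ContDiff ℝ ∞ (chi : Eu n → ℝ) := (chiB (Eu n)).contDiff

theorem chi_compact {n : ℕ} : HasCompactSupport (chi : Eu n → ℝ) := (chiB (Eu n)).hasCompactSupport

theorem md_sum {n : ℕ} (N : ℕ) (ξ : Eu n) :
    ∑ i ∈ Finset.range (N + 1), md i ξ = chi (((2 : ℝ) ^ N)⁻¹ • ξ) := by
  induction N with
  | zero => simp [md]
  | succ N ih => rw [Finset.sum_range_succ, ih, md]; ring

theorem Psi_integrable {n : ℕ} {ρ N : ℝ} (hN : 0 ≤ N) (hρ : (n : ℝ) < ρ) (j : ℕ) :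
    Integrable (Psi ρ N j : Eu n → ℝ) := by
  refine ⟨(continuous_Psi ρ N j).aestronglyMeasurable, ?_⟩
  rw [hasFiniteIntegral_iff_ofReal (Filter.Eventually.of_forall fun x => (Psi_pos ρ N j x).le)]
  exact (psE_mass hN hρ j).trans_lt ENNReal.ofReal_lt_top

theorem integrable_of_Psi {n : ℕ} {ρ N B : ℝ} (hN : 0 ≤ N) (hρ : (n : ℝ) < ρ) {j : ℕ}
    {k : Eu n → ℂ} (hk : Continuous k) (h : ∀ x, ‖k x‖ ≤ B * Psi ρ N j x) : Integrable k :=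
  ((Psi_integrable hN hρ j).const_mul B).mono' hk.aestronglyMeasurable
    (Filter.Eventually.of_forall h)

open scoped ContDiff in
theorem hcs_prod {n : ℕ} (a : ℝ × Eu n → ℝ) (b : Eu n → ℝ) (hb : HasCompactSupport b) :
    HasCompactSupport (fun p : ℝ × Eu n => ((chiB ℝ p.1 * a p * b p.2 : ℝ) : ℂ)) := by
  apply HasCompactSupport.of_support_subset_isCompact
    ((chiB ℝ).hasCompactSupport.isCompact.prod hb.isCompact)
  intro p hp
  have hp' : chiB ℝ p.1 * a p * b p.2 ≠ 0 := by
    intro h; apply hp; simp only [h]; simp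
  constructor
  · apply subset_tsupport
    intro h; apply hp'; rw [h]; simp
  · apply subset_tsupport
    intro h; apply hp'; rw [h]; simp

theorem inv_pow_mem (i : ℕ) : ((2 : ℝ) ^ i)⁻¹ ∈ Metric.closedBall (0 : ℝ) (chiB ℝ).rIn := by
  have h : (chiB ℝ).rIn = 1 := rfl
  rw [Metric.mem_closedBall, dist_zero_right, h, Real.norm_of_nonneg (by positivity)]
  exact inv_le_one_of_one_le₀ (one_le_pow₀ (by norm_num))

open scoped ContDiff in
theorem chi_smul_smooth {n : ℕ} (c : ℝ) : ContDiff ℝ ∞ (fun p : ℝ × Eu n => chi (c • p.2)) := by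
  have h : ContDiff ℝ ∞ (fun p : ℝ × Eu n => c • p.2) := contDiff_snd.const_smul c
  exact chi_smooth.comp h

open scoped ContDiff in
theorem ker_md {n : ℕ} (θ : ℝ) {ρ N γ : ℝ} (hN : 0 ≤ N) (hγ : 0 ≤ γ) (hγ1 : γ ≤ 1) :
    ∃ B : ℝ, 0 ≤ B ∧ ∀ i : ℕ, ∃ k : Eu n → ℂ,
      IsKer ρ N γ (((4 : ℝ) ^ i) ^ θ * B) i k (fun ξ => ((md i ξ * lam ξ ^ θ : ℝ) : ℂ)) := by
  -- low frequency
  obtain ⟨B0, hB0, h0⟩ := ker_scale (n := n)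
    (fun p : ℝ × Eu n => ((chiB ℝ p.1 * (1 + ‖p.2‖ ^ 2) ^ θ * chi p.2 : ℝ) : ℂ)) (by
      apply Complex.ofRealCLM.contDiff.comp
      refine ContDiff.mul (ContDiff.mul ((chiB ℝ).contDiff.comp contDiff_fst) ?_)
        (chi_smooth.comp contDiff_snd)
      refine ContDiff.rpow_const_of_ne ?_ (fun x => by positivity)
      exact contDiff_const.add (contDiff_snd.norm_sq ℝ))
    (hcs_prod (fun p => (1 + ‖p.2‖ ^ 2) ^ θ) chi chi_compact) (ρ := ρ) hN hγ hγ1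
  obtain ⟨B1, hB1, h1⟩ := ker_scale (n := n)
    (fun p : ℝ × Eu n => ((chiB ℝ p.1 * (p.1 ^ 2 + ‖p.2‖ ^ 2) ^ θ * (chi p.2 - chi ((2 : ℝ) • p.2)) : ℝ) : ℂ)) (by
      apply Complex.ofRealCLM.contDiff.comp
      rw [contDiff_iff_contDiffAt]
      rintro ⟨t, ξ⟩
      by_cases hξ : ‖ξ‖ < 1 / 2
      · apply contDiffAt_const (c := (0 : ℝ)) |>.congr_of_eventuallyEq
        have : ∀ᶠ p : ℝ × Eu n in nhds (t, ξ), ‖p.2‖ < 1 / 2 :=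
          (continuous_snd.norm.continuousAt (x := (t, ξ))).eventually (gt_mem_nhds hξ)
        filter_upwards [this] with p hp
        rw [chi_one (by linarith), chi_one (by rw [norm_smul]; norm_num; linarith), sub_self]
        exact mul_zero _
      · have hξ0 : 0 < ‖ξ‖ := by push Not at hξ; linarith
        refine ContDiffAt.mul (ContDiffAt.mul ((chiB ℝ).contDiff.comp contDiff_fst).contDiffAt ?_) ?_
        · refine ContDiffAt.rpow_const_of_ne ?_ (by positivity)
          exact ((contDiff_fst.pow 2).add (contDiff_snd.norm_sq ℝ)).contDiffAt
        · exact ((chi_smooth.comp contDiff_snd).sub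
            (chi_smul_smooth 2)).contDiffAt)
    (hcs_prod (fun p => (p.1 ^ 2 + ‖p.2‖ ^ 2) ^ θ) (fun ξ => chi ξ - chi ((2 : ℝ) • ξ))
      (chi_compact.sub (chi_compact.comp_smul (by norm_num)))) (ρ := ρ) hN hγ hγ1
  refine ⟨max B0 B1, le_max_of_le_left hB0, fun i => ?_⟩
  rcases i with _ | i
  · obtain ⟨k, hk⟩ := h0 0 0
    refine ⟨k, ?_⟩
    have e : (fun ξ : Eu n => ((md 0 ξ * lam ξ ^ θ : ℝ) : ℂ)) =
      fun ξ => ((chiB ℝ (0 : ℝ) * (1 + ‖((2 : ℝ) ^ 0)⁻¹ • ξ‖ ^ 2) ^ θ * chi (((2 : ℝ) ^ 0)⁻¹ • ξ) : ℝ) : ℂ) := by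
      ext ξ
      have : chiB ℝ (0 : ℝ) = 1 := (chiB ℝ).one_of_mem_closedBall (by simp [chiB])
      rw [this]
      simp [md, lam, mul_comm]
    rw [e]
    exact hk.mono (by simp)
  · obtain ⟨k, hk⟩ := h1 ((2 : ℝ) ^ (i + 1))⁻¹ (i + 1)
    have hk2 := hk.smul (((4 : ℝ) ^ (i + 1)) ^ θ) (by positivity)
    refine ⟨fun x => (((((4 : ℝ) ^ (i + 1)) ^ θ : ℝ)) : ℂ) * k x, ?_⟩
    · have e : (fun ξ : Eu n => ((md (i + 1) ξ * lam ξ ^ θ : ℝ) : ℂ)) = fun ξ =>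
        ((((4 : ℝ) ^ (i + 1)) ^ θ : ℝ) : ℂ) * ((chiB ℝ ((2 : ℝ) ^ (i + 1))⁻¹ *
          (((2 : ℝ) ^ (i + 1))⁻¹ ^ 2 + ‖((2 : ℝ) ^ (i + 1))⁻¹ • ξ‖ ^ 2) ^ θ *
          (chi (((2 : ℝ) ^ (i + 1))⁻¹ • ξ) - chi ((2 : ℝ) • ((2 : ℝ) ^ (i + 1))⁻¹ • ξ)) : ℝ) : ℂ) := by
        ext ξ
        have h1 : chiB ℝ (((2 : ℝ) ^ (i + 1))⁻¹) = 1 := (chiB ℝ).one_of_mem_closedBall (by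
          exact inv_pow_mem _)
        rw [h1, ← Complex.ofReal_mul]
        congr 1
        have h2 : (2 : ℝ) • ((2 : ℝ) ^ (i + 1))⁻¹ • ξ = ((2 : ℝ) ^ i)⁻¹ • ξ := by
          rw [smul_smul]; congr 1; rw [pow_succ]; field_simp
        have h3 : lam ξ = 4 ^ (i + 1) * (((2 : ℝ) ^ (i + 1))⁻¹ ^ 2 + ‖((2 : ℝ) ^ (i + 1))⁻¹ • ξ‖ ^ 2) := by
          rw [norm_smul, Real.norm_of_nonneg (by positivity)]
          have : (4 : ℝ) ^ (i + 1) = ((2 : ℝ) ^ (i + 1)) ^ 2 := by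
            rw [← pow_mul, mul_comm, pow_mul]; norm_num
          rw [this, lam]; field_simp
        rw [h2, h3, Real.mul_rpow (by positivity) (by positivity), md]
        ring
      rw [e]
      exact hk2.mono (by gcongr; exact le_max_right _ _)

def Far {n : ℕ} (s : ℝ) (j : ℕ) (ξ : Eu n) : ℝ := chi (((2 : ℝ) ^ (j + 2))⁻¹ • ξ) * lam ξ ^ (s / 2)

open scoped ContDiff in
theorem ker_far_even {n : ℕ} (a : ℕ) {ρ N : ℝ} (hN : 0 ≤ N) :
    ∃ B : ℝ, 0 ≤ B ∧ ∀ j : ℕ, ∃ k : Eu n → ℂ, Continuous k ∧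
      (∀ x, ‖k x‖ ≤ (((2 : ℝ) ^ j) ^ (2 * a : ℝ) * B) * Psi ρ N j x) ∧
      ∀ ξ, FT k ξ = Far (2 * a) j ξ := by
  obtain ⟨B1, hB1, h1⟩ := ker_scale (n := n)
    (fun p : ℝ × Eu n => ((chiB ℝ p.1 * (p.1 ^ 2 + ‖p.2‖ ^ 2) ^ a * chi ((4 : ℝ)⁻¹ • p.2) : ℝ) : ℂ)) (by
      apply Complex.ofRealCLM.contDiff.comp
      refine ContDiff.mul (ContDiff.mul ((chiB ℝ).contDiff.comp contDiff_fst) ?_) ?_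
      · exact ((contDiff_fst.pow 2).add (contDiff_snd.norm_sq ℝ)).pow a
      · exact chi_smul_smooth _)
    (hcs_prod (fun p => (p.1 ^ 2 + ‖p.2‖ ^ 2) ^ a) (fun ξ => chi ((4 : ℝ)⁻¹ • ξ))
      (chi_compact.comp_smul (by norm_num))) (ρ := ρ) (γ := 0) hN le_rfl zero_le_one
  refine ⟨B1, hB1, fun j => ?_⟩
  obtain ⟨k, hk⟩ := h1 ((2 : ℝ) ^ j)⁻¹ j
  have hk2 := hk.smul (((2 : ℝ) ^ j) ^ (2 * a : ℝ)) (by positivity)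
  refine ⟨_, hk2.cont, hk2.bd, fun ξ => ?_⟩
  rw [hk2.ft, ← Complex.ofReal_mul]
  congr 1
  have h1 : chiB ℝ (((2 : ℝ) ^ j)⁻¹) = 1 := (chiB ℝ).one_of_mem_closedBall (by
    exact inv_pow_mem _)
  have h2 : (4 : ℝ)⁻¹ • ((2 : ℝ) ^ j)⁻¹ • ξ = ((2 : ℝ) ^ (j + 2))⁻¹ • ξ := by
    rw [smul_smul]; congr 1; rw [pow_add]; field_simp; norm_num
  have h3 : lam ξ = ((2 : ℝ) ^ j) ^ 2 * (((2 : ℝ) ^ j)⁻¹ ^ 2 + ‖((2 : ℝ) ^ j)⁻¹ • ξ‖ ^ 2) := by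
    rw [norm_smul, Real.norm_of_nonneg (by positivity), lam]; field_simp
  have h4 : ((2 : ℝ) ^ j) ^ (2 * a : ℝ) = (((2 : ℝ) ^ j) ^ 2) ^ a := by
    rw [← pow_mul ((2 : ℝ) ^ j) 2 a, ← Real.rpow_natCast ((2 : ℝ) ^ j) (2 * a)]; push_cast; rfl
  rw [h1, h2, Far, show (2 * (a : ℝ)) / 2 = a by ring, Real.rpow_natCast, h3, mul_pow, h4]
  ring

theorem FT_add {n : ℕ} {f g : Eu n → ℂ} (hf : Integrable f) (hg : Integrable g) (ξ : Eu n) :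
    FT (fun x => f x + g x) ξ = FT f ξ + FT g ξ := by
  have aux : ∀ f : Eu n → ℂ, Integrable f →
      Integrable fun x => f x * Complex.exp (-(Complex.I * ((⟪x, ξ⟫ : ℝ) : ℂ))) := by
    intro f hf
    refine (hf.norm).mono' (hf.aestronglyMeasurable.mul (by fun_prop)) ?_
    filter_upwards with x
    rw [norm_mul, show -(Complex.I * ((⟪x, ξ⟫ : ℝ) : ℂ)) = ((-(⟪x, ξ⟫ : ℝ) : ℝ) : ℂ) * Complex.I by
      push_cast; ring, Complex.norm_exp_ofReal_mul_I, mul_one]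
  unfold FT
  rw [← integral_add (aux f hf) (aux g hg)]
  simp only [add_mul]

theorem FT_sum {n : ℕ} {ι : Type*} (s : Finset ι) {f : ι → Eu n → ℂ} (hf : ∀ i ∈ s, Integrable (f i))
    (ξ : Eu n) : FT (fun x => ∑ i ∈ s, f i x) ξ = ∑ i ∈ s, FT (f i) ξ := by
  classical
  induction s using Finset.induction_on with
  | empty => simp [FT]
  | insert a s ha ih =>
    simp only [Finset.sum_insert ha]
    rw [FT_add (hf a (Finset.mem_insert_self _ _))
      (integrable_finsetSum _ fun i hi => hf i (Finset.mem_insert_of_mem hi)),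
      ih fun i hi => hf i (Finset.mem_insert_of_mem hi)]

theorem Psi_compare {n : ℕ} {ρ N : ℝ} (hρ : 0 ≤ ρ) {l d j : ℕ} (h : l + d = j + 2) (x : Eu n) :
    Psi ρ N l x ≤ ((4 : ℝ) ^ n * (((2 : ℝ) ^ d) ^ n)⁻¹) * ((2 : ℝ) ^ d) ^ ρ * Psi ρ N j x := by
  have h1 : ((2 : ℝ) ^ l) ^ n = ((2 : ℝ) ^ j) ^ n * ((4 : ℝ) ^ n * (((2 : ℝ) ^ d) ^ n)⁻¹) := by
    have : (2 : ℝ) ^ l * 2 ^ d = 2 ^ j * 4 := by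
      rw [← pow_add, h, pow_add]; norm_num
    field_simp
    rw [← mul_pow, this, mul_pow]
  have h2 : (1 + 2 ^ l * ‖x‖) ^ (-ρ) ≤ ((2 : ℝ) ^ d) ^ ρ * (1 + 2 ^ j * ‖x‖) ^ (-ρ) := by
    rw [Real.rpow_neg (by positivity), Real.rpow_neg (by positivity)]
    rw [inv_le_comm₀ (by positivity) (by positivity), mul_inv, inv_inv,
      inv_mul_le_iff₀ (by positivity), ← Real.mul_rpow (by positivity) (by positivity)]
    gcongr
    have e : (2 : ℝ) ^ d * (1 + 2 ^ l * ‖x‖) = 2 ^ d + 2 ^ (j + 2) * ‖x‖ := by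
      rw [← h, pow_add]; ring
    rw [e, pow_add]
    have : (1 : ℝ) ≤ 2 ^ d := one_le_pow₀ (by norm_num)
    have : 0 ≤ 2 ^ j * ‖x‖ := by positivity
    nlinarith
  unfold Psi
  calc _ ≤ (((2 : ℝ) ^ j) ^ n * ((4 : ℝ) ^ n * (((2 : ℝ) ^ d) ^ n)⁻¹)) *
        (((2 : ℝ) ^ d) ^ ρ * (1 + 2 ^ j * ‖x‖) ^ (-ρ)) * (1 + ‖x‖) ^ (-N) := by
        rw [← h1]; gcongr
    _ = _ := by ring

theorem ker_far_gen {n : ℕ} {s : ℝ} {ρ N : ℝ} (hN : 0 ≤ N) (hρ : (n : ℝ) < ρ)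
    (hs : ρ < n + s) :
    ∃ B : ℝ, 0 ≤ B ∧ ∀ j : ℕ, ∃ k : Eu n → ℂ, Continuous k ∧
      (∀ x, ‖k x‖ ≤ (((2 : ℝ) ^ j) ^ s * B) * Psi ρ N j x) ∧
      ∀ ξ, FT k ξ = Far s j ξ := by
  obtain ⟨B, hB, hk⟩ := ker_md (n := n) (s / 2) (ρ := ρ) (γ := 0) hN le_rfl zero_le_one
  choose k hk using hk
  set q : ℝ := 2 ^ (ρ - n - s) with hq
  have hρ0 : 0 ≤ ρ := (Nat.cast_nonneg n).trans hρ.le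
  have hq0 : 0 ≤ q := by positivity
  have hq1 : q < 1 := Real.rpow_lt_one_of_one_lt_of_neg (by norm_num) (by linarith)
  refine ⟨4 ^ s * 4 ^ n * (1 - q)⁻¹ * B, by
    have : 0 < 1 - q := by linarith
    positivity, fun j => ?_⟩
  refine ⟨fun x => ∑ l ∈ Finset.range (j + 2 + 1), k l x,
    continuous_finsetSum _ fun l _ => (hk l).cont, fun x => ?_, fun ξ => ?_⟩
  · have hterm : ∀ l d, l + d = j + 2 → ‖k l x‖ ≤ ((2 : ℝ) ^ j) ^ s * (4 ^ s * 4 ^ n * B) * Psi ρ N j x * q ^ d := by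
      intro l d h
      refine ((hk l).bd x).trans ?_
      have e1 : ((4 : ℝ) ^ l) ^ (s / 2) = ((2 : ℝ) ^ j) ^ s * 4 ^ s * (((2 : ℝ) ^ d) ^ s)⁻¹ := by
        have : (2 : ℝ) ^ l * 2 ^ d = 2 ^ j * 4 := by
          rw [← pow_add, h, pow_add]; norm_num
        have h4 : ((4 : ℝ) ^ l) ^ (s / 2) = ((2 : ℝ) ^ l) ^ s := by
          rw [show (4 : ℝ) ^ l = ((2 : ℝ) ^ l) ^ (2 : ℝ) by
            rw [Real.rpow_two, ← pow_mul, mul_comm, pow_mul]; norm_num]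
          rw [← Real.rpow_mul (by positivity)]; congr 1; ring
        rw [h4, ← Real.mul_rpow (by positivity) (by positivity), ← this,
          Real.mul_rpow (by positivity) (by positivity)]
        field_simp
      have e2 : q ^ d = ((2 : ℝ) ^ d) ^ ρ * (((2 : ℝ) ^ d) ^ n)⁻¹ * (((2 : ℝ) ^ d) ^ s)⁻¹ := by
        rw [hq, ← Real.rpow_natCast, ← Real.rpow_natCast ((2:ℝ)^d) n, ← Real.rpow_natCast 2 d,
          ← Real.rpow_mul (by norm_num), ← Real.rpow_mul (by norm_num), ← Real.rpow_mul (by norm_num),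
          ← Real.rpow_mul (by norm_num), ← Real.rpow_neg (by norm_num), ← Real.rpow_neg (by norm_num),
          ← Real.rpow_add (by norm_num), ← Real.rpow_add (by norm_num)]
        congr 1; ring
      rw [e1, e2]
      calc _ ≤ ((2 : ℝ) ^ j) ^ s * 4 ^ s * (((2 : ℝ) ^ d) ^ s)⁻¹ * B *
            (((4 : ℝ) ^ n * (((2 : ℝ) ^ d) ^ n)⁻¹) * ((2 : ℝ) ^ d) ^ ρ * Psi ρ N j x) := by
            gcongr; exact Psi_compare hρ0 h x
        _ = _ := by ring
    have hP := (Psi_pos ρ N j x).le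
    calc _ ≤ ∑ l ∈ Finset.range (j + 2 + 1), ‖k l x‖ := norm_sum_le _ _
      _ = ∑ d ∈ Finset.range (j + 2 + 1), ‖k (j + 2 + 1 - 1 - d) x‖ :=
          (Finset.sum_range_reflect (fun l => ‖k l x‖) (j + 2 + 1)).symm
      _ ≤ ∑ d ∈ Finset.range (j + 2 + 1), ((2 : ℝ) ^ j) ^ s * (4 ^ s * 4 ^ n * B) * Psi ρ N j x * q ^ d := by
          apply Finset.sum_le_sum
          intro d hd
          apply hterm
          have := Finset.mem_range.1 hd
          omega
      _ = ((2 : ℝ) ^ j) ^ s * (4 ^ s * 4 ^ n * B) * Psi ρ N j x * ∑ d ∈ Finset.range (j + 2 + 1), q ^ d := by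
          rw [Finset.mul_sum]
      _ ≤ ((2 : ℝ) ^ j) ^ s * (4 ^ s * 4 ^ n * B) * Psi ρ N j x * (1 - q)⁻¹ := by
          gcongr
          rw [← tsum_geometric_of_lt_one hq0 hq1]
          exact (summable_geometric_of_lt_one hq0 hq1).sum_le_tsum _ fun _ _ => by positivity
      _ = _ := by ring
  · rw [FT_sum]
    · simp only [(hk _).ft]
      rw [← Complex.ofReal_sum, ← Finset.sum_mul, md_sum, Far]
    · intro l _
      exact integrable_of_Psi hN hρ (hk l).cont (hk l).bd

/-- character e^{-i x·ξ} -/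
def ec {n : ℕ} (x ξ : Eu n) : ℂ := Complex.exp (-(Complex.I * ((⟪x, ξ⟫ : ℝ) : ℂ)))

theorem ec_norm {n : ℕ} (x ξ : Eu n) : ‖ec x ξ‖ = 1 := by
  rw [ec, show -(Complex.I * ((⟪x, ξ⟫ : ℝ) : ℂ)) = ((-(⟪x, ξ⟫ : ℝ) : ℝ) : ℂ) * Complex.I by
      push_cast; ring, Complex.norm_exp_ofReal_mul_I]

theorem ec_add {n : ℕ} (x y ξ : Eu n) : ec (x + y) ξ = ec x ξ * ec y ξ := by
  rw [ec, ec, ec, ← Complex.exp_add, inner_add_left]; congr 1; push_cast; ring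

theorem ec_add_right {n : ℕ} (x ξ η : Eu n) : ec x (ξ + η) = ec x ξ * ec x η := by
  rw [ec, ec, ec, ← Complex.exp_add, inner_add_right]; congr 1; push_cast; ring

theorem continuous_ec {n : ℕ} : Continuous fun p : Eu n × Eu n => ec p.1 p.2 := by
  unfold ec; fun_prop

@[fun_prop]
theorem Continuous.ec' {n : ℕ} {X : Type*} [TopologicalSpace X] {f g : X → Eu n}
    (hf : Continuous f) (hg : Continuous g) : Continuous fun x => ec (f x) (g x) :=
  continuous_ec.comp (hf.prodMk hg)

theorem measurable_ec {n : ℕ} {X : Type*} [MeasurableSpace X] {f g : X → Eu n}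
    (hf : Measurable f) (hg : Measurable g) : Measurable fun x => ec (f x) (g x) := by
  unfold ec
  exact Complex.measurable_exp.comp (((Complex.measurable_ofReal.comp (hf.inner hg)).const_mul _).neg)

theorem FT_eq {n : ℕ} (f : Eu n → ℂ) (ξ : Eu n) : FT f ξ = ∫ x, f x * ec x ξ := rfl

theorem FT_shift {n : ℕ} (f : Eu n → ℂ) (w ξ : Eu n) :
    ∫ x, f (x - w) * ec x ξ = ec w ξ * FT f ξ := by
  rw [FT_eq, ← integral_const_mul, ← integral_sub_right_eq_self (fun x => ec w ξ * (f x * ec x ξ)) w]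
  congr 1; ext x
  have : ec x ξ = ec (x - w) ξ * ec w ξ := by rw [← ec_add, sub_add_cancel]
  rw [this]; ring

theorem integrable_mul_ec {n : ℕ} {f : Eu n → ℂ} (hf : Integrable f) (ξ : Eu n) :
    Integrable fun x => f x * ec x ξ := by
  refine (hf.norm).mono' (hf.aestronglyMeasurable.mul
    (by fun_prop : Continuous fun x => ec x ξ).aestronglyMeasurable) ?_
  filter_upwards with x
  rw [norm_mul, ec_norm, mul_one]

def K2 {n : ℕ} (σ : Eu n → Eu n → ℂ) (c : ℝ≥0∞) (τ0 τ1 τ2 : Measure (Eu n)) : Prop :=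
  ∃ (ν : Measure (Eu n × Eu n × Eu n)) (b : Eu n × Eu n × Eu n → ℂ), SFinite ν ∧ Measurable b ∧
    Integrable b ν ∧ (∀ ξ η, σ ξ η = ∫ p, b p * ec p.2.1 ξ * ec p.2.2 η ∂ν) ∧
    ∀ H : Eu n → Eu n → ℝ≥0∞, Measurable (Function.uncurry H) →
      ∫⁻ p, ‖b p‖ₑ * H p.2.1 p.2.2 ∂ν ≤
        c * ∫⁻ u, ∫⁻ y, ∫⁻ z, H (u + y) (u + z) ∂τ2 ∂τ1 ∂τ0

theorem K2.mono {n : ℕ} {σ : Eu n → Eu n → ℂ} {c c' : ℝ≥0∞} {τ0 τ1 τ2 : Measure (Eu n)}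
    (h : K2 σ c τ0 τ1 τ2) (hc : c ≤ c') : K2 σ c' τ0 τ1 τ2 := by
  obtain ⟨ν, b, h1, h2, h3, h4, h5⟩ := h
  exact ⟨ν, b, h1, h2, h3, h4, fun H hH => (h5 H hH).trans (by gcongr)⟩

theorem K2_zero {n : ℕ} (c : ℝ≥0∞) (τ0 τ1 τ2 : Measure (Eu n)) :
    K2 (fun _ _ => 0) c τ0 τ1 τ2 :=
  ⟨0, 0, inferInstance, measurable_zero, integrable_zero _ _ _, by simp, by simp⟩

theorem K2_one {n : ℕ} :
    K2 (n := n) (fun _ _ => 1) 1 (Measure.dirac 0) (Measure.dirac 0) (Measure.dirac 0) := by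
  refine ⟨Measure.dirac 0, fun _ => 1, inferInstance, measurable_const, integrable_const _, ?_, ?_⟩
  · intro ξ η
    rw [integral_dirac]; simp [ec]
  · intro H hH
    have h1 : ∀ u y, ∫⁻ z, H (u + y) (u + z) ∂(Measure.dirac (0 : Eu n)) = H (u + y) u := by
      intro u y
      rw [lintegral_dirac' _ (by exact hH.comp (by fun_prop : Measurable fun z => (u + y, u + z)))]
      simp
    simp only [h1]
    have h2 : ∀ u, ∫⁻ y, H (u + y) u ∂(Measure.dirac (0 : Eu n)) = H u u := by
      intro u
      rw [lintegral_dirac' _ (by exact hH.comp (by fun_prop : Measurable fun y => (u + y, u)))]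
      simp
    simp only [h2]
    have h4 : Measurable fun y : Eu n => H y y :=
      hH.comp (by fun_prop : Measurable fun y : Eu n => (y, y))
    rw [lintegral_dirac' (0 : Eu n) h4]
    have h3 : Measurable fun p : Eu n × Eu n × Eu n => ‖(1:ℂ)‖ₑ * H p.2.1 p.2.2 :=
      measurable_const.mul (hH.comp (by fun_prop : Measurable fun p : Eu n × Eu n × Eu n => (p.2.1, p.2.2)))
    rw [lintegral_dirac' _ h3]
    simp

theorem K2.swap {n : ℕ} {σ : Eu n → Eu n → ℂ} {c : ℝ≥0∞} {τ0 τ1 τ2 : Measure (Eu n)}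
    [SFinite τ1] [SFinite τ2]
    (h : K2 σ c τ0 τ1 τ2) : K2 (fun ξ η => σ η ξ) c τ0 τ2 τ1 := by
  obtain ⟨ν, b, h1, h2, h3, h4, h5⟩ := h
  let S : Eu n × Eu n × Eu n ≃ᵐ Eu n × Eu n × Eu n :=
    (MeasurableEquiv.refl _).prodCongr MeasurableEquiv.prodComm
  have hS : ∀ p, S p = (p.1, p.2.2, p.2.1) := fun p => rfl
  have hmp : MeasurePreserving S ν (ν.map S) := S.measurable.measurePreserving ν
  have hb : ∀ p, b (S (S p)) = b p := fun p => rfl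
  refine ⟨ν.map S, fun p => b (S p), inferInstance, h2.comp S.measurable, ?_, ?_, ?_⟩
  · rw [← hmp.integrable_comp_emb S.measurableEmbedding]
    exact h3
  · intro ξ η
    show σ η ξ = _
    rw [h4, ← hmp.integral_comp S.measurableEmbedding]
    congr 1; ext p
    show _ = b (S (S p)) * ec (S p).2.1 ξ * ec (S p).2.2 η
    rw [hb, hS]; ring
  · intro H hH
    rw [← hmp.lintegral_comp_emb S.measurableEmbedding]
    refine (h5 (fun y z => H z y) (hH.comp measurable_swap)).trans ?_
    refine mul_le_mul_right (lintegral_mono fun u => le_of_eq ?_) _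
    refine lintegral_lintegral_swap ?_
    exact (hH.comp (by fun_prop : Measurable fun p : Eu n × Eu n => (u + p.2, u + p.1))).aemeasurable

/-- the triple average -/
theorem triple_eq {n : ℕ} (ρ N : ℝ) (i j : ℕ) (H : Eu n → Eu n → ℝ≥0∞)
    (hH : Measurable (Function.uncurry H)) :
    ∫⁻ u, ∫⁻ y, ∫⁻ z, H (u + y) (u + z) ∂(tauP n ρ N j) ∂(tauP n ρ N i) ∂(tauP n ρ N j) =
    ∫⁻ w, ∫⁻ y, ∫⁻ z, psE ρ N j w * (psE ρ N i (y - w) * psE ρ N j (z - w)) * H y z := by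
  have hm : Measurable fun q : Eu n × Eu n × Eu n => H (q.1 + q.2.1) (q.1 + q.2.2) :=
    hH.comp (by fun_prop : Measurable fun q : Eu n × Eu n × Eu n => (q.1 + q.2.1, q.1 + q.2.2))
  have m1 : Measurable fun q : Eu n × Eu n => ∫⁻ z, H (q.1 + q.2) (q.1 + z) ∂(tauP n ρ N j) := by
    have : Measurable fun q : (Eu n × Eu n) × Eu n => H (q.1.1 + q.1.2) (q.1.1 + q.2) :=
      hH.comp (by fun_prop : Measurable fun q : (Eu n × Eu n) × Eu n => (q.1.1 + q.1.2, q.1.1 + q.2))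
    exact this.lintegral_prod_right'
  rw [lintegral_tauP _ _ _ (m1.lintegral_prod_right')]
  congr 1; ext w
  have m2 : Measurable fun y => ∫⁻ z, H (w + y) (w + z) ∂(tauP n ρ N j) :=
    m1.comp (by fun_prop : Measurable fun y => (w, y))
  dsimp only
  rw [lintegral_tauP _ _ _ m2, ← lintegral_const_mul' _ _ (psE_ne_top _ _ _ _),
    ← lintegral_sub_right_eq_self _ w]
  congr 1; ext y
  have m3 : Measurable fun z => H (w + (y - w)) (w + z) :=
    hH.comp (by fun_prop : Measurable fun z => (w + (y - w), w + z))
  rw [lintegral_tauP _ _ _ m3, ← lintegral_const_mul' _ _ (psE_ne_top _ _ _ _),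
    ← lintegral_const_mul' _ _ (psE_ne_top _ _ _ _), ← lintegral_sub_right_eq_self _ w]
  congr 1; ext z
  rw [add_sub_cancel, add_sub_cancel]; ring

theorem triple_one {n : ℕ} {ρ N : ℝ} (hN : 0 ≤ N) (hρ : (n : ℝ) < ρ) (i j : ℕ) :
    ∫⁻ _u : Eu n, ∫⁻ _y : Eu n, ∫⁻ _z : Eu n, (1 : ℝ≥0∞) ∂(tauP n ρ N j) ∂(tauP n ρ N i) ∂(tauP n ρ N j) ≠ ∞ := by
  have h : ∀ j, tauP n ρ N j Set.univ ≠ ∞ := by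
    intro j
    have := psE_mass hN hρ j
    rw [← lintegral_one, lintegral_tauP _ _ _ measurable_const]
    simp only [mul_one]
    exact (this.trans_lt ENNReal.ofReal_lt_top).ne
  simp only [lintegral_const, one_mul]
  exact ENNReal.mul_ne_top (ENNReal.mul_ne_top (h _) (h _)) (h _)

/-- P3 integrated -/
theorem P3_int {n : ℕ} {ρ N : ℝ} (hN : 0 ≤ N) (hρ : (n : ℝ) < ρ) :
    ∃ C : ℝ≥0∞, C ≠ ∞ ∧ ∀ i j : ℕ, i ≤ j → ∀ H : Eu n → Eu n → ℝ≥0∞,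
      Measurable (Function.uncurry H) →
      ∫⁻ y, ∫⁻ z, psE ρ N i y * psE ρ N j z * H y z ≤ C *
        ∫⁻ w, ∫⁻ y, ∫⁻ z, psE ρ N j w * (psE ρ N i (y - w) * psE ρ N j (z - w)) * H y z := by
  have hρ0 : 0 ≤ ρ := (Nat.cast_nonneg n).trans hρ.le
  obtain ⟨C, hC, h⟩ := psE_P3 (n := n) hρ0 hN
  refine ⟨C, hC, fun i j hij H hH => ?_⟩
  have hp := measurable_psE (n := n) ρ N
  have M : Measurable fun q : (Eu n × Eu n) × Eu n =>
      psE ρ N j q.2 * (psE ρ N i (q.1.1 - q.2) * psE ρ N j (q.1.2 - q.2)) * H q.1.1 q.1.2 := by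
    have a1 : Measurable fun q : (Eu n × Eu n) × Eu n => psE ρ N j q.2 := (hp j).comp measurable_snd
    have a2 : Measurable fun q : (Eu n × Eu n) × Eu n => psE ρ N i (q.1.1 - q.2) :=
      (hp i).comp (measurable_fst.fst.sub measurable_snd)
    have a3 : Measurable fun q : (Eu n × Eu n) × Eu n => psE ρ N j (q.1.2 - q.2) :=
      (hp j).comp (measurable_fst.snd.sub measurable_snd)
    have a4 : Measurable fun q : (Eu n × Eu n) × Eu n => H q.1.1 q.1.2 := hH.comp measurable_fst
    exact (a1.mul (a2.mul a3)).mul a4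
  calc _ ≤ ∫⁻ y, ∫⁻ z, C * ∫⁻ w, psE ρ N j w * (psE ρ N i (y - w) * psE ρ N j (z - w)) * H y z := by
        refine lintegral_mono fun y => lintegral_mono fun z => ?_
        rw [lintegral_mul_const, ← mul_assoc]
        · exact mul_le_mul_left (h i j y z hij) _
        · have a2 : Measurable fun w => psE ρ N i (y - w) := (hp i).comp (by fun_prop)
          have a3 : Measurable fun w => psE ρ N j (z - w) := (hp j).comp (by fun_prop)
          exact (hp j).mul (a2.mul a3)
    _ = C * ∫⁻ y, ∫⁻ z, ∫⁻ w, psE ρ N j w * (psE ρ N i (y - w) * psE ρ N j (z - w)) * H y z := by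
        rw [← lintegral_const_mul' _ _ hC]
        congr 1; ext y
        rw [← lintegral_const_mul' _ _ hC]
    _ = _ := by
        congr 1
        have : ∀ y, ∫⁻ z, ∫⁻ w, psE ρ N j w * (psE ρ N i (y - w) * psE ρ N j (z - w)) * H y z =
            ∫⁻ w, ∫⁻ z, psE ρ N j w * (psE ρ N i (y - w) * psE ρ N j (z - w)) * H y z := by
          intro y
          refine lintegral_lintegral_swap ?_
          have q1 : Measurable fun p : Eu n × Eu n => ((y, p.1), p.2) := by fun_prop
          have q2 := M.comp q1
          exact q2.aemeasurable
        simp only [this]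
        refine lintegral_lintegral_swap ?_
        have M2 : Measurable fun q : (Eu n × Eu n) × Eu n =>
          psE ρ N j q.1.2 * (psE ρ N i (q.1.1 - q.1.2) * psE ρ N j (q.2 - q.1.2)) * H q.1.1 q.2 := by
          have q1 : Measurable fun p : (Eu n × Eu n) × Eu n => ((p.1.1, p.2), p.1.2) := by fun_prop
          have q2 := M.comp q1
          exact q2
        exact M2.lintegral_prod_right'.aemeasurable

theorem enorm_le_psE {n : ℕ} {ρ N B : ℝ} (hB : 0 ≤ B) {j : ℕ} {x : Eu n} {v : ℂ}
    (h : ‖v‖ ≤ B * Psi ρ N j x) : ‖v‖ₑ ≤ ENNReal.ofReal B * psE ρ N j x := by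
  rw [psE, ← ENNReal.ofReal_mul hB, ← ofReal_norm]
  exact ENNReal.ofReal_le_ofReal h

theorem K2_mk {n : ℕ} {ρ N : ℝ} (hN : 0 ≤ N) (hρ : (n : ℝ) < ρ) {i j : ℕ}
    {σ : Eu n → Eu n → ℂ} {c : ℝ≥0∞} (hc : c ≠ ∞)
    (ν : Measure (Eu n × Eu n × Eu n)) [SFinite ν] (b : Eu n × Eu n × Eu n → ℂ) (hb : Measurable b)
    (hσ : Integrable b ν → ∀ ξ η, σ ξ η = ∫ p, b p * ec p.2.1 ξ * ec p.2.2 η ∂ν)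
    (hH : ∀ H : Eu n → Eu n → ℝ≥0∞, Measurable (Function.uncurry H) →
      ∫⁻ p, ‖b p‖ₑ * H p.2.1 p.2.2 ∂ν ≤
        c * ∫⁻ w, ∫⁻ y, ∫⁻ z, psE ρ N j w * (psE ρ N i (y - w) * psE ρ N j (z - w)) * H y z) :
    K2 σ c (tauP n ρ N j) (tauP n ρ N i) (tauP n ρ N j) := by
  have hint : Integrable b ν := by
    refine ⟨hb.aestronglyMeasurable, ?_⟩
    have := hH (fun _ _ => 1) measurable_const
    rw [← triple_eq _ _ _ _ _ measurable_const] at this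
    simp only [mul_one] at this
    exact this.trans_lt (ENNReal.mul_lt_top hc.lt_top (triple_one hN hρ i j).lt_top)
  refine ⟨ν, b, inferInstance, hb, hint, hσ hint, fun H h => ?_⟩
  rw [triple_eq _ _ _ _ _ h]
  exact hH H h

theorem integrable_b_ec {n : ℕ} {ν : Measure (Eu n × Eu n × Eu n)} {b : Eu n × Eu n × Eu n → ℂ}
    (hb : Integrable b ν) (ξ η : Eu n) :
    Integrable (fun p => b p * ec p.2.1 ξ * ec p.2.2 η) ν := by
  have m1 : Measurable fun p : Eu n × Eu n × Eu n => ec p.2.1 ξ :=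
    measurable_ec measurable_snd.fst measurable_const
  have m2 : Measurable fun p : Eu n × Eu n × Eu n => ec p.2.2 η :=
    measurable_ec measurable_snd.snd measurable_const
  refine hb.norm.mono' ((hb.aestronglyMeasurable.mul m1.aestronglyMeasurable).mul
    m2.aestronglyMeasurable) ?_
  filter_upwards with p
  rw [norm_mul, norm_mul, ec_norm, ec_norm, mul_one, mul_one]

theorem K2_T2 {n : ℕ} {ρ N γ : ℝ} (hN : 0 ≤ N) (hρ : (n : ℝ) < ρ) :
    ∃ C : ℝ≥0∞, C ≠ ∞ ∧ ∀ (i j : ℕ) (B B2 : ℝ) (k k2 g g2 : Eu n → ℂ), i ≤ j → 0 ≤ B → 0 ≤ B2 →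
      IsKer ρ N γ B i k g → IsKer ρ N γ B2 j k2 g2 →
      K2 (fun ξ η => g ξ * g2 η) (C * ENNReal.ofReal (B * B2))
        (tauP n ρ N j) (tauP n ρ N i) (tauP n ρ N j) := by
  obtain ⟨C, hC, hP⟩ := P3_int (n := n) hN hρ
  refine ⟨C, hC, fun i j B B2 k k2 g g2 hij hB hB2 hk hk2 => ?_⟩
  have he : MeasurableEmbedding (Prod.mk (0 : Eu n) : Eu n × Eu n → Eu n × Eu n × Eu n) :=
    measurableEmbedding_prodMk_left 0
  have mk1 := hk.cont.measurable
  have mk2 := hk2.cont.measurable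
  have hb : Measurable fun p : Eu n × Eu n × Eu n => k p.2.1 * k2 p.2.2 :=
    (mk1.comp measurable_snd.fst).mul (mk2.comp measurable_snd.snd)
  refine K2_mk hN hρ (by finiteness) ((volume : Measure (Eu n × Eu n)).map (Prod.mk 0))
    (fun p => k p.2.1 * k2 p.2.2) hb ?_ ?_
  · intro hint ξ η
    rw [he.integral_map]
    have : ∀ q : Eu n × Eu n, k q.1 * k2 q.2 * ec q.1 ξ * ec q.2 η =
      (k q.1 * ec q.1 ξ) * (k2 q.2 * ec q.2 η) := fun q => by ring
    simp only [this]
    rw [Measure.volume_eq_prod, integral_prod_mul (fun y => k y * ec y ξ) (fun z => k2 z * ec z η), ← FT_eq, ← FT_eq, hk.ft, hk2.ft]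
  · intro H hH
    have m1 : Measurable fun p : Eu n × Eu n => ‖k p.1 * k2 p.2‖ₑ * H p.1 p.2 :=
      ((mk1.comp measurable_fst).mul (mk2.comp measurable_snd)).enorm.mul hH
    rw [he.lintegral_map, Measure.volume_eq_prod, lintegral_prod _ m1.aemeasurable]
    calc _ ≤ ∫⁻ y, ∫⁻ z, ENNReal.ofReal (B * B2) * (psE ρ N i y * psE ρ N j z * H y z) := by
          refine lintegral_mono fun y => lintegral_mono fun z => ?_
          dsimp only
          rw [enorm_mul, ENNReal.ofReal_mul hB]
          have a1 := enorm_le_psE hB (hk.bd y)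
          have a2 := enorm_le_psE hB2 (hk2.bd z)
          calc _ ≤ (ENNReal.ofReal B * psE ρ N i y) * (ENNReal.ofReal B2 * psE ρ N j z) * H y z :=
                mul_le_mul_left (mul_le_mul' a1 a2) _
            _ = _ := by ring
      _ = ENNReal.ofReal (B * B2) * ∫⁻ y, ∫⁻ z, (psE ρ N i y * psE ρ N j z * H y z) := by
          rw [← lintegral_const_mul' _ _ ENNReal.ofReal_ne_top]
          congr 1; ext y
          rw [← lintegral_const_mul' _ _ ENNReal.ofReal_ne_top]
      _ ≤ ENNReal.ofReal (B * B2) * (C * _) := mul_le_mul_right (hP i j hij H hH) _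
      _ = _ := by ring

theorem Psi_gain {n : ℕ} {ρ N γ : ℝ} (hγ : 0 ≤ γ) {i j : ℕ} (hij : i ≤ j) (w : Eu n) :
    Psi (ρ + γ) N j w * (2 ^ i * ‖w‖) ^ γ ≤ ((2 : ℝ) ^ (j - i)) ^ (-γ) * Psi ρ N j w := by
  unfold Psi
  have h1 : (2 : ℝ) ^ i * ‖w‖ = ((2 : ℝ) ^ (j - i))⁻¹ * (2 ^ j * ‖w‖) := by
    have : (2 : ℝ) ^ j = 2 ^ (j - i) * 2 ^ i := by rw [← pow_add]; congr 1; omega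
    rw [this]; field_simp
  have h2 : (2 ^ i * ‖w‖) ^ γ ≤ ((2 : ℝ) ^ (j - i)) ^ (-γ) * (1 + 2 ^ j * ‖w‖) ^ γ := by
    rw [h1, Real.mul_rpow (by positivity) (by positivity), Real.inv_rpow (by positivity),
      ← Real.rpow_neg (by positivity)]
    gcongr
    linarith
  have h3 : (1 + 2 ^ j * ‖w‖) ^ (-(ρ + γ)) * (1 + 2 ^ j * ‖w‖) ^ γ = (1 + 2 ^ j * ‖w‖) ^ (-ρ) := by
    rw [← Real.rpow_add (by positivity)]; congr 1; ring
  calc _ ≤ (2 ^ j) ^ n * (1 + 2 ^ j * ‖w‖) ^ (-(ρ + γ)) * (1 + ‖w‖) ^ (-N) *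
        (((2 : ℝ) ^ (j - i)) ^ (-γ) * (1 + 2 ^ j * ‖w‖) ^ γ) := by gcongr
    _ = (2 ^ j) ^ n * ((1 + 2 ^ j * ‖w‖) ^ (-(ρ + γ)) * (1 + 2 ^ j * ‖w‖) ^ γ) * (1 + ‖w‖) ^ (-N) *
        ((2 : ℝ) ^ (j - i)) ^ (-γ) := by ring
    _ = _ := by rw [h3]; ring

set_option maxHeartbeats 1000000 in
theorem K2_T1 {n : ℕ} {ρ N γ : ℝ} (hN : 0 ≤ N) (hρ : (n : ℝ) < ρ) (hγ : 0 ≤ γ) :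
    ∃ C : ℝ≥0∞, C ≠ ∞ ∧ ∀ (i j : ℕ) (Bh B B2 : ℝ) (h k k2 gh g g2 : Eu n → ℂ), i ≤ j →
      0 ≤ Bh → 0 ≤ B → 0 ≤ B2 → Continuous h → (∀ x, ‖h x‖ ≤ Bh * Psi (ρ + γ) N j x) →
      (∀ ξ, FT h ξ = gh ξ) →
      IsKer ρ N γ B i k g → IsKer ρ N γ B2 j k2 g2 →
      K2 (fun ξ η => (gh (ξ + η) - gh η) * (g ξ * g2 η))
        (C * ENNReal.ofReal (Bh * B * B2 * ((2 : ℝ) ^ (j - i)) ^ (-γ)))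
        (tauP n ρ N j) (tauP n ρ N i) (tauP n ρ N j) := by
  obtain ⟨C, hC, hP⟩ := P3_int (n := n) hN hρ
  obtain ⟨C2, hC2, hcv⟩ := psE_conv (n := n) hN hρ
  refine ⟨1 + C2 * C, by finiteness, fun i j Bh B B2 h k k2 gh g g2 hij hBh hB hB2 hhc hh hhf hk hk2 => ?_⟩
  have mh := hhc.measurable
  have mk1 := hk.cont.measurable
  have mk2 := hk2.cont.measurable
  have ik := integrable_of_Psi hN hρ hk.cont hk.bd
  have ik2 := integrable_of_Psi hN hρ hk2.cont hk2.bd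
  have ih : Integrable h := integrable_of_Psi hN (by linarith) hhc hh
  have hp := measurable_psE (n := n) ρ N
  have a1 : Measurable fun p : Eu n × Eu n × Eu n => k (p.2.1 - p.1) :=
    mk1.comp (measurable_snd.fst.sub measurable_fst)
  have a2 : Measurable fun p : Eu n × Eu n × Eu n => k p.2.1 := mk1.comp measurable_snd.fst
  have a3 : Measurable fun p : Eu n × Eu n × Eu n => k2 (p.2.2 - p.1) :=
    mk2.comp (measurable_snd.snd.sub measurable_fst)
  have a4 : Measurable fun p : Eu n × Eu n × Eu n => h p.1 := mh.comp measurable_fst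
  have hb : Measurable fun p : Eu n × Eu n × Eu n =>
      h p.1 * (k (p.2.1 - p.1) - k p.2.1) * k2 (p.2.2 - p.1) := (a4.mul (a1.sub a2)).mul a3
  refine K2_mk hN hρ (by finiteness) volume _ hb ?_ ?_
  · intro hint ξ η
    have hint2 := integrable_b_ec hint ξ η
    rw [Measure.volume_eq_prod] at hint2 ⊢
    rw [integral_prod _ hint2]
    have key : ∀ w, ∫ q : Eu n × Eu n, h w * (k (q.1 - w) - k q.1) * k2 (q.2 - w) * ec q.1 ξ * ec q.2 η =
        (h w * ec w (ξ + η) - h w * ec w η) * (g ξ * g2 η) := by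
      intro w
      have : ∀ q : Eu n × Eu n, h w * (k (q.1 - w) - k q.1) * k2 (q.2 - w) * ec q.1 ξ * ec q.2 η =
        (h w * (k (q.1 - w) * ec q.1 ξ - k q.1 * ec q.1 ξ)) * (k2 (q.2 - w) * ec q.2 η) :=
        fun q => by ring
      simp only [this]
      rw [Measure.volume_eq_prod, integral_prod_mul
        (fun y => h w * (k (y - w) * ec y ξ - k y * ec y ξ)) (fun z => k2 (z - w) * ec z η),
        FT_shift, integral_const_mul, integral_sub, FT_shift, ← FT_eq, hk.ft, hk2.ft, ec_add_right]
      · ring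
      · exact integrable_mul_ec (ik.comp_sub_right w) ξ
      · exact integrable_mul_ec ik ξ
    simp only [key]
    rw [integral_mul_const, integral_sub (integrable_mul_ec ih _) (integrable_mul_ec ih _),
      ← FT_eq, ← FT_eq, hhf, hhf]
  · intro H hH
    set c := ENNReal.ofReal (Bh * B * B2 * ((2 : ℝ) ^ (j - i)) ^ (-γ)) with hc
    have hcT : c ≠ ∞ := ENNReal.ofReal_ne_top
    have mH : Measurable fun p : Eu n × Eu n × Eu n => H p.2.1 p.2.2 := hH.comp measurable_snd
    have hpt : ∀ p : Eu n × Eu n × Eu n, ‖h p.1 * (k (p.2.1 - p.1) - k p.2.1) * k2 (p.2.2 - p.1)‖ₑ ≤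
        c * (psE ρ N j p.1 * (psE ρ N i (p.2.1 - p.1) * psE ρ N j (p.2.2 - p.1)) +
          psE ρ N j p.1 * (psE ρ N i p.2.1 * psE ρ N j (p.2.2 - p.1))) := by
      rintro ⟨w, y, z⟩
      dsimp only
      have P1 := (Psi_pos ρ N j w).le
      have P2 := (Psi_pos ρ N i (y - w)).le
      have P3 := (Psi_pos ρ N j (z - w)).le
      have P4 := (Psi_pos ρ N i y).le
      have P5 := (Psi_pos (ρ + γ) N j w).le
      have : ‖h w * (k (y - w) - k y) * k2 (z - w)‖ ≤ (Bh * B * B2 * ((2 : ℝ) ^ (j - i)) ^ (-γ)) *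
          (Psi ρ N j w * (Psi ρ N i (y - w) * Psi ρ N j (z - w)) +
          Psi ρ N j w * (Psi ρ N i y * Psi ρ N j (z - w))) := by
        rw [norm_mul, norm_mul]
        calc _ ≤ (Bh * Psi (ρ + γ) N j w) * (B * (2 ^ i * ‖w‖) ^ γ * (Psi ρ N i (y - w) + Psi ρ N i y)) *
              (B2 * Psi ρ N j (z - w)) := by
              gcongr
              · exact hh w
              · exact hk.df y w
              · exact hk2.bd _
          _ = Bh * B * B2 * (Psi (ρ + γ) N j w * (2 ^ i * ‖w‖) ^ γ) *
              ((Psi ρ N i (y - w) + Psi ρ N i y) * Psi ρ N j (z - w)) := by ring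
          _ ≤ Bh * B * B2 * (((2 : ℝ) ^ (j - i)) ^ (-γ) * Psi ρ N j w) *
              ((Psi ρ N i (y - w) + Psi ρ N i y) * Psi ρ N j (z - w)) := by
              exact mul_le_mul_of_nonneg_right
                (mul_le_mul_of_nonneg_left (Psi_gain hγ hij w) (by positivity)) (by positivity)
          _ = _ := by ring
      rw [← ofReal_norm]
      refine (ENNReal.ofReal_le_ofReal this).trans (le_of_eq ?_)
      rw [ENNReal.ofReal_mul (by positivity), ENNReal.ofReal_add (by positivity) (by positivity)]
      simp only [psE, hc]
      rw [ENNReal.ofReal_mul P1, ENNReal.ofReal_mul P2, ENNReal.ofReal_mul P1, ENNReal.ofReal_mul P4]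
    have n1 : Measurable fun p : Eu n × Eu n × Eu n => psE ρ N j p.1 := (hp j).comp measurable_fst
    have n2 : Measurable fun p : Eu n × Eu n × Eu n => psE ρ N i (p.2.1 - p.1) :=
      (hp i).comp (measurable_snd.fst.sub measurable_fst)
    have n3 : Measurable fun p : Eu n × Eu n × Eu n => psE ρ N j (p.2.2 - p.1) :=
      (hp j).comp (measurable_snd.snd.sub measurable_fst)
    have n4 : Measurable fun p : Eu n × Eu n × Eu n => psE ρ N i p.2.1 := (hp i).comp measurable_snd.fst
    have M1 : Measurable fun p : Eu n × Eu n × Eu n =>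
      psE ρ N j p.1 * (psE ρ N i (p.2.1 - p.1) * psE ρ N j (p.2.2 - p.1)) * H p.2.1 p.2.2 :=
      (n1.mul (n2.mul n3)).mul mH
    have M2 : Measurable fun p : Eu n × Eu n × Eu n =>
      psE ρ N j p.1 * (psE ρ N i p.2.1 * psE ρ N j (p.2.2 - p.1)) * H p.2.1 p.2.2 :=
      (n1.mul (n4.mul n3)).mul mH
    set I := ∫⁻ w, ∫⁻ y, ∫⁻ z, psE ρ N j w * (psE ρ N i (y - w) * psE ρ N j (z - w)) * H y z with hI
    have I1 : ∫⁻ p : Eu n × Eu n × Eu n,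
        psE ρ N j p.1 * (psE ρ N i (p.2.1 - p.1) * psE ρ N j (p.2.2 - p.1)) * H p.2.1 p.2.2 = I := by
      rw [Measure.volume_eq_prod, lintegral_prod _ M1.aemeasurable]
      congr 1; ext w
      have q1 : Measurable fun q : Eu n × Eu n => (w, q) := measurable_prodMk_left
      have q2 : Measurable fun q : Eu n × Eu n =>
        psE ρ N j w * (psE ρ N i (q.1 - w) * psE ρ N j (q.2 - w)) * H q.1 q.2 := by
        have q3 := M1.comp q1
        exact q3
      rw [Measure.volume_eq_prod, lintegral_prod _ q2.aemeasurable]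
    have I2 : ∫⁻ p : Eu n × Eu n × Eu n,
        psE ρ N j p.1 * (psE ρ N i p.2.1 * psE ρ N j (p.2.2 - p.1)) * H p.2.1 p.2.2 ≤ C2 * (C * I) := by
      rw [Measure.volume_eq_prod, lintegral_prod_symm _ M2.aemeasurable]
      calc _ ≤ ∫⁻ q : Eu n × Eu n, C2 * (psE ρ N i q.1 * psE ρ N j q.2 * H q.1 q.2) := by
            refine lintegral_mono fun q => ?_
            dsimp only
            have e : ∀ w, psE ρ N j w * (psE ρ N i q.1 * psE ρ N j (q.2 - w)) * H q.1 q.2 =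
              (psE ρ N j w * psE ρ N j (q.2 - w)) * (psE ρ N i q.1 * H q.1 q.2) := fun w => by ring
            simp only [e]
            have b1 : Measurable fun w => psE ρ N j (q.2 - w) :=
              (hp j).comp (measurable_const.sub measurable_id)
            have b2 : Measurable fun w => psE ρ N j w * psE ρ N j (q.2 - w) := (hp j).mul b1
            rw [lintegral_mul_const _ b2]
            calc _ ≤ (C2 * psE ρ N j q.2) * (psE ρ N i q.1 * H q.1 q.2) :=
                  mul_le_mul_left (hcv j q.2) _
              _ = _ := by ring
        _ = C2 * ∫⁻ y, ∫⁻ z, psE ρ N i y * psE ρ N j z * H y z := by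
            rw [lintegral_const_mul' _ _ hC2]
            congr 1
            have M3 : Measurable fun q : Eu n × Eu n => psE ρ N i q.1 * psE ρ N j q.2 * H q.1 q.2 :=
              (((hp i).comp measurable_fst).mul ((hp j).comp measurable_snd)).mul hH
            rw [Measure.volume_eq_prod, lintegral_prod _ M3.aemeasurable]
        _ ≤ _ := mul_le_mul_right (hP i j hij H hH) _
    calc _ ≤ ∫⁻ p : Eu n × Eu n × Eu n, c *
          ((psE ρ N j p.1 * (psE ρ N i (p.2.1 - p.1) * psE ρ N j (p.2.2 - p.1)) * H p.2.1 p.2.2) +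
          (psE ρ N j p.1 * (psE ρ N i p.2.1 * psE ρ N j (p.2.2 - p.1)) * H p.2.1 p.2.2)) := by
          refine lintegral_mono fun p => ?_
          refine (mul_le_mul_left (hpt p) _).trans (le_of_eq ?_)
          ring
      _ = c * (I + ∫⁻ p : Eu n × Eu n × Eu n,
          (psE ρ N j p.1 * (psE ρ N i p.2.1 * psE ρ N j (p.2.2 - p.1)) * H p.2.1 p.2.2)) := by
          rw [lintegral_const_mul' _ _ hcT, lintegral_add_left M1, I1]
      _ ≤ c * (I + C2 * (C * I)) := by gcongr
      _ = _ := by ring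

theorem tele_one {q v : ℝ} (hq : 1 < q) (hv : 0 < v) :
    min v v⁻¹ ≤ (2 * (q + 1) / (q - 1)) * (q * v / (1 + q * v) - v / (1 + v)) := by
  have hq1 : 0 < q - 1 := by linarith
  have hq0 : 0 < q := by linarith
  have e : (2 * (q + 1) / (q - 1)) * (q * v / (1 + q * v) - v / (1 + v)) =
      (2 * (q + 1)) * v / ((1 + v) * (1 + q * v)) := by
    have h1 : 1 + q * v ≠ 0 := by positivity
    have h2 : 1 + v ≠ 0 := by positivity
    field_simp
    ring
  rw [e]
  rcases le_total v 1 with h | h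
  · refine (min_le_left _ _).trans ?_
    rw [le_div_iff₀ (by positivity)]
    have h1 : (1 + v) * (1 + q * v) ≤ 2 * (q + 1) := by nlinarith [mul_le_mul_of_nonneg_left h hq0.le]
    nlinarith
  · refine (min_le_right _ _).trans ?_
    rw [le_div_iff₀ (by positivity), inv_mul_le_iff₀ hv]
    have h1 : 1 + v ≤ 2 * v := by linarith
    have h2 : 1 + q * v ≤ (q + 1) * v := by nlinarith
    calc (1 + v) * (1 + q * v) ≤ (2 * v) * ((q + 1) * v) := by gcongr
      _ = _ := by ring

theorem tele_sum {q t : ℝ} (hq : 1 < q) (ht : 0 < t) :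
    ∑' i : ℕ, ENNReal.ofReal (min (t * q ^ i) (t * q ^ i)⁻¹) ≤ ENNReal.ofReal (2 * (q + 1) / (q - 1)) := by
  have hq0 : 0 < q := by linarith
  apply ENNReal.tsum_le_of_sum_range_le
  intro M
  rw [← ENNReal.ofReal_sum_of_nonneg (fun i _ => by positivity)]
  apply ENNReal.ofReal_le_ofReal
  have hK : 0 ≤ 2 * (q + 1) / (q - 1) := div_nonneg (by positivity) (by linarith)
  calc _ ≤ ∑ i ∈ Finset.range M, (2 * (q + 1) / (q - 1)) *
        (t * q ^ (i + 1) / (1 + t * q ^ (i + 1)) - t * q ^ i / (1 + t * q ^ i)) := by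
        refine Finset.sum_le_sum fun i _ => ?_
        have := tele_one hq (v := t * q ^ i) (by positivity)
        rw [show q * (t * q ^ i) = t * q ^ (i + 1) by ring] at this
        exact this
    _ = (2 * (q + 1) / (q - 1)) * (t * q ^ M / (1 + t * q ^ M) - t * q ^ 0 / (1 + t * q ^ 0)) := by
        rw [← Finset.mul_sum, Finset.sum_range_sub (fun i => t * q ^ i / (1 + t * q ^ i))]
    _ ≤ (2 * (q + 1) / (q - 1)) * 1 := by
        gcongr
        have h1 : t * q ^ M / (1 + t * q ^ M) ≤ 1 := by
          rw [div_le_one (by positivity)]; linarith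
        have h2 : 0 ≤ t * q ^ 0 / (1 + t * q ^ 0) := by positivity
        linarith
    _ = _ := mul_one _

theorem min_sum {q : ℝ} (hq : 1 < q) (a b : ℝ≥0∞) :
    ∑' i : ℕ, min (a * ENNReal.ofReal (q ^ i)) (b * ENNReal.ofReal ((q ^ i)⁻¹)) ≤
      ENNReal.ofReal (2 * (q + 1) / (q - 1)) * (a * b) ^ (1 / 2 : ℝ) := by
  have hq0 : 0 < q := by linarith
  have hK : 0 < 2 * (q + 1) / (q - 1) := div_pos (by positivity) (by linarith)
  by_cases ha : a = 0
  · simp [ha]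
  by_cases hb : b = 0
  · simp [hb]
  by_cases haT : a = ∞
  · rw [haT, ENNReal.top_mul hb, ENNReal.top_rpow_of_pos (by norm_num), ENNReal.mul_top]
    · exact le_top
    · simpa using hK
  by_cases hbT : b = ∞
  · rw [hbT, ENNReal.mul_top ha, ENNReal.top_rpow_of_pos (by norm_num), ENNReal.mul_top]
    · exact le_top
    · simpa using hK
  lift a to ℝ≥0 using haT
  lift b to ℝ≥0 using hbT
  have ha' : 0 < (a : ℝ) := by
    have : a ≠ 0 := by simpa using ha
    positivity
  have hb' : 0 < (b : ℝ) := by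
    have : b ≠ 0 := by simpa using hb
    positivity
  have key : ∀ i : ℕ, min ((a : ℝ≥0∞) * ENNReal.ofReal (q ^ i)) (b * ENNReal.ofReal ((q ^ i)⁻¹)) =
      ENNReal.ofReal (√(a * b)) * ENNReal.ofReal (min (√(a / b) * q ^ i) (√(a / b) * q ^ i)⁻¹) := by
    intro i
    rw [← ENNReal.ofReal_mul (by positivity), mul_min_of_nonneg _ _ (by positivity),
      ← ENNReal.ofReal_coe_nnreal, ← ENNReal.ofReal_coe_nnreal, ← ENNReal.ofReal_mul (by positivity),
      ← ENNReal.ofReal_mul (by positivity)]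
    have h1 : √((a : ℝ) * b) * (√((a : ℝ) / b) * q ^ i) = a * q ^ i := by
      rw [← mul_assoc, ← Real.sqrt_mul (by positivity)]
      rw [show (a : ℝ) * b * (a / b) = a * a by field_simp, Real.sqrt_mul_self ha'.le]
    have h2 : √((a : ℝ) * b) * (√((a : ℝ) / b) * q ^ i)⁻¹ = b * (q ^ i)⁻¹ := by
      rw [mul_inv, ← mul_assoc, ← Real.sqrt_inv, ← Real.sqrt_mul (by positivity)]
      rw [show (a : ℝ) * b * ((a : ℝ) / (b : ℝ))⁻¹ = (b : ℝ) * b by field_simp, Real.sqrt_mul_self hb'.le]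
    rw [h1, h2, ENNReal.ofReal_min]
  simp only [key]
  rw [ENNReal.tsum_mul_left, mul_comm]
  have h3 : ENNReal.ofReal (√((a : ℝ) * b)) = ((a : ℝ≥0∞) * b) ^ (1 / 2 : ℝ) := by
    rw [Real.sqrt_eq_rpow, ← ENNReal.ofReal_rpow_of_nonneg (by positivity) (by norm_num),
      ENNReal.ofReal_mul (by positivity), ENNReal.ofReal_coe_nnreal, ENNReal.ofReal_coe_nnreal]
  rw [h3]
  exact mul_le_mul_left (tele_sum hq (by positivity)) _

/-- half power of the Bessel symbol -/
def bp (s : ℝ) (ε : Bool) : ℝ := if ε then s / 2 else 0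

def ww (s γ : ℝ) (i j : ℕ) (e : Bool × Bool) : ℝ :=
  ((2 : ℝ) ^ j) ^ s * ((4 : ℝ) ^ i) ^ (-bp s e.1) * ((4 : ℝ) ^ j) ^ (-bp s e.2) * ((2 : ℝ) ^ (j - i)) ^ (-γ)

theorem four_rpow (i : ℕ) (s : ℝ) : ((4 : ℝ) ^ i) ^ (-(s / 2)) = ((2 : ℝ) ^ i) ^ (-s) := by
  rw [show (4 : ℝ) ^ i = ((2 : ℝ) ^ i) ^ (2 : ℝ) by
    rw [Real.rpow_two, ← pow_mul, mul_comm, pow_mul]; norm_num]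
  rw [← Real.rpow_mul (by positivity)]; congr 1; ring

def SL : Set (Bool × Bool) := {(false, false), (false, true), (true, true)}

theorem ofReal_rpow' {x : ℝ} (hx : 0 < x) (p : ℝ) : ENNReal.ofReal x ^ p = ENNReal.ofReal (x ^ p) :=
  ENNReal.ofReal_rpow_of_pos hx

/-- the sum estimate in the region L -/
theorem sum_L {s γ r0 : ℝ} (hγ : 0 < γ) (hγs : γ ≤ s) (hr0 : 0 < r0) {K : ℝ≥0∞} (hK : K ≠ ∞) :
    ∃ C : ℝ≥0∞, C ≠ ∞ ∧ ∀ (c : Bool × Bool → ℝ≥0∞),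
      c (false, false) * c (true, true) = c (true, false) * c (false, true) →
      ∀ u : ℕ × ℕ → ℝ≥0∞, (∀ p, p.2 < p.1 → u p = 0) →
      (∀ i j, i ≤ j → ∀ e ∈ SL, u (i, j) ≤ K * ENNReal.ofReal (ww s γ i j e) * c e) →
      ∑' p, u p ^ r0 ≤ C * (c (true, false) ^ (γ / s / 2) * c (false, true) ^ (1 - γ / s / 2)) ^ r0 := by
  have hs : 0 < s := hγ.trans_le hγs
  set ε := γ / s with hε
  have hε0 : 0 < ε := by positivity
  have hε1 : ε ≤ 1 := by rw [hε, div_le_one hs]; exact hγs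
  set q : ℝ := 2 ^ (γ * r0) with hq
  have hq1 : 1 < q := Real.one_lt_rpow (by norm_num) (by positivity)
  set C1 := ENNReal.ofReal (2 * (q + 1) / (q - 1)) with hC1
  set x : ℝ≥0∞ := ENNReal.ofReal (2 ^ (-(γ * r0 / 2))) with hx
  have hx1 : x < 1 := by
    rw [hx, ENNReal.ofReal_lt_one]
    exact Real.rpow_lt_one_of_one_lt_of_neg (by norm_num) (by linarith [mul_pos hγ hr0])
  refine ⟨K ^ r0 * C1 * (1 - x)⁻¹, ?_, fun c hc u hu0 hu => ?_⟩
  · have h1 : K ^ r0 ≠ ∞ := by finiteness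
    have h2 : (1 - x)⁻¹ ≠ ∞ := by
      rw [ENNReal.inv_ne_top]; exact (tsub_pos_of_lt hx1).ne'
    have h3 : C1 ≠ ∞ := ENNReal.ofReal_ne_top
    exact ENNReal.mul_ne_top (ENNReal.mul_ne_top h1 h3) h2
  -- reindex
  have hinj : Function.Injective (fun p : ℕ × ℕ => ((p.2, p.2 + p.1) : ℕ × ℕ)) := by
    rintro ⟨a, b⟩ ⟨a', b'⟩ h
    simp only [Prod.mk.injEq] at h ⊢
    omega
  have hre : ∑' p, u p ^ r0 = ∑' p : ℕ × ℕ, u (p.2, p.2 + p.1) ^ r0 := by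
    refine (hinj.tsum_eq (f := fun p => u p ^ r0) ?_).symm
    rintro ⟨i, j⟩ hp
    by_cases hij : j < i
    · exfalso; apply hp
      show u (i, j) ^ r0 = 0
      rw [hu0 _ hij, ENNReal.zero_rpow_of_pos hr0]
    · exact ⟨(j - i, i), by show (i, i + (j - i)) = (i, j); congr; omega⟩
  rw [hre, ENNReal.tsum_prod (f := fun d i => u (i, i + d) ^ r0)]
  set c00 := c (false, false)
  set c01 := c (false, true)
  set c10 := c (true, false)
  set c11 := c (true, true)
  set Y := (c10 ^ (ε / 2) * c01 ^ (1 - ε / 2)) ^ r0 with hY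
  -- pointwise
  have hpt : ∀ d i : ℕ, u (i, i + d) ^ r0 ≤ (K ^ r0 * ENNReal.ofReal (((2 : ℝ) ^ d) ^ (-(γ * r0)))) *
      (c01 ^ ((1 - ε) * r0)) *
      min ((c00 ^ (ε * r0) * ENNReal.ofReal (((2 : ℝ) ^ d) ^ (γ * r0))) * ENNReal.ofReal (q ^ i))
        (c11 ^ (ε * r0) * ENNReal.ofReal ((q ^ i)⁻¹)) := by
    intro d i
    have hle : i ≤ i + d := by omega
    have b00 := hu i (i + d) hle (false, false) (by simp [SL])
    have b01 := hu i (i + d) hle (false, true) (by simp [SL])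
    have b11 := hu i (i + d) hle (true, true) (by simp [SL])
    have hd : i + d - i = d := by omega
    have w00 : ww s γ i (i + d) (false, false) = ((2 : ℝ) ^ d) ^ (-γ) * ((2 : ℝ) ^ (i + d)) ^ s := by
      simp only [ww, bp, hd]; simp; ring
    have w01 : ww s γ i (i + d) (false, true) = ((2 : ℝ) ^ d) ^ (-γ) := by
      simp only [ww, bp, hd, if_true, four_rpow]
      rw [Real.rpow_neg (by positivity) s]
      have : (0:ℝ) < ((2 : ℝ) ^ (i + d)) ^ s := by positivity
      simp; field_simp
    have w11 : ww s γ i (i + d) (true, true) = ((2 : ℝ) ^ d) ^ (-γ) * (((2 : ℝ) ^ i) ^ s)⁻¹ := by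
      simp only [ww, bp, hd, if_true, four_rpow]
      rw [Real.rpow_neg (by positivity) s, Real.rpow_neg (by positivity) s]
      have : (0:ℝ) < ((2 : ℝ) ^ (i + d)) ^ s := by positivity
      field_simp
    rw [w00, ENNReal.ofReal_mul (by positivity)] at b00
    rw [w01] at b01
    rw [w11, ENNReal.ofReal_mul (by positivity)] at b11
    set D := ENNReal.ofReal (((2 : ℝ) ^ d) ^ (-γ)) with hD
    have hDr : ENNReal.ofReal (((2 : ℝ) ^ d) ^ (-(γ * r0))) = D ^ r0 := by
      rw [hD, ofReal_rpow' (by positivity), ← Real.rpow_mul (by positivity)]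
      congr 2; ring
    have split : ∀ X : ℝ≥0∞, X ^ r0 = X ^ ((1 - ε) * r0) * X ^ (ε * r0) := by
      intro X
      rw [← ENNReal.rpow_add_of_nonneg _ _ (by have : 0 ≤ 1 - ε := by linarith
                                               positivity) (by positivity)]
      congr 1; ring
    have hε1' : 0 ≤ (1 - ε) * r0 := mul_nonneg (by linarith) hr0.le
    have hεr : 0 ≤ ε * r0 := by positivity
    have hεs : s * (ε * r0) = γ * r0 := by rw [hε]; field_simp
    have p2 : ∀ i : ℕ, (((2 : ℝ) ^ i) ^ s) ^ (ε * r0) = q ^ i := by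
      intro i
      rw [← Real.rpow_mul (by positivity), hεs, hq, ← Real.rpow_natCast, ← Real.rpow_natCast,
        ← Real.rpow_mul (by norm_num), ← Real.rpow_mul (by norm_num), mul_comm]
    have f00 : u (i, i + d) ^ (ε * r0) ≤ (K * D) ^ (ε * r0) *
        ((c00 ^ (ε * r0) * ENNReal.ofReal (((2 : ℝ) ^ d) ^ (γ * r0))) * ENNReal.ofReal (q ^ i)) := by
      calc _ ≤ ((K * D) * (ENNReal.ofReal (((2 : ℝ) ^ (i + d)) ^ s) * c00)) ^ (ε * r0) := by
            refine ENNReal.rpow_le_rpow (b00.trans (le_of_eq (by ring))) hεr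
        _ = _ := by
            rw [ENNReal.mul_rpow_of_nonneg (K * D) _ hεr, ENNReal.mul_rpow_of_nonneg (ENNReal.ofReal _) _ hεr,
              ofReal_rpow' (by positivity), p2, pow_add, ENNReal.ofReal_mul (by positivity)]
            rw [show ((2 : ℝ) ^ d) ^ (γ * r0) = q ^ d by
              rw [← p2 d, ← Real.rpow_mul (by positivity), hεs]]
            ring
    have f11 : u (i, i + d) ^ (ε * r0) ≤ (K * D) ^ (ε * r0) *
        (c11 ^ (ε * r0) * ENNReal.ofReal ((q ^ i)⁻¹)) := by
      calc _ ≤ ((K * D) * (ENNReal.ofReal ((((2 : ℝ) ^ i) ^ s)⁻¹) * c11)) ^ (ε * r0) := by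
            refine ENNReal.rpow_le_rpow (b11.trans (le_of_eq (by ring))) hεr
        _ = _ := by
            rw [ENNReal.mul_rpow_of_nonneg (K * D) _ hεr, ENNReal.mul_rpow_of_nonneg (ENNReal.ofReal _) _ hεr,
              ofReal_rpow' (by positivity), Real.inv_rpow (by positivity), p2]
            ring
    have f01 : u (i, i + d) ^ ((1 - ε) * r0) ≤ (K * D) ^ ((1 - ε) * r0) * c01 ^ ((1 - ε) * r0) := by
      rw [← ENNReal.mul_rpow_of_nonneg _ _ hε1']
      exact ENNReal.rpow_le_rpow b01 hε1'
    rw [hDr, ← ENNReal.mul_rpow_of_nonneg _ _ hr0.le, split (u _), split (K * D)]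
    set m1 := (c00 ^ (ε * r0) * ENNReal.ofReal (((2 : ℝ) ^ d) ^ (γ * r0))) * ENNReal.ofReal (q ^ i)
    set m2 := c11 ^ (ε * r0) * ENNReal.ofReal ((q ^ i)⁻¹)
    have f : u (i, i + d) ^ (ε * r0) ≤ (K * D) ^ (ε * r0) * min m1 m2 := by
      rcases min_choice m1 m2 with h | h <;> rw [h]
      · exact f00
      · exact f11
    calc _ ≤ ((K * D) ^ ((1 - ε) * r0) * c01 ^ ((1 - ε) * r0)) * ((K * D) ^ (ε * r0) * min m1 m2) :=
          mul_le_mul' f01 f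
      _ = _ := by ring
  calc _ ≤ ∑' d : ℕ, ∑' i : ℕ, (K ^ r0 * ENNReal.ofReal (((2 : ℝ) ^ d) ^ (-(γ * r0)))) *
      (c01 ^ ((1 - ε) * r0)) *
      min ((c00 ^ (ε * r0) * ENNReal.ofReal (((2 : ℝ) ^ d) ^ (γ * r0))) * ENNReal.ofReal (q ^ i))
        (c11 ^ (ε * r0) * ENNReal.ofReal ((q ^ i)⁻¹)) :=
        ENNReal.tsum_le_tsum fun d => ENNReal.tsum_le_tsum fun i => hpt d i
    _ ≤ ∑' d : ℕ, (K ^ r0 * ENNReal.ofReal (((2 : ℝ) ^ d) ^ (-(γ * r0)))) *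
      (c01 ^ ((1 - ε) * r0)) * (C1 * ((c00 ^ (ε * r0) * ENNReal.ofReal (((2 : ℝ) ^ d) ^ (γ * r0))) *
        c11 ^ (ε * r0)) ^ (1 / 2 : ℝ)) := by
        refine ENNReal.tsum_le_tsum fun d => ?_
        rw [ENNReal.tsum_mul_left]
        exact mul_le_mul_right (min_sum hq1 _ _) _
    _ = ∑' d : ℕ, (K ^ r0 * C1 * Y) * x ^ d := by
        congr 1; ext d
        have e1 : ((c00 ^ (ε * r0) * ENNReal.ofReal (((2 : ℝ) ^ d) ^ (γ * r0))) *
            c11 ^ (ε * r0)) ^ (1 / 2 : ℝ) = (c10 * c01) ^ (ε / 2 * r0) *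
              ENNReal.ofReal (((2 : ℝ) ^ d) ^ (γ * r0 / 2)) := by
          rw [mul_right_comm, ENNReal.mul_rpow_of_nonneg _ _ (by norm_num),
            ← ENNReal.mul_rpow_of_nonneg c00 c11 (by positivity), hc, ofReal_rpow' (by positivity),
            ← ENNReal.rpow_mul, ← Real.rpow_mul (by positivity)]
          congr 2
          · ring
          · congr 1; ring
        have e2 : ENNReal.ofReal (((2 : ℝ) ^ d) ^ (-(γ * r0))) *
            ENNReal.ofReal (((2 : ℝ) ^ d) ^ (γ * r0 / 2)) = x ^ d := by
          rw [hx, ← ENNReal.ofReal_mul (by positivity), ← ENNReal.ofReal_pow (by positivity),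
            ← Real.rpow_add (by positivity)]
          congr 1
          rw [← Real.rpow_natCast, ← Real.rpow_natCast, ← Real.rpow_mul (by norm_num),
            ← Real.rpow_mul (by norm_num)]
          congr 1; ring
        have e3 : c01 ^ ((1 - ε) * r0) * (c10 * c01) ^ (ε / 2 * r0) = Y := by
          rw [hY, ENNReal.mul_rpow_of_nonneg _ _ (by positivity),
            ENNReal.mul_rpow_of_nonneg _ _ hr0.le, ← ENNReal.rpow_mul, ← ENNReal.rpow_mul,
            mul_left_comm, ← ENNReal.rpow_add_of_nonneg _ _ (mul_nonneg (by linarith) hr0.le) (by positivity)]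
          congr 2; ring
        rw [e1, ← e2, ← e3]; ring
    _ = _ := by
        rw [ENNReal.tsum_mul_left, ENNReal.tsum_geometric]; ring

theorem K2.neg {n : ℕ} {σ : Eu n → Eu n → ℂ} {c : ℝ≥0∞} {τ0 τ1 τ2 : Measure (Eu n)}
    (h : K2 σ c τ0 τ1 τ2) : K2 (fun ξ η => -σ ξ η) c τ0 τ1 τ2 := by
  obtain ⟨ν, b, h1, h2, h3, h4, h5⟩ := h
  refine ⟨ν, fun p => -b p, h1, h2.neg, h3.neg, fun ξ η => ?_, fun H hH => ?_⟩
  · show -σ ξ η = _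
    rw [h4, ← integral_neg]; congr 1; ext p; ring
  · simpa only [enorm_neg] using h5 H hH

theorem Good.swap {n : ℕ} {A r : ℝ} {C0 C : ℝ≥0∞} {τ0 τ1 τ2 τt : Measure (Eu n)} {δ : ℝ}
    (h : Good A r C0 C τ0 τ1 τ2 τt δ) : Good A r C0 C τ0 τ2 τ1 τt δ :=
  ⟨h.sf0, h.sf2, h.sf1, h.sft, h.m0, h.m2, h.m1, h.mt, h.sv, h.s2, h.s1⟩

structure Region {n : ℕ} (s A r : ℝ) (C0 C : ℝ≥0∞) (r0 : ℝ) (S : Set (Bool × Bool)) (α : ℝ)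
    (w : ℕ × ℕ → Bool × Bool → ℝ≥0∞) (σ : ℕ × ℕ → Eu n → Eu n → ℂ) : Prop where
  ne : S.Nonempty
  a0 : 0 ≤ α
  a1 : α ≤ 1
  piece : ∀ p, ∃ (τ0 τ1 τ2 τt : Measure (Eu n)) (δ : ℝ), Good A r C0 C τ0 τ1 τ2 τt δ ∧
    ∀ e ∈ S, ∃ σe, K2 σe (w p e) τ0 τ1 τ2 ∧
      ∀ ξ η, σ p ξ η = σe ξ η * ((lam ξ ^ bp s e.1 * lam η ^ bp s e.2 : ℝ) : ℂ)
  sum : ∀ c : Bool × Bool → ℝ≥0∞,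
    c (false, false) * c (true, true) = c (true, false) * c (false, true) →
    ∀ u : ℕ × ℕ → ℝ≥0∞, (∀ p, ∀ e ∈ S, u p ≤ w p e * c e) →
      ∑' p, u p ^ r0 ≤ C * (c (true, false) ^ α * c (false, true) ^ (1 - α)) ^ r0

theorem Region.mono {n : ℕ} {s A r : ℝ} {C0 C C' : ℝ≥0∞} {r0 : ℝ} {S : Set (Bool × Bool)} {α : ℝ}
    {w : ℕ × ℕ → Bool × Bool → ℝ≥0∞} {σ : ℕ × ℕ → Eu n → Eu n → ℂ}
    (h : Region s A r C0 C r0 S α w σ) (hC : C ≤ C') : Region s A r C0 C' r0 S α w σ := by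
  refine ⟨h.ne, h.a0, h.a1, fun p => ?_, fun c hc u hu => (h.sum c hc u hu).trans (by gcongr)⟩
  obtain ⟨τ0, τ1, τ2, τt, δ, hG, h2⟩ := h.piece p
  exact ⟨τ0, τ1, τ2, τt, δ, Good_mono hC hG, h2⟩

theorem Region.swap {n : ℕ} {s A r : ℝ} {C0 C : ℝ≥0∞} {r0 : ℝ} {S : Set (Bool × Bool)} {α : ℝ}
    {w : ℕ × ℕ → Bool × Bool → ℝ≥0∞} {σ : ℕ × ℕ → Eu n → Eu n → ℂ}
    (h : Region s A r C0 C r0 S α w σ) :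
    Region s A r C0 C r0 {e | e.swap ∈ S} (1 - α) (fun p e => w p e.swap) (fun p ξ η => σ p η ξ) := by
  refine ⟨?_, by linarith [h.a1], by linarith [h.a0], fun p => ?_, fun c hc u hu => ?_⟩
  · obtain ⟨e, he⟩ := h.ne
    exact ⟨e.swap, by simpa using he⟩
  · obtain ⟨τ0, τ1, τ2, τt, δ, hG, h2⟩ := h.piece p
    refine ⟨τ0, τ2, τ1, τt, δ, hG.swap, fun e he => ?_⟩
    obtain ⟨σe, hK, hσ⟩ := h2 e.swap he
    have := hG.sf1
    have := hG.sf2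
    refine ⟨_, hK.swap, fun ξ η => ?_⟩
    rw [hσ, mul_comm (lam η ^ _)]; rfl
  · have := h.sum (fun e => c e.swap) (by rw [mul_comm (c _)] at hc ⊢; simpa [mul_comm] using hc) u
      (fun p e he => by simpa using hu p e.swap (by simpa using he))
    refine this.trans (le_of_eq ?_)
    simp only [Prod.swap_prod_mk, sub_sub_cancel]
    rw [mul_comm (c _ ^ α)]

/-- the trivial region -/
theorem Region_A {n : ℕ} {s A r : ℝ} (hA : 0 ≤ A) {C0 : ℝ≥0∞} (hC0 : 1 ≤ C0) {r0 : ℝ} (hr0 : 0 < r0) :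
    Region (n := n) s A r C0 (1 + ENNReal.ofReal (2 ^ A)) r0 {(true, false)} 1
      (fun p _ => if p = (0, 0) then 1 else 0)
      (fun p ξ _ => if p = (0, 0) then ((lam ξ ^ (s / 2) : ℝ) : ℂ) else 0) := by
  refine ⟨⟨_, rfl⟩, zero_le_one, le_rfl, fun p => ?_, fun c hc u hu => ?_⟩
  · refine ⟨_, _, _, _, _, Good_mono le_add_self (Good_dirac hA hC0), fun e he => ?_⟩
    rw [Set.mem_singleton_iff] at he
    subst he
    by_cases hp : p = (0, 0)
    · refine ⟨_, by simpa [hp] using K2_one, fun ξ η => ?_⟩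
      simp [hp, bp]
    · refine ⟨_, K2_zero _ _ _ _, fun ξ η => ?_⟩
      simp [hp]
  · rw [tsum_eq_single (0, 0)]
    · have := hu (0, 0) _ rfl
      simp only [if_true, one_mul] at this
      simp only [ENNReal.rpow_one, sub_self, ENNReal.rpow_zero, mul_one]
      calc _ ≤ 1 * c (true, false) ^ r0 := by rw [one_mul]; gcongr
        _ ≤ _ := by gcongr; exact le_self_add
    · intro p hp
      have := hu p _ rfl
      simp only [hp, if_false, zero_mul, nonpos_iff_eq_zero] at this
      rw [this, ENNReal.zero_rpow_of_pos hr0]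

theorem Region_of {n : ℕ} {s γ A r ρ N r0 : ℝ} (hγ : 0 < γ) (hγs : γ ≤ s) (hr0 : 0 < r0)
    (hA : 0 ≤ A) (hr : 0 < r) (hr1 : r ≤ 1)
    (hρ : (n : ℝ) < ρ * r) (hN : A ≤ N * r) {C0 : ℝ≥0∞} (hC0 : ENNReal.ofReal (2 ^ (ρ + N)) ≤ C0)
    (hC1 : 1 ≤ C0) (hC0T : C0 ≠ ∞) {K : ℝ≥0∞} (hK : K ≠ ∞) :
    ∃ C : ℝ≥0∞, C ≠ ∞ ∧ ∀ (sel : ℕ × ℕ → Prop) [DecidablePred sel] (_ : ∀ i j, sel (i, j) → i ≤ j)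
      (σ : ℕ × ℕ → Eu n → Eu n → ℂ),
      (∀ i j, i ≤ j → ∀ e ∈ SL, ∃ σe, K2 σe (K * ENNReal.ofReal (ww s γ i j e))
        (tauP n ρ N j) (tauP n ρ N i) (tauP n ρ N j) ∧
        ∀ ξ η, σ (i, j) ξ η = σe ξ η * ((lam ξ ^ bp s e.1 * lam η ^ bp s e.2 : ℝ) : ℂ)) →
      Region s A r C0 C r0 SL (γ / s / 2)
        (fun p e => if sel p then K * ENNReal.ofReal (ww s γ p.1 p.2 e) else 0)
        (fun p ξ η => if sel p then σ p ξ η else 0) := by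
  obtain ⟨Ca, hCa, hGa⟩ := Good_Psi (n := n) hA hr hr1 hρ hN hC0 hC0T
  obtain ⟨Cb, hCb, hsum⟩ := sum_L hγ hγs hr0 hK
  have hs : 0 < s := hγ.trans_le hγs
  have hε : γ / s ≤ 1 := by rw [div_le_one hs]; exact hγs
  refine ⟨Ca + Cb + ENNReal.ofReal (2 ^ A), by finiteness, fun sel _ hsel σ hσ =>
    ⟨⟨(false, false), by simp [SL]⟩, by positivity, by linarith, ?_, ?_⟩⟩
  · rintro ⟨i, j⟩
    by_cases hp : sel (i, j)
    · have hij := hsel i j hp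
      refine ⟨_, _, _, _, _, Good_mono (le_self_add.trans le_self_add) (hGa j i j hij le_rfl), fun e he => ?_⟩
      obtain ⟨σe, h1, h2⟩ := hσ i j hij e he
      refine ⟨σe, by simpa only [hp, if_true] using h1, fun ξ η => ?_⟩
      simp only [hp, if_true]; exact h2 ξ η
    · refine ⟨_, _, _, _, _, Good_mono le_add_self (Good_dirac hA hC1), fun e he => ?_⟩
      refine ⟨_, K2_zero _ _ _ _, fun ξ η => ?_⟩
      simp [hp]
  · intro c hc u hu
    refine (hsum c hc u ?_ ?_).trans (by gcongr; exact le_add_self.trans le_self_add)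
    · intro p hp
      have := hu p (false, false) (by simp [SL])
      rw [if_neg] at this
      · simpa using this
      · intro h; exact absurd (hsel p.1 p.2 h) (by omega)
    · intro i j hij e he
      have := hu (i, j) e he
      split_ifs at this
      · exact this
      · refine this.trans ?_; simp

theorem ker_md_bp {n : ℕ} (t : Bool → ℝ) {ρ N γ : ℝ} (hN : 0 ≤ N) (hγ : 0 ≤ γ) (hγ1 : γ ≤ 1) :
    ∃ B : ℝ, 0 ≤ B ∧ ∀ (ε : Bool) (i : ℕ), ∃ k : Eu n → ℂ,
      IsKer ρ N γ (((4 : ℝ) ^ i) ^ (t ε) * B) i k (fun ξ => ((md i ξ * lam ξ ^ (t ε) : ℝ) : ℂ)) := by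
  obtain ⟨B1, hB1, h1⟩ := ker_md (n := n) (t true) (ρ := ρ) hN hγ hγ1
  obtain ⟨B2, hB2, h2⟩ := ker_md (n := n) (t false) (ρ := ρ) hN hγ hγ1
  refine ⟨B1 + B2, by positivity, fun ε i => ?_⟩
  cases ε
  · obtain ⟨k, hk⟩ := h2 i
    exact ⟨k, hk.mono (by gcongr; linarith)⟩
  · obtain ⟨k, hk⟩ := h1 i
    exact ⟨k, hk.mono (by gcongr; linarith)⟩

def σ1 {n : ℕ} (s : ℝ) (p : ℕ × ℕ) (ξ η : Eu n) : ℂ :=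
  (((Far s p.2 (ξ + η) - Far s p.2 η) * (md p.1 ξ * md p.2 η) : ℝ) : ℂ)

def σ2 {n : ℕ} (s : ℝ) (p : ℕ × ℕ) (ξ η : Eu n) : ℂ :=
  ((-(lam ξ ^ (s / 2) * (md p.1 ξ * md p.2 η)) : ℝ) : ℂ)

theorem lam_cancel {n : ℕ} (ξ : Eu n) (t : ℝ) : lam ξ ^ (-t) * lam ξ ^ t = 1 := by
  rw [← Real.rpow_add (lam_pos ξ)]; simp

theorem L1_piece {n : ℕ} {s γ ρ N : ℝ} (hγ : 0 < γ) (hγ1 : γ ≤ 1) (hN : 0 ≤ N) (hρ : (n : ℝ) < ρ)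
    (hF : ∃ B : ℝ, 0 ≤ B ∧ ∀ j : ℕ, ∃ k : Eu n → ℂ, Continuous k ∧
      (∀ x, ‖k x‖ ≤ (((2 : ℝ) ^ j) ^ s * B) * Psi (ρ + γ) N j x) ∧
      ∀ ξ, FT k ξ = Far s j ξ) :
    ∃ K : ℝ≥0∞, K ≠ ∞ ∧ ∀ i j, i ≤ j → ∀ e : Bool × Bool, ∃ σe, K2 σe (K * ENNReal.ofReal (ww s γ i j e))
        (tauP n ρ N j) (tauP n ρ N i) (tauP n ρ N j) ∧
        ∀ ξ η, σ1 s (i, j) ξ η = σe ξ η * ((lam ξ ^ bp s e.1 * lam η ^ bp s e.2 : ℝ) : ℂ) := by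
  obtain ⟨B0, hB0, h0⟩ := hF
  obtain ⟨B, hB, hb⟩ := ker_md_bp (n := n) (fun ε => -bp s ε) (ρ := ρ) hN hγ.le hγ1
  obtain ⟨C, hC, hT⟩ := K2_T1 (n := n) hN hρ hγ.le
  refine ⟨C * ENNReal.ofReal (B0 * B * B), by finiteness, fun i j hij e => ?_⟩
  obtain ⟨h, hc, hh, hft⟩ := h0 j
  obtain ⟨k, hk⟩ := hb e.1 i
  obtain ⟨k2, hk2⟩ := hb e.2 j
  have := hT i j _ _ _ h k k2 (fun ξ => (Far s j ξ : ℂ)) _ _ hij (by positivity) (by positivity)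
    (by positivity) hc hh hft hk hk2
  refine ⟨_, this.mono (le_of_eq ?_), fun ξ η => ?_⟩
  · rw [mul_assoc C, ← ENNReal.ofReal_mul (by positivity)]
    congr 2; unfold ww; ring
  · have a1 := lam_cancel ξ (bp s e.1)
    have a2 := lam_cancel η (bp s e.2)
    simp only [σ1]
    norm_cast
    linear_combination (-((Far s j (ξ + η) - Far s j η) * (md i ξ * md j η))) * a1 -
      ((Far s j (ξ + η) - Far s j η) * (md i ξ * md j η)) * (lam ξ ^ (-bp s e.1) * lam ξ ^ (bp s e.1)) * a2

theorem L2_piece {n : ℕ} {s γ ρ N : ℝ} (hγ : 0 < γ) (hγ1 : γ ≤ 1) (hγs : γ ≤ s) (hN : 0 ≤ N)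
    (hρ : (n : ℝ) < ρ) :
    ∃ K : ℝ≥0∞, K ≠ ∞ ∧ ∀ i j, i ≤ j → ∀ e : Bool × Bool, ∃ σe, K2 σe (K * ENNReal.ofReal (ww s γ i j e))
        (tauP n ρ N j) (tauP n ρ N i) (tauP n ρ N j) ∧
        ∀ ξ η, σ2 s (i, j) ξ η = σe ξ η * ((lam ξ ^ bp s e.1 * lam η ^ bp s e.2 : ℝ) : ℂ) := by
  obtain ⟨B0, hB0, h0⟩ := ker_md_bp (n := n) (fun ε => s / 2 - bp s ε) (ρ := ρ) hN hγ.le hγ1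
  obtain ⟨B, hB, hb⟩ := ker_md_bp (n := n) (fun ε => -bp s ε) (ρ := ρ) hN hγ.le hγ1
  obtain ⟨C, hC, hT⟩ := K2_T2 (n := n) (γ := γ) hN hρ
  refine ⟨C * ENNReal.ofReal (B0 * B), by finiteness, fun i j hij e => ?_⟩
  obtain ⟨k, hk⟩ := h0 e.1 i
  obtain ⟨k2, hk2⟩ := hb e.2 j
  have := hT i j _ _ k k2 _ _ hij (by positivity) (by positivity) hk hk2
  refine ⟨_, this.neg.mono ?_, fun ξ η => ?_⟩
  · rw [mul_assoc C, ← ENNReal.ofReal_mul (by positivity)]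
    refine mul_le_mul_right (ENNReal.ofReal_le_ofReal ?_) _
    have e1 : ((4 : ℝ) ^ i) ^ (s / 2 - bp s e.1) = ((2 : ℝ) ^ i) ^ s * ((4 : ℝ) ^ i) ^ (-bp s e.1) := by
      rw [sub_eq_add_neg, Real.rpow_add (by positivity)]
      congr 1
      have := four_rpow i (-s)
      rwa [neg_neg, neg_div, neg_neg] at this
    have e2 : ((2 : ℝ) ^ i) ^ s ≤ ((2 : ℝ) ^ j) ^ s * ((2 : ℝ) ^ (j - i)) ^ (-γ) := by
      have : (2 : ℝ) ^ j = 2 ^ i * 2 ^ (j - i) := by rw [← pow_add]; congr 1; omega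
      rw [this, Real.mul_rpow (by positivity) (by positivity), mul_assoc, ← Real.rpow_add (by positivity)]
      have h1 : 1 ≤ ((2 : ℝ) ^ (j - i)) ^ (s + -γ) :=
        Real.one_le_rpow (one_le_pow₀ (by norm_num)) (by linarith)
      have h2 : 0 ≤ ((2 : ℝ) ^ i) ^ s := by positivity
      nlinarith
    rw [e1]; unfold ww
    have hx : 0 ≤ ((4 : ℝ) ^ i) ^ (-bp s e.1) * ((4 : ℝ) ^ j) ^ (-bp s e.2) * (B0 * B) := by positivity
    have := mul_le_mul_of_nonneg_right e2 hx
    calc _ = _ := by ring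
      _ ≤ _ := this
      _ = _ := by ring
  · have a1 : lam ξ ^ (s / 2 - bp s e.1) * lam ξ ^ (bp s e.1) = lam ξ ^ (s / 2) := by
      rw [← Real.rpow_add (lam_pos ξ)]; simp
    have a2 := lam_cancel η (bp s e.2)
    simp only [σ2]
    norm_cast
    linear_combination (md i ξ * md j η) * a1 +
      (md i ξ * md j η) * (lam ξ ^ (s / 2 - bp s e.1) * lam ξ ^ (bp s e.1)) * a2

theorem md_supp {n : ℕ} {i : ℕ} {ξ : Eu n} (h : (2 : ℝ) ^ (i + 1) ≤ ‖ξ‖) : md i ξ = 0 := by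
  have key : ∀ l : ℕ, l ≤ i → chi (((2 : ℝ) ^ l)⁻¹ • ξ) = 0 := by
    intro l hl
    apply chi_zero
    rw [norm_smul, norm_inv, norm_pow, Real.norm_ofNat, le_inv_mul_iff₀ (by positivity)]
    refine le_trans ?_ h
    rw [← pow_succ]
    exact pow_le_pow_right₀ (by norm_num) (by omega)
  cases i with
  | zero => simpa [md] using key 0 le_rfl
  | succ i => rw [md, key _ le_rfl, key _ (by omega), sub_zero]

theorem chi_Far {n : ℕ} {j : ℕ} {ξ : Eu n} (h : ‖ξ‖ ≤ (2 : ℝ) ^ (j + 2)) (s : ℝ) :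
    Far s j ξ = lam ξ ^ (s / 2) := by
  unfold Far
  rw [chi_one, one_mul]
  rw [norm_smul, norm_inv, norm_pow, Real.norm_ofNat, inv_mul_le_iff₀ (by positivity), mul_one]
  exact h

def beta {n : ℕ} (s : ℝ) (ξ η : Eu n) : ℝ := lam (ξ + η) ^ (s / 2) - lam ξ ^ (s / 2) - lam η ^ (s / 2)

theorem σ_add {n : ℕ} (s : ℝ) {i j : ℕ} (hij : i ≤ j) (ξ η : Eu n) :
    σ1 s (i, j) ξ η + σ2 s (i, j) ξ η = ((beta s ξ η * (md i ξ * md j η) : ℝ) : ℂ) := by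
  simp only [σ1, σ2]
  norm_cast
  by_cases h1 : (2 : ℝ) ^ (i + 1) ≤ ‖ξ‖
  · rw [md_supp h1]; ring
  by_cases h2 : (2 : ℝ) ^ (j + 1) ≤ ‖η‖
  · rw [md_supp h2]; ring
  push Not at h1 h2
  have h3 : (2 : ℝ) ^ (i + 1) ≤ 2 ^ (j + 1) := pow_le_pow_right₀ (by norm_num) (by omega)
  have h4 : (2 : ℝ) ^ (j + 2) = 2 ^ (j + 1) + 2 ^ (j + 1) := by ring
  have h5 : (0:ℝ) < 2 ^ (j + 1) := by positivity
  rw [chi_Far (ξ := ξ + η), chi_Far (ξ := η), beta]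
  · ring
  · linarith
  · linarith [norm_add_le ξ η]

theorem lam_add {n : ℕ} (ξ η : Eu n) : lam (ξ + η) ≤ 2 * (lam ξ * lam η) := by
  unfold lam
  have h := norm_add_le ξ η
  have h0 := norm_nonneg (ξ + η)
  nlinarith [sq_nonneg (‖ξ‖ - ‖η‖), sq_nonneg (‖ξ‖ * ‖η‖), norm_nonneg ξ, norm_nonneg η]

theorem one_le_lam {n : ℕ} (ξ : Eu n) : 1 ≤ lam ξ := by unfold lam; nlinarith [norm_nonneg ξ]

theorem chi_eventually {n : ℕ} (ξ : Eu n) :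
    ∀ᶠ M : ℕ in Filter.atTop, chi (((2 : ℝ) ^ M)⁻¹ • ξ) = 1 := by
  have : Filter.Tendsto (fun M : ℕ => (2 : ℝ) ^ M) Filter.atTop Filter.atTop :=
    tendsto_pow_atTop_atTop_of_one_lt (by norm_num)
  filter_upwards [this.eventually_ge_atTop ‖ξ‖] with M hM
  apply chi_one
  rwa [norm_smul, norm_inv, norm_pow, Real.norm_ofNat, inv_mul_le_iff₀ (by positivity), mul_one]

structure RD (n : ℕ) where
  S : Set (Bool × Bool)
  α : ℝ
  w : ℕ × ℕ → Bool × Bool → ℝ≥0∞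
  σ : ℕ × ℕ → Eu n → Eu n → ℂ

def RD.of {n : ℕ} {s A r : ℝ} {C0 C : ℝ≥0∞} {r0 : ℝ} {S : Set (Bool × Bool)} {α : ℝ}
    {w : ℕ × ℕ → Bool × Bool → ℝ≥0∞} {σ : ℕ × ℕ → Eu n → Eu n → ℂ}
    (_ : Region s A r C0 C r0 S α w σ) : RD n := ⟨S, α, w, σ⟩

def box (M : ℕ) : Finset (ℕ × ℕ) := Finset.range (M + 1) ×ˢ Finset.range (M + 1)

theorem sum_box {n : ℕ} (M : ℕ) (ξ η : Eu n) :
    ∑ p ∈ box M, md p.1 ξ * md p.2 η = chi (((2 : ℝ) ^ M)⁻¹ • ξ) * chi (((2 : ℝ) ^ M)⁻¹ • η) := by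
  rw [box, Finset.sum_product, ← md_sum, ← md_sum, Finset.sum_mul_sum]

theorem sum_box_swap {n : ℕ} (M : ℕ) (ξ η : Eu n) :
    ∑ p ∈ box M, ((if p.1 ≤ p.2 then md p.1 ξ * md p.2 η else 0) +
      (if p.1 < p.2 then md p.1 η * md p.2 ξ else 0)) =
      chi (((2 : ℝ) ^ M)⁻¹ • ξ) * chi (((2 : ℝ) ^ M)⁻¹ • η) := by
  rw [Finset.sum_add_distrib]
  have : ∑ p ∈ box M, (if p.1 < p.2 then md p.1 η * md p.2 ξ else 0) =
      ∑ p ∈ box M, (if p.2 < p.1 then md p.1 ξ * md p.2 η else 0) := by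
    refine Finset.sum_bij (fun p _ => p.swap) ?_ ?_ ?_ ?_
    · intro p hp; simp only [box, Finset.mem_product] at hp ⊢; exact ⟨hp.2, hp.1⟩
    · intro p _ q _ h; exact Prod.swap_injective h
    · intro p hp; exact ⟨p.swap, by simp only [box, Finset.mem_product] at hp ⊢; exact ⟨hp.2, hp.1⟩, by simp⟩
    · intro p _; simp [mul_comm]
  rw [this, ← Finset.sum_add_distrib, ← sum_box]
  refine Finset.sum_congr rfl fun p _ => ?_
  by_cases h : p.1 ≤ p.2
  · simp [h, not_lt.2 h]
  · simp [h, not_le.1 h]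

/-- data of a decomposition -/
def Decomp (n : ℕ) (s A r : ℝ) (C0 C : ℝ≥0∞) (r0 : ℝ) {R : ℕ} (d : Fin R → RD n) : Prop :=
  (∀ i, Region s A r C0 C r0 (d i).S (d i).α (d i).w (d i).σ) ∧
  (∃ K : ℝ, ∀ M ξ η, ‖∑ i, ∑ p ∈ box M, (d i).σ p ξ η‖ ≤ K * (lam ξ ^ (s / 2) * lam η ^ (s / 2))) ∧
  ∀ ξ η, Filter.Tendsto (fun M => ∑ i, ∑ p ∈ box M, (d i).σ p ξ η) Filter.atTop
    (nhds ((lam (ξ + η) ^ (s / 2) : ℝ) : ℂ))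

theorem sum_A {n : ℕ} (s : ℝ) (M : ℕ) (ξ : Eu n) :
    ∑ p ∈ box M, (if p = (0, 0) then ((lam ξ ^ (s / 2) : ℝ) : ℂ) else 0) = ((lam ξ ^ (s / 2) : ℝ) : ℂ) := by
  rw [Finset.sum_ite_eq' (box M) (0, 0)]
  simp [box]

theorem decomp_zero (n : ℕ) {A r : ℝ} (hA : 0 ≤ A) {C0 : ℝ≥0∞} (hC0 : 1 ≤ C0) {r0 : ℝ} (hr0 : 0 < r0) :
    ∃ C : ℝ≥0∞, C ≠ ∞ ∧ ∃ (R : ℕ) (d : Fin R → RD n), Decomp n 0 A r C0 C r0 d := by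
  refine ⟨1 + ENNReal.ofReal (2 ^ A), by finiteness, 1, fun _ => RD.of (Region_A (n := n) (s := 0) (r := r) hA hC0 hr0),
    fun i => Region_A hA hC0 hr0, ⟨1, fun M ξ η => ?_⟩, fun ξ η => ?_⟩
  · simp only [Finset.univ_unique, Finset.sum_singleton, RD.of]
    rw [sum_A]; simp
  · simp only [Finset.univ_unique, Finset.sum_singleton, RD.of]
    simp only [sum_A]; simp

theorem decomp_pos (n : ℕ) {s γ A r ρ N r0 : ℝ} (hγ : 0 < γ) (hγ1 : γ ≤ 1) (hγs : γ ≤ s) (hr0 : 0 < r0)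
    (hA : 0 ≤ A) (hr : 0 < r) (hr1 : r ≤ 1) (hN0 : 0 ≤ N) (hρ0 : (n : ℝ) < ρ)
    (hρ : (n : ℝ) < ρ * r) (hN : A ≤ N * r) {C0 : ℝ≥0∞} (hC0 : ENNReal.ofReal (2 ^ (ρ + N)) ≤ C0)
    (hC1 : 1 ≤ C0) (hC0T : C0 ≠ ∞)
    (hF : ∃ B : ℝ, 0 ≤ B ∧ ∀ j : ℕ, ∃ k : Eu n → ℂ, Continuous k ∧
      (∀ x, ‖k x‖ ≤ (((2 : ℝ) ^ j) ^ s * B) * Psi (ρ + γ) N j x) ∧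
      ∀ ξ, FT k ξ = Far s j ξ) :
    ∃ C : ℝ≥0∞, C ≠ ∞ ∧ ∃ (R : ℕ) (d : Fin R → RD n), Decomp n s A r C0 C r0 d := by
  have hs : 0 < s := hγ.trans_le hγs
  obtain ⟨K1, hK1, P1⟩ := L1_piece hγ hγ1 hN0 hρ0 hF
  obtain ⟨K2, hK2, P2⟩ := L2_piece (n := n) hγ hγ1 hγs hN0 hρ0
  obtain ⟨D1, hD1, Q1⟩ := Region_of (n := n) hγ hγs hr0 hA hr hr1 hρ hN hC0 hC1 hC0T hK1
  obtain ⟨D2, hD2, Q2⟩ := Region_of (n := n) hγ hγs hr0 hA hr hr1 hρ hN hC0 hC1 hC0T hK2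
  have RA := Region_A (n := n) (s := s) (r := r) hA hC1 hr0
  have R1 := Q1 (fun p => p.1 ≤ p.2) (fun i j h => h) (σ1 s) (fun i j h e _ => P1 i j h e)
  have R2 := Q2 (fun p => p.1 ≤ p.2) (fun i j h => h) (σ2 s) (fun i j h e _ => P2 i j h e)
  have R3 := Q1 (fun p => p.1 < p.2) (fun i j h => le_of_lt h) (σ1 s) (fun i j h e _ => P1 i j h e)
  have R4 := Q2 (fun p => p.1 < p.2) (fun i j h => le_of_lt h) (σ2 s) (fun i j h e _ => P2 i j h e)
  set C := (1 + ENNReal.ofReal (2 ^ A)) + D1 + D2 with hC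
  have hCa : 1 + ENNReal.ofReal (2 ^ A) ≤ C := le_self_add.trans le_self_add
  have hCb : D1 ≤ C := le_add_self.trans le_self_add
  have hCc : D2 ≤ C := le_add_self
  have hid : ∀ M (ξ η : Eu n), ∑ p ∈ box M, (if p = (0, 0) then ((lam ξ ^ (s / 2) : ℝ) : ℂ) else 0) +
      ∑ p ∈ box M, (if p = (0, 0) then ((lam η ^ (s / 2) : ℝ) : ℂ) else 0) +
      ∑ p ∈ box M, (if p.1 ≤ p.2 then σ1 s p ξ η else 0) +
      ∑ p ∈ box M, (if p.1 ≤ p.2 then σ2 s p ξ η else 0) +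
      ∑ p ∈ box M, (if p.1 < p.2 then σ1 s p η ξ else 0) +
      ∑ p ∈ box M, (if p.1 < p.2 then σ2 s p η ξ else 0) =
      ((lam ξ ^ (s / 2) + lam η ^ (s / 2) + beta s ξ η *
        (chi (((2 : ℝ) ^ M)⁻¹ • ξ) * chi (((2 : ℝ) ^ M)⁻¹ • η)) : ℝ) : ℂ) := by
    intro M ξ η
    rw [sum_A, sum_A, ← sum_box_swap, Finset.mul_sum]
    push_cast
    rw [add_assoc, add_assoc, add_assoc, ← Finset.sum_add_distrib, ← Finset.sum_add_distrib,
      ← Finset.sum_add_distrib]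
    congr 1
    refine Finset.sum_congr rfl fun p _ => ?_
    have hb : beta s η ξ = beta s ξ η := by unfold beta; rw [add_comm η ξ]; ring
    by_cases h : p.1 ≤ p.2
    · have e1 := σ_add s h ξ η
      have e2 := σ_add s h η ξ
      rw [hb] at e2
      push_cast at e1 e2
      by_cases h' : p.1 < p.2
      · simp only [h, h', if_true]; push_cast; linear_combination e1 + e2
      · simp only [h, h', if_true, if_false]; push_cast; linear_combination e1
    · have h' : ¬ p.1 < p.2 := by omega
      simp only [h, h', if_false]; push_cast; ring
  refine ⟨C, by finiteness, 6, ![RD.of RA, RD.of RA.swap, RD.of R1, RD.of R2, RD.of R3.swap, RD.of R4.swap], ?_, ?_, ?_⟩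
  · intro i
    fin_cases i
    · exact RA.mono hCa
    · exact RA.swap.mono hCa
    · exact R1.mono hCb
    · exact R2.mono hCc
    · exact R3.swap.mono hCb
    · exact R4.swap.mono hCc
  · refine ⟨4 + 2 ^ (s / 2), fun M ξ η => ?_⟩
    have := hid M ξ η
    rw [Fin.sum_univ_six]
    refine (le_of_eq (congrArg norm this)).trans ?_
    rw [Complex.norm_real, Real.norm_eq_abs]
    have h1 : 1 ≤ lam ξ ^ (s / 2) := Real.one_le_rpow (one_le_lam ξ) (by positivity)
    have h2 : 1 ≤ lam η ^ (s / 2) := Real.one_le_rpow (one_le_lam η) (by positivity)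
    have h3 : lam (ξ + η) ^ (s / 2) ≤ 2 ^ (s / 2) * (lam ξ ^ (s / 2) * lam η ^ (s / 2)) := by
      rw [← Real.mul_rpow (lam_pos _).le (lam_pos _).le, ← Real.mul_rpow (by norm_num) (by have := lam_pos ξ; have := lam_pos η; positivity)]
      exact Real.rpow_le_rpow (lam_pos _).le (lam_add ξ η) (by positivity)
    have h4 : 0 < lam (ξ + η) ^ (s / 2) := Real.rpow_pos_of_pos (lam_pos _) _
    have h5 : |chi (((2 : ℝ) ^ M)⁻¹ • ξ) * chi (((2 : ℝ) ^ M)⁻¹ • η)| ≤ 1 := by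
      rw [abs_of_nonneg (mul_nonneg (chi_nonneg _) (chi_nonneg _))]
      exact mul_le_one₀ (chi_le_one _) (chi_nonneg _) (chi_le_one _)
    set x := lam ξ ^ (s / 2)
    set y := lam η ^ (s / 2)
    set z := lam (ξ + η) ^ (s / 2)
    have h6 : |beta s ξ η| ≤ z + x + y := by
      show |z - x - y| ≤ _
      rw [abs_le]; constructor <;> linarith
    have hx : x ≤ x * y := by nlinarith
    have hy : y ≤ x * y := by nlinarith
    calc _ ≤ |x + y| + |beta s ξ η| * 1 := by
          refine (abs_add_le _ _).trans ?_
          rw [abs_mul]; gcongr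
      _ ≤ (x + y) + (z + x + y) := by rw [mul_one, abs_of_nonneg (by linarith)]; linarith
      _ ≤ _ := by nlinarith
  · intro ξ η
    refine Filter.Tendsto.congr' ?_ tendsto_const_nhds
    filter_upwards [chi_eventually ξ, chi_eventually η] with M h1 h2
    have := hid M ξ η
    rw [Fin.sum_univ_six]
    refine Eq.trans ?_ this.symm
    rw [h1, h2]; unfold beta; congr 1; ring

/-- existence of the decomposition -/
theorem decomp (n : ℕ) {s A r r0 : ℝ} (hr0 : 0 < r0) (hA : 0 ≤ A) (hr : 0 < r) (hr1 : r ≤ 1)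
    (hs : max 0 ((n : ℝ) * (1 / r - 1)) < s ∨ ∃ j : ℕ, s = 2 * j) :
    ∃ C1 : ℝ≥0∞, C1 ≠ ∞ ∧ ∀ C0, C1 ≤ C0 → C0 ≠ ∞ →
    ∃ C : ℝ≥0∞, C ≠ ∞ ∧ ∃ (R : ℕ) (d : Fin R → RD n), Decomp n s A r C0 C r0 d := by
  have hn : (0 : ℝ) ≤ n := Nat.cast_nonneg n
  have hnr : (n : ℝ) ≤ n / r := by rw [le_div_iff₀ hr]; nlinarith
  have hN : A ≤ A / r * r := by rw [div_mul_cancel₀ _ hr.ne']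
  have hN0 : 0 ≤ A / r := by positivity
  rcases hs with hs | ⟨a, ha⟩
  · have hs0 : 0 < s := (le_max_left _ _).trans_lt hs
    have hs1 : (n : ℝ) * (1 / r - 1) < s := (le_max_right _ _).trans_lt hs
    set δ := n + s - n / r with hδ
    have hδ0 : 0 < δ := by
      have : (n : ℝ) * (1 / r - 1) = n / r - n := by ring
      rw [hδ]; linarith
    set γ := min 1 (min s (δ / 3))
    have hγ : 0 < γ := lt_min one_pos (lt_min hs0 (by positivity))
    have hγ1 : γ ≤ 1 := min_le_left _ _
    have hγs : γ ≤ s := (min_le_right _ _).trans (min_le_left _ _)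
    have hγδ : γ ≤ δ / 3 := (min_le_right _ _).trans (min_le_right _ _)
    refine ⟨1 + ENNReal.ofReal (2 ^ ((n / r + δ / 3) + A / r)), by finiteness, fun C0 h1 h2 => ?_⟩
    have hF := ker_far_gen (n := n) (s := s) (ρ := (n / r + δ / 3) + γ) (N := A / r) hN0
      (by linarith) (by rw [hδ] at hγδ ⊢; linarith)
    refine decomp_pos n hγ hγ1 hγs hr0 hA hr hr1 hN0 (by linarith) ?_ hN (le_add_self.trans h1)
      (le_self_add.trans h1) h2 hF
    rw [add_mul, div_mul_cancel₀ _ hr.ne']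
    have : 0 < δ / 3 * r := by positivity
    linarith
  · rcases Nat.eq_zero_or_pos a with rfl | hpos
    · refine ⟨1, by finiteness, fun C0 h1 h2 => ?_⟩
      rw [ha]; simp only [Nat.cast_zero, mul_zero]
      exact decomp_zero n hA h1 hr0
    · have ha1 : (1 : ℝ) ≤ a := by exact_mod_cast hpos
      refine ⟨1 + ENNReal.ofReal (2 ^ ((n / r + 1) + A / r)), by finiteness, fun C0 h1 h2 => ?_⟩
      have hF := ker_far_even (n := n) a (ρ := (n / r + 1) + 1) (N := A / r) hN0
      rw [← ha] at hF
      refine decomp_pos n one_pos le_rfl (by rw [ha]; linarith) hr0 hA hr hr1 hN0 (by linarith) ?_ hN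
        (le_add_self.trans h1) (le_self_add.trans h1) h2 hF
      rw [add_mul, div_mul_cancel₀ _ hr.ne']
      linarith

/-- inverse transform without normalisation -/
def INV {m k : ℕ} (h : Eu m × Eu k → ℂ) (p : Eu m × Eu k) : ℂ :=
  ∫ q : Eu m × Eu k, h q * (ec (-p.1) q.1 * ec (-p.2) q.2)

abbrev WW (m k : ℕ) := WithLp 2 (Eu m × Eu k)

def eW (m k : ℕ) : WW m k ≃L[ℝ] Eu m × Eu k := WithLp.prodContinuousLinearEquiv 2 ℝ (Eu m) (Eu k)

open FourierTransform SchwartzMap in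
theorem INV_eq {m k : ℕ} (h : Eu m × Eu k → ℂ) (p : Eu m × Eu k) :
    INV h p = 𝓕⁻ (fun w : WW m k => h (WithLp.ofLp w)) ((2 * π)⁻¹ • WithLp.toLp 2 p) := by
  rw [Real.fourierInv_eq', INV]
  have := (WithLp.volume_preserving_ofLp (Eu m) (Eu k)).integral_comp
    (MeasurableEquiv.toLp 2 (Eu m × Eu k)).symm.measurableEmbedding
    (fun q : Eu m × Eu k => h q * (ec (-p.1) q.1 * ec (-p.2) q.2))
  rw [← this]
  refine integral_congr_ae (Filter.Eventually.of_forall fun w => ?_)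
  simp only [smul_eq_mul]
  rw [mul_comm]
  congr 1
  unfold ec
  rw [← Complex.exp_add]
  congr 1
  rw [inner_smul_right, WithLp.prod_inner_apply]
  simp only [inner_neg_left]
  rw [mul_inv_cancel_left₀ (by positivity), real_inner_comm w.ofLp.1, real_inner_comm w.ofLp.2]
  push_cast
  ring

open FourierTransform SchwartzMap in
theorem INV_surj {m k : ℕ} (f : SchwartzMap (Eu m × Eu k) ℂ) :
    ∃ h : SchwartzMap (Eu m × Eu k) ℂ, ⇑f = INV h := by
  let c : ℝˣ := Units.mk0 (2 * π) (by positivity)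
  let e2 : WW m k ≃L[ℝ] WW m k := ContinuousLinearEquiv.unitsEquivAut ℝ c |>.symm |> fun _ =>
    ContinuousLinearEquiv.smulLeft c
  let F : SchwartzMap (WW m k) ℂ := compCLMOfContinuousLinearEquiv ℂ (e2.trans (eW m k)) f
  refine ⟨compCLMOfContinuousLinearEquiv ℂ (eW m k).symm (𝓕 F), ?_⟩
  ext p
  rw [INV_eq]
  have : (fun w : WW m k => (compCLMOfContinuousLinearEquiv ℂ (eW m k).symm (𝓕 F)) (WithLp.ofLp w))
      = 𝓕 F := by
    ext w; rfl
  rw [this, ← fourierInv_coe, FourierTransform.fourierInv_fourier_eq]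
  change f p = f (WithLp.ofLp ((2*π) • ((2 * π)⁻¹ • WithLp.toLp 2 p)))
  rw [smul_inv_smul₀ (by positivity)]

open FourierTransform SchwartzMap in
theorem INV_schwartz {m k : ℕ} (h : SchwartzMap (Eu m × Eu k) ℂ) :
    ∃ f : SchwartzMap (Eu m × Eu k) ℂ, ⇑f = INV h := by
  let c : ℝˣ := Units.mk0 (2 * π)⁻¹ (by positivity)
  let e2 : WW m k ≃L[ℝ] WW m k := ContinuousLinearEquiv.smulLeft c
  let H : SchwartzMap (WW m k) ℂ := compCLMOfContinuousLinearEquiv ℂ (eW m k) h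
  refine ⟨compCLMOfContinuousLinearEquiv ℂ ((eW m k).symm.trans e2) (𝓕⁻ H), ?_⟩
  ext p
  rw [INV_eq]
  have : (fun w : WW m k => h (WithLp.ofLp w)) = H := rfl
  rw [this, ← fourierInv_coe]
  rfl

open FourierTransform SchwartzMap in
theorem INV_mul {m k : ℕ} (h1 h2 : SchwartzMap (Eu m × Eu k) ℂ) :
    ∃ h : SchwartzMap (Eu m × Eu k) ℂ, (∀ q, h q = ∫ t, h1 t * h2 (q - t)) ∧
      ∀ p, INV h1 p * INV h2 p = INV h p := by
  let H1 : SchwartzMap (WW m k) ℂ := compCLMOfContinuousLinearEquiv ℂ (eW m k) h1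
  let H2 : SchwartzMap (WW m k) ℂ := compCLMOfContinuousLinearEquiv ℂ (eW m k) h2
  let H := convolution (ContinuousLinearMap.mul ℂ ℂ) H1 H2
  refine ⟨compCLMOfContinuousLinearEquiv ℂ (eW m k).symm H, fun q => ?_, fun p => ?_⟩
  · change H (WithLp.toLp 2 q) = _
    rw [convolution_apply, MeasureTheory.convolution_def]
    have := (WithLp.volume_preserving_ofLp (Eu m) (Eu k)).integral_comp
      (MeasurableEquiv.toLp 2 (Eu m × Eu k)).symm.measurableEmbedding
      (fun t : Eu m × Eu k => h1 t * h2 (q - t))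
    rw [← this]
    rfl
  · rw [INV_eq, INV_eq, INV_eq]
    have e1 : (fun w : WW m k => h1 (WithLp.ofLp w)) = H1 := rfl
    have e2 : (fun w : WW m k => h2 (WithLp.ofLp w)) = H2 := rfl
    have e3 : (fun w : WW m k => (compCLMOfContinuousLinearEquiv ℂ (eW m k).symm H) (WithLp.ofLp w)) = H := by
      ext w; rfl
    rw [e1, e2, e3]
    simp only [Real.fourierInv_eq_fourier_neg, ← fourier_coe]
    rw [fourier_convolution]
    simp

/-- product weight -/
def lw {m k : ℕ} (a b : ℝ) (q : Eu m × Eu k) : ℝ := lam q.1 ^ a * lam q.2 ^ b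

theorem tg_lam {n : ℕ} {D : Type*} [NormedAddCommGroup D] [NormedSpace ℝ D] (L : D →L[ℝ] Eu n)
    (a : ℝ) : Function.HasTemperateGrowth (fun q : D => lam (L q) ^ a) := by
  have h1 := Function.hasTemperateGrowth_one_add_norm_sq_rpow (Eu n) a
  have h2 := h1.comp L.hasTemperateGrowth
  exact h2

theorem tg_lw {m k : ℕ} (a b : ℝ) : Function.HasTemperateGrowth (lw a b : Eu m × Eu k → ℝ) :=
  (tg_lam (ContinuousLinearMap.fst ℝ (Eu m) (Eu k)) a).mul
    (tg_lam (ContinuousLinearMap.snd ℝ (Eu m) (Eu k)) b)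

def wS {m k : ℕ} (a b : ℝ) (h : SchwartzMap (Eu m × Eu k) ℂ) : SchwartzMap (Eu m × Eu k) ℂ :=
  SchwartzMap.smulLeftCLM ℂ (lw a b : Eu m × Eu k → ℝ) h

theorem wS_apply {m k : ℕ} (a b : ℝ) (h : SchwartzMap (Eu m × Eu k) ℂ) (q) :
    wS a b h q = (lw a b q : ℂ) * h q := by
  rw [wS, SchwartzMap.smulLeftCLM_apply_apply (tg_lw a b)]
  simp

theorem wS_zero {m k : ℕ} (h : SchwartzMap (Eu m × Eu k) ℂ) : wS 0 0 h = h := by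
  ext q; rw [wS_apply]; simp [lw]

theorem wS_wS {m k : ℕ} (a b a' b' : ℝ) (h : SchwartzMap (Eu m × Eu k) ℂ) :
    wS a b (wS a' b' h) = wS (a + a') (b + b') h := by
  ext q; rw [wS_apply, wS_apply, wS_apply, ← mul_assoc]
  congr 1
  rw [lw, lw, lw, Real.rpow_add (lam_pos _), Real.rpow_add (lam_pos _)]
  push_cast; ring

theorem slice_int {m k : ℕ} (f : SchwartzMap (Eu m × Eu k) ℂ) (x : Eu k) :
    Integrable (fun y => f (y, x)) := by
  have hg : Function.HasTemperateGrowth (fun y : Eu m => (y, x)) := by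
    have h1 : Function.HasTemperateGrowth (fun y : Eu m =>
      (ContinuousLinearMap.inl ℝ (Eu m) (Eu k)) y + ((0 : Eu m), x)) :=
      (ContinuousLinearMap.hasTemperateGrowth _).add (Function.HasTemperateGrowth.const _)
    simpa using h1
  have := (SchwartzMap.compCLM ℂ hg ⟨1, 1, fun y => by
    have : ‖y‖ ≤ ‖(y, x)‖ := le_max_left _ _
    linarith⟩ f).integrable (μ := volume)
  exact this

theorem schw_cont_int {m k : ℕ} (h : SchwartzMap (Eu m × Eu k) ℂ) (x : Eu k) :
    Continuous fun ξ : Eu m => ∫ ξ' : Eu k, h (ξ, ξ') * ec (-x) ξ' := by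
  obtain ⟨C, hC⟩ : ∃ C : ℝ, ∀ q : Eu m × Eu k, (1 + ‖q‖) ^ (k + 1) * ‖h q‖ ≤ C := by
    have := SchwartzMap.one_add_le_sup_seminorm_apply (𝕜 := ℝ) (m := (k+1, 0)) (k := k+1) (n := 0)
      le_rfl le_rfl h
    simp only [norm_iteratedFDeriv_zero] at this
    exact ⟨_, this⟩
  have hC0 : 0 ≤ C := le_trans (by positivity) (hC 0)
  refine continuous_of_dominated (bound := fun ξ' => C * (1 + ‖ξ'‖) ^ (-((k : ℝ) + 1))) ?_ ?_ ?_ ?_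
  · intro ξ
    apply Continuous.aestronglyMeasurable
    have := h.continuous
    fun_prop
  · refine fun ξ => Filter.Eventually.of_forall fun ξ' => ?_
    rw [norm_mul, ec_norm, mul_one, Real.rpow_neg (by positivity), ← div_eq_mul_inv,
      le_div_iff₀ (by positivity), mul_comm]
    refine le_trans ?_ (hC (ξ, ξ'))
    have e1 : (1 + ‖ξ'‖) ^ ((k : ℝ) + 1) = (1 + ‖ξ'‖) ^ (k + 1) := by
      rw [← Real.rpow_natCast]; push_cast; rfl
    rw [e1]
    have : ‖ξ'‖ ≤ ‖(ξ, ξ')‖ := le_max_right _ _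
    gcongr
  · refine Integrable.const_mul (integrable_one_add_norm ?_) C
    simp
  · refine Filter.Eventually.of_forall fun ξ' => ?_
    have := h.continuous
    fun_prop

instance haarProd (m k : ℕ) : (volume : Measure (Eu m × Eu k)).IsAddHaarMeasure := by
  rw [Measure.volume_eq_prod]; infer_instance

theorem schw_ec_int {m k : ℕ} (h : SchwartzMap (Eu m × Eu k) ℂ) (x : Eu m) (x' : Eu k) :
    Integrable (fun q : Eu m × Eu k => h q * (ec x q.1 * ec x' q.2)) := by
  refine (h.integrable (μ := volume)).mono ?_ ?_
  · apply Continuous.aestronglyMeasurable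
    have := h.continuous
    fun_prop
  · refine Filter.Eventually.of_forall fun q => ?_
    simp [ec_norm]

theorem INV_iter {m k : ℕ} (h : SchwartzMap (Eu m × Eu k) ℂ) (x : Eu m) (x' : Eu k) :
    INV h (x, x') = ∫ ξ : Eu m, (∫ ξ' : Eu k, h (ξ, ξ') * ec (-x') ξ') * ec (-x) ξ := by
  rw [INV]
  have := integral_prod _ (schw_ec_int h (-x) (-x'))
  rw [Measure.volume_eq_prod]
  rw [this]
  congr 1; ext ξ
  rw [← integral_mul_const]
  congr 1; ext ξ'
  simp only; ring

open FourierTransform in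
theorem JsFst_INV {m k : ℕ} (s : ℝ) (h : SchwartzMap (Eu m × Eu k) ℂ) :
    JsFst s (INV h) = INV (wS (s / 2) 0 h) := by
  ext ⟨x, x'⟩
  obtain ⟨f, hf⟩ := INV_schwartz h
  set Φ : Eu m → ℂ := fun ξ => ∫ ξ' : Eu k, h (ξ, ξ') * ec (-x') ξ' with hΦ
  have hΦc : Continuous Φ := schw_cont_int h x'
  have hΦi : Integrable Φ := by
    have := schw_ec_int h 0 (-x')
    rw [Measure.volume_eq_prod] at this
    have := this.integral_prod_left
    refine this.congr (Filter.Eventually.of_forall fun ξ => ?_)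
    simp [hΦ, ec]
  have hinv : ∀ w : Eu m, 𝓕⁻ Φ w = INV h ((2 * π) • w, x') := by
    intro w
    rw [INV_iter, Real.fourierInv_eq']
    congr 1; ext ξ
    rw [smul_eq_mul, mul_comm]
    congr 1
    rw [ec, inner_neg_left, inner_smul_left, real_inner_comm]
    congr 1
    simp; ring
  have hF : Integrable (𝓕 Φ) := by
    have h1 : Integrable (fun y => f (y, x')) := slice_int f x'
    have h2 := h1.comp_smul (R := -(2 * π)) (neg_ne_zero.2 (by positivity))
    refine h2.congr (Filter.Eventually.of_forall fun w => ?_)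
    have : 𝓕 Φ w = 𝓕⁻ Φ (-w) := by rw [Real.fourierInv_eq_fourier_neg, neg_neg]
    simp only
    rw [this, hinv, hf]
    simp
  have hmain := hΦc.fourier_fourierInv_eq hΦi hF
  have key : ∀ ξ, (∫ y : Eu m, INV h (y, x') * ec y ξ) = ((2 * π) ^ m : ℝ) * Φ ξ := by
    intro ξ
    rw [← congrFun hmain ξ, Real.fourier_eq']
    have := Measure.integral_comp_smul (volume : Measure (Eu m))
      (fun y : Eu m => INV h (y, x') * ec y ξ) (2 * π)
    have e : (∫ v : Eu m, cexp (((-2 * π * ⟪v, ξ⟫ : ℝ) : ℂ) * I) • 𝓕⁻ Φ v)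
        = ∫ v : Eu m, INV h ((2 * π) • v, x') * ec ((2 * π) • v) ξ := by
      congr 1; ext v
      rw [hinv, smul_eq_mul, mul_comm]
      congr 2
      rw [inner_smul_left]
      simp; ring
    rw [e, this, finrank_euclideanSpace_fin, abs_of_pos (by positivity), Complex.real_smul, ← mul_assoc,
      ← Complex.ofReal_mul, mul_inv_cancel₀ (by positivity)]
    simp
  rw [INV_iter, JsFst, ← integral_const_mul]
  congr 1; ext ξ
  change _ * (_ * (∫ y : Eu m, INV h (y, x') * ec y ξ) * _) = _
  rw [key]
  have e1 : (∫ ξ' : Eu k, wS (s / 2) 0 h (ξ, ξ') * ec (-x') ξ') = ((lam ξ ^ (s / 2) : ℝ) : ℂ) * Φ ξ := by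
    rw [hΦ, ← integral_const_mul]
    congr 1; ext ξ'
    rw [wS_apply, lw, Real.rpow_zero, mul_one, mul_assoc]
  rw [e1]
  have e2 : ec (-x) ξ = cexp (I * ((⟪x, ξ⟫ : ℝ) : ℂ)) := by rw [ec]; simp
  have e3 : (((2 * π) ^ m)⁻¹ : ℝ) * (((2 * π) ^ m : ℝ) : ℂ) = 1 := by
    rw [← Complex.ofReal_mul, inv_mul_cancel₀ (by positivity)]; simp
  rw [e2]
  simp only
  rw [show (1 + ‖ξ‖ ^ 2) = lam ξ from rfl]
  linear_combination (((lam ξ ^ (s / 2) : ℝ) : ℂ) * Φ ξ * cexp (I * ((⟪x, ξ⟫ : ℝ) : ℂ))) * e3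

def swS {m k : ℕ} (h : SchwartzMap (Eu m × Eu k) ℂ) : SchwartzMap (Eu k × Eu m) ℂ :=
  SchwartzMap.compCLMOfContinuousLinearEquiv ℂ (ContinuousLinearEquiv.prodComm ℝ (Eu k) (Eu m)) h

theorem swS_apply {m k : ℕ} (h : SchwartzMap (Eu m × Eu k) ℂ) (q) : swS h q = h q.swap := rfl

theorem INV_swap {m k : ℕ} (h : SchwartzMap (Eu m × Eu k) ℂ) (p) : INV (swS h) p = INV h p.swap := by
  rw [INV, INV, Measure.volume_eq_prod, Measure.volume_eq_prod]
  rw [← integral_prod_swap]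
  congr 1; ext q
  simp only [swS_apply, Prod.swap_swap, Prod.fst_swap, Prod.snd_swap]
  ring

theorem JsSnd_INV {m k : ℕ} (s : ℝ) (h : SchwartzMap (Eu m × Eu k) ℂ) :
    JsSnd s (INV h) = INV (wS 0 (s / 2) h) := by
  have h1 := JsFst_INV s (swS h)
  have h2 : swS (wS 0 (s / 2) h) = wS (s / 2) 0 (swS h) := by
    ext q; simp only [swS_apply, wS_apply, lw]; simp
  ext x
  have h3 := congrFun h1 x.swap
  rw [← h2, INV_swap, Prod.swap_swap] at h3
  rw [← h3, show INV (swS h) = fun p => INV h p.swap from funext (INV_swap h)]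
  rfl

def EE {m k : ℕ} (x q : Eu m × Eu k) : ℂ := ec (-x.1) q.1 * ec (-x.2) q.2

theorem EE_norm {m k : ℕ} (x q : Eu m × Eu k) : ‖EE x q‖ = 1 := by simp [EE, ec_norm]

theorem EE_add {m k : ℕ} (x q r : Eu m × Eu k) : EE x (q + r) = EE x q * EE x r := by
  simp only [EE, Prod.fst_add, Prod.snd_add, ec_add_right]; ring

/-- bilinear multiplier -/
def TT {m k : ℕ} (σ : Eu m → Eu m → ℂ) (σ' : Eu k → Eu k → ℂ) (φ ψ : Eu m × Eu k → ℂ)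
    (x : Eu m × Eu k) : ℂ :=
  ∫ z : (Eu m × Eu k) × (Eu m × Eu k), (σ z.1.1 z.2.1 * σ' z.1.2 z.2.2) *
    ((φ z.1 * EE x z.1) * (ψ z.2 * EE x z.2))

def Dom {n : ℕ} (s : ℝ) (σ : Eu n → Eu n → ℂ) : Prop :=
  Measurable (Function.uncurry σ) ∧ ∃ K : ℝ, ∀ ξ η, ‖σ ξ η‖ ≤ K * (lam ξ ^ (s / 2) * lam η ^ (s / 2))

theorem Dom.bd {n : ℕ} {s : ℝ} {σ : Eu n → Eu n → ℂ} (h : Dom s σ) : ∃ K : ℝ, 0 ≤ K ∧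
    ∀ ξ η, ‖σ ξ η‖ ≤ K * (lam ξ ^ (s / 2) * lam η ^ (s / 2)) := by
  obtain ⟨-, K, hK⟩ := h
  refine ⟨|K|, abs_nonneg _, fun ξ η => (hK ξ η).trans ?_⟩
  have := lam_pos ξ; have := lam_pos η
  gcongr; exact le_abs_self K

theorem TT_dom {m k : ℕ} {s s' K K' : ℝ} {σ : Eu m → Eu m → ℂ} {σ' : Eu k → Eu k → ℂ} (h0 : 0 ≤ K)
    (h : ∀ ξ η, ‖σ ξ η‖ ≤ K * (lam ξ ^ (s / 2) * lam η ^ (s / 2)))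
    (h' : ∀ ξ η, ‖σ' ξ η‖ ≤ K' * (lam ξ ^ (s' / 2) * lam η ^ (s' / 2)))
    (φ ψ : SchwartzMap (Eu m × Eu k) ℂ) (x : Eu m × Eu k) (z : (Eu m × Eu k) × (Eu m × Eu k)) :
    ‖(σ z.1.1 z.2.1 * σ' z.1.2 z.2.2) * ((φ z.1 * EE x z.1) * (ψ z.2 * EE x z.2))‖ ≤
      K * K' * (‖wS (s / 2) (s' / 2) φ z.1‖ * ‖wS (s / 2) (s' / 2) ψ z.2‖) := by
  simp only [norm_mul, EE_norm, mul_one, wS_apply, Complex.norm_real, Real.norm_eq_abs]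
  have e : ∀ z : Eu m × Eu k, |lw (s / 2) (s' / 2) z| = lam z.1 ^ (s / 2) * lam z.2 ^ (s' / 2) :=
    fun z => abs_of_pos (by have := lam_pos z.1; have := lam_pos z.2; unfold lw; positivity)
  rw [e, e]
  calc _ ≤ (K * (lam z.1.1 ^ (s / 2) * lam z.2.1 ^ (s / 2))) *
      (K' * (lam z.1.2 ^ (s' / 2) * lam z.2.2 ^ (s' / 2))) * (‖φ z.1‖ * ‖ψ z.2‖) := by
        have := lam_pos z.1.1; have := lam_pos z.2.1
        gcongr
        · exact h _ _
        · exact h' _ _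
    _ = _ := by ring

theorem dom_int {m k : ℕ} (φ ψ : SchwartzMap (Eu m × Eu k) ℂ) (K : ℝ) :
    Integrable (fun z : (Eu m × Eu k) × (Eu m × Eu k) => K * (‖φ z.1‖ * ‖ψ z.2‖)) := by
  have h1 := (φ.integrable (μ := volume)).norm
  have h2 := (ψ.integrable (μ := volume)).norm
  exact (h1.mul_prod h2).const_mul K

theorem TT_meas {m k : ℕ} {σ : Eu m → Eu m → ℂ} {σ' : Eu k → Eu k → ℂ}
    (h : Measurable (Function.uncurry σ)) (h' : Measurable (Function.uncurry σ'))
    (φ ψ : SchwartzMap (Eu m × Eu k) ℂ) (x : Eu m × Eu k) :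
    Measurable fun z : (Eu m × Eu k) × (Eu m × Eu k) =>
      (σ z.1.1 z.2.1 * σ' z.1.2 z.2.2) * ((φ z.1 * EE x z.1) * (ψ z.2 * EE x z.2)) := by
  have q1 : Measurable fun z : (Eu m × Eu k) × (Eu m × Eu k) => (z.1.1, z.2.1) := by fun_prop
  have q2 : Measurable fun z : (Eu m × Eu k) × (Eu m × Eu k) => (z.1.2, z.2.2) := by fun_prop
  have r1 := h.comp q1
  have r2 := h'.comp q2
  have c1 : Measurable fun z : (Eu m × Eu k) × (Eu m × Eu k) =>
      ((φ z.1 * EE x z.1) * (ψ z.2 * EE x z.2)) := by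
    apply Continuous.measurable
    have := φ.continuous
    have := ψ.continuous
    unfold EE
    fun_prop
  exact (r1.mul r2).mul c1

theorem TT_int {m k : ℕ} {s s' : ℝ} {σ : Eu m → Eu m → ℂ} {σ' : Eu k → Eu k → ℂ}
    (h : Dom s σ) (h' : Dom s' σ') (φ ψ : SchwartzMap (Eu m × Eu k) ℂ) (x : Eu m × Eu k) :
    Integrable fun z : (Eu m × Eu k) × (Eu m × Eu k) =>
      (σ z.1.1 z.2.1 * σ' z.1.2 z.2.2) * ((φ z.1 * EE x z.1) * (ψ z.2 * EE x z.2)) := by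
  obtain ⟨K, hK0, hK⟩ := h.bd
  obtain ⟨K', -, hK'⟩ := h'.bd
  exact (dom_int (wS (s / 2) (s' / 2) φ) (wS (s / 2) (s' / 2) ψ) (K * K')).mono'
    (TT_meas h.1 h'.1 φ ψ x).aestronglyMeasurable
    (Filter.Eventually.of_forall fun z => TT_dom hK0 hK hK' φ ψ x z)

theorem TT_sum {m k : ℕ} {s s' : ℝ} {ι ι' : Type*} (J : Finset ι) (J' : Finset ι')
    {σ : ι → Eu m → Eu m → ℂ} {σ' : ι' → Eu k → Eu k → ℂ}
    (h : ∀ i, Dom s (σ i)) (h' : ∀ i, Dom s' (σ' i)) (φ ψ : SchwartzMap (Eu m × Eu k) ℂ)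
    (x : Eu m × Eu k) :
    TT (fun ξ η => ∑ i ∈ J, σ i ξ η) (fun ξ η => ∑ i ∈ J', σ' i ξ η) φ ψ x =
      ∑ i ∈ J, ∑ i' ∈ J', TT (σ i) (σ' i') φ ψ x := by
  unfold TT
  simp_rw [Finset.sum_mul_sum, Finset.sum_mul]
  rw [integral_finsetSum]
  · refine Finset.sum_congr rfl fun i _ => ?_
    rw [integral_finsetSum]
    exact fun i' _ => TT_int (h i) (h' i') φ ψ x
  · exact fun i _ => integrable_finsetSum _ fun i' _ => TT_int (h i) (h' i') φ ψ x

theorem TT_tendsto {m k : ℕ} {s s' K K' : ℝ} {σ : ℕ → Eu m → Eu m → ℂ} {σ' : ℕ → Eu k → Eu k → ℂ}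
    {σl : Eu m → Eu m → ℂ} {σl' : Eu k → Eu k → ℂ} (hK0 : 0 ≤ K)
    (hm : ∀ i, Measurable (Function.uncurry (σ i))) (hm' : ∀ i, Measurable (Function.uncurry (σ' i)))
    (h : ∀ i ξ η, ‖σ i ξ η‖ ≤ K * (lam ξ ^ (s / 2) * lam η ^ (s / 2)))
    (h' : ∀ i ξ η, ‖σ' i ξ η‖ ≤ K' * (lam ξ ^ (s' / 2) * lam η ^ (s' / 2)))
    (hl : ∀ ξ η, Filter.Tendsto (fun i => σ i ξ η) Filter.atTop (nhds (σl ξ η)))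
    (hl' : ∀ ξ η, Filter.Tendsto (fun i => σ' i ξ η) Filter.atTop (nhds (σl' ξ η)))
    (φ ψ : SchwartzMap (Eu m × Eu k) ℂ) (x : Eu m × Eu k) :
    Filter.Tendsto (fun i => TT (σ i) (σ' i) φ ψ x) Filter.atTop (nhds (TT σl σl' φ ψ x)) := by
  unfold TT
  refine tendsto_integral_of_dominated_convergence
    (fun z => K * K' * (‖wS (s / 2) (s' / 2) φ z.1‖ * ‖wS (s / 2) (s' / 2) ψ z.2‖)) ?_ ?_ ?_ ?_
  · exact fun i => (TT_meas (hm i) (hm' i) φ ψ x).aestronglyMeasurable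
  · exact dom_int _ _ _
  · exact fun i => Filter.Eventually.of_forall fun z => TT_dom hK0 (h i) (h' i) φ ψ x z
  · exact Filter.Eventually.of_forall fun z => ((hl _ _).mul (hl' _ _)).mul_const _

theorem lam_add_rpow {n : ℕ} {s : ℝ} (hs : 0 ≤ s) (ξ η : Eu n) :
    ‖((lam (ξ + η) ^ (s / 2) : ℝ) : ℂ)‖ ≤ (2 : ℝ) ^ (s / 2) * (lam ξ ^ (s / 2) * lam η ^ (s / 2)) := by
  have h1 := lam_pos ξ; have h2 := lam_pos η; have h3 := lam_pos (ξ + η)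
  rw [Complex.norm_real, Real.norm_eq_abs, abs_of_pos (by positivity), ← Real.mul_rpow h1.le h2.le,
    ← Real.mul_rpow (by norm_num) (by positivity)]
  exact Real.rpow_le_rpow h3.le (lam_add ξ η) (by positivity)

theorem prod_formula {m k : ℕ} {s s' : ℝ} (hs : 0 ≤ s) (hs' : 0 ≤ s')
    (φ ψ : SchwartzMap (Eu m × Eu k) ℂ) (x : Eu m × Eu k) :
    JsFst s (JsSnd s' (fun x => INV φ x * INV ψ x)) x =
      TT (fun ξ η => ((lam (ξ + η) ^ (s / 2) : ℝ) : ℂ))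
        (fun ξ η => ((lam (ξ + η) ^ (s' / 2) : ℝ) : ℂ)) φ ψ x := by
  obtain ⟨h, hh, hp⟩ := INV_mul φ ψ
  rw [show (fun x => INV φ x * INV ψ x) = INV h from funext hp, JsSnd_INV, JsFst_INV, wS_wS]
  simp only [add_zero, zero_add]
  have cl : ∀ {n : ℕ} (s : ℝ), Continuous fun ξ : Eu n => lam ξ ^ s := fun s => by
    refine Continuous.rpow_const (by unfold lam; fun_prop) fun ξ => Or.inl (lam_pos ξ).ne'
  let G : (Eu m × Eu k) × (Eu m × Eu k) → ℂ := fun z =>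
    ((lam (z.1.1 + z.2.1) ^ (s / 2) : ℝ) * (lam (z.1.2 + z.2.2) ^ (s' / 2) : ℝ) : ℂ) *
      ((φ z.1 * EE x z.1) * (ψ z.2 * EE x z.2))
  have Gc : Continuous G := by
    have a1 := (cl (n := m) (s / 2)).comp
      (by fun_prop : Continuous fun z : (Eu m × Eu k) × (Eu m × Eu k) => z.1.1 + z.2.1)
    have a2 := (cl (n := k) (s' / 2)).comp
      (by fun_prop : Continuous fun z : (Eu m × Eu k) × (Eu m × Eu k) => z.1.2 + z.2.2)
    have := φ.continuous
    have := ψ.continuous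
    have a3 : Continuous fun z : (Eu m × Eu k) × (Eu m × Eu k) =>
      ((φ z.1 * EE x z.1) * (ψ z.2 * EE x z.2)) := by unfold EE; fun_prop
    exact ((Complex.continuous_ofReal.comp a1).mul (Complex.continuous_ofReal.comp a2)).mul a3
  have Gb : ∀ z, ‖G z‖ ≤ ((2 : ℝ) ^ (s / 2) * (2 : ℝ) ^ (s' / 2)) *
      (‖wS (s / 2) (s' / 2) φ z.1‖ * ‖wS (s / 2) (s' / 2) ψ z.2‖) := fun z =>
    TT_dom (by positivity) (lam_add_rpow hs) (lam_add_rpow hs') φ ψ x z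
  have Gi : Integrable G := (dom_int _ _ _).mono' Gc.aestronglyMeasurable
    (Filter.Eventually.of_forall Gb)
  have Gi2 : Integrable (fun z : (Eu m × Eu k) × (Eu m × Eu k) => G (z.2, z.1 - z.2))
      ((volume : Measure (Eu m × Eu k)).prod volume) := by
    have h1 := ((wS (s / 2) (s' / 2) φ).integrable (μ := volume)).norm
    have h2 := ((wS (s / 2) (s' / 2) ψ).integrable (μ := volume)).norm
    have h3 := (h1.convolution_integrand (ContinuousLinearMap.mul ℝ ℝ) h2).const_mul
      ((2 : ℝ) ^ (s / 2) * (2 : ℝ) ^ (s' / 2))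
    refine h3.mono' ?_ (Filter.Eventually.of_forall fun z => Gb (z.2, z.1 - z.2))
    apply Continuous.aestronglyMeasurable
    fun_prop
  have hTT : TT (fun ξ η => ((lam (ξ + η) ^ (s / 2) : ℝ) : ℂ))
        (fun ξ η => ((lam (ξ + η) ^ (s' / 2) : ℝ) : ℂ)) φ ψ x = ∫ z, G z := rfl
  rw [hTT, Measure.volume_eq_prod, integral_prod _ Gi]
  have e1 : ∀ t, ∫ r, G (t, r) = ∫ q, G (t, q - t) := fun t =>
    (integral_sub_right_eq_self (fun r => G (t, r)) t).symm
  simp_rw [e1]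
  rw [← integral_integral_swap (f := fun q t => G (t, q - t)) Gi2, INV]
  congr 1; ext q
  rw [wS_apply, hh, ← integral_const_mul, ← integral_mul_const]
  congr 1; ext t
  change _ * EE x q = _
  have : q = t + (q - t) := by abel
  conv_lhs => rw [this]
  rw [EE_add, lw, ← this]
  simp only [G, Prod.fst_sub, Prod.snd_sub, add_sub_cancel]
  push_cast; ring

theorem K2.meas {n : ℕ} {σ : Eu n → Eu n → ℂ} {c : ℝ≥0∞} {τ0 τ1 τ2 : Measure (Eu n)}
    (h : K2 σ c τ0 τ1 τ2) : Measurable (Function.uncurry σ) := by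
  obtain ⟨ν, b, hν, hb, hi, hr, -⟩ := h
  have : StronglyMeasurable fun z : Eu n × Eu n => ∫ p, b p * ec p.2.1 z.1 * ec p.2.2 z.2 ∂ν := by
    apply StronglyMeasurable.integral_prod_right (f := fun (z : Eu n × Eu n) p => b p * ec p.2.1 z.1 * ec p.2.2 z.2)
    apply Measurable.stronglyMeasurable
    have q1 : Measurable fun w : (Eu n × Eu n) × (Eu n × Eu n × Eu n) => b w.2 := hb.comp measurable_snd
    have q2 : Measurable fun w : (Eu n × Eu n) × (Eu n × Eu n × Eu n) => ec w.2.2.1 w.1.1 :=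
      measurable_ec (by fun_prop) (by fun_prop)
    have q3 : Measurable fun w : (Eu n × Eu n) × (Eu n × Eu n × Eu n) => ec w.2.2.2 w.1.2 :=
      measurable_ec (by fun_prop) (by fun_prop)
    exact (q1.mul q2).mul q3
  have e : Function.uncurry σ = fun z : Eu n × Eu n => ∫ p, b p * ec p.2.1 z.1 * ec p.2.2 z.2 ∂ν := by
    ext z; exact hr z.1 z.2
  rw [e]; exact this.measurable

theorem K2.bdd {n : ℕ} {σ : Eu n → Eu n → ℂ} {c : ℝ≥0∞} {τ0 τ1 τ2 : Measure (Eu n)}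
    (h : K2 σ c τ0 τ1 τ2) : ∃ K : ℝ, 0 ≤ K ∧ ∀ ξ η, ‖σ ξ η‖ ≤ K := by
  obtain ⟨ν, b, hν, hb, hi, hr, -⟩ := h
  refine ⟨∫ p, ‖b p‖ ∂ν, integral_nonneg fun _ => norm_nonneg _, fun ξ η => ?_⟩
  rw [hr]
  refine (norm_integral_le_integral_norm _).trans (le_of_eq ?_)
  congr 1; ext p; simp [ec_norm]

theorem Region.dom {n : ℕ} {s A r : ℝ} {C0 C : ℝ≥0∞} {r0 : ℝ} {S : Set (Bool × Bool)} {α : ℝ}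
    {w : ℕ × ℕ → Bool × Bool → ℝ≥0∞} {σ : ℕ × ℕ → Eu n → Eu n → ℂ} (hs : 0 ≤ s)
    (R : Region s A r C0 C r0 S α w σ) (p : ℕ × ℕ) : Dom s (σ p) := by
  obtain ⟨e, he⟩ := R.ne
  obtain ⟨τ0, τ1, τ2, τt, δ, -, h⟩ := R.piece p
  obtain ⟨σe, hK, hσ⟩ := h e he
  have e0 : Function.uncurry (σ p) = fun z : Eu n × Eu n => Function.uncurry σe z *
      ((lam z.1 ^ bp s e.1 * lam z.2 ^ bp s e.2 : ℝ) : ℂ) := by ext z; exact hσ z.1 z.2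
  refine ⟨?_, ?_⟩
  · rw [e0]
    refine hK.meas.mul ?_
    apply Measurable.complex_ofReal
    unfold lam
    fun_prop
  · obtain ⟨K, hK0, hK⟩ := hK.bdd
    refine ⟨K, fun ξ η => ?_⟩
    have l1 := lam_pos ξ; have l2 := lam_pos η
    rw [hσ, norm_mul, Complex.norm_real, Real.norm_eq_abs, abs_of_pos (by positivity)]
    have hb : ∀ ε, bp s ε ≤ s / 2 := by intro ε; cases ε <;> simp [bp]; linarith
    have b1 := Real.rpow_le_rpow_of_exponent_le (one_le_lam ξ) (hb e.1)
    have b2 := Real.rpow_le_rpow_of_exponent_le (one_le_lam η) (hb e.2)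
    gcongr
    exact hK ξ η

theorem expand {m k : ℕ} {s s' A A' r r' : ℝ} {C0 C C0' C' : ℝ≥0∞} {r0 r0' : ℝ} {R R' : ℕ}
    {d : Fin R → RD m} {d' : Fin R' → RD k} (hs : 0 ≤ s) (hs' : 0 ≤ s')
    (hd : Decomp m s A r C0 C r0 d) (hd' : Decomp k s' A' r' C0' C' r0' d')
    (φ ψ : SchwartzMap (Eu m × Eu k) ℂ) (x : Eu m × Eu k) :
    ‖JsFst s (JsSnd s' (fun x => INV φ x * INV ψ x)) x‖ₑ ≤
      ∑ i, ∑ i', ∑' p, ∑' p', ‖TT ((d i).σ p) ((d' i').σ p') φ ψ x‖ₑ := by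
  obtain ⟨hR, ⟨K, hK⟩, hl⟩ := hd
  obtain ⟨hR', ⟨K', hK'⟩, hl'⟩ := hd'
  rw [prod_formula hs hs']
  have e1 : ∀ M ξ η, ∑ i, ∑ p ∈ box M, (d i).σ p ξ η
      = ∑ j ∈ Finset.univ ×ˢ box M, (d j.1).σ j.2 ξ η := fun M ξ η => by rw [Finset.sum_product]
  have e1' : ∀ M ξ η, ∑ i, ∑ p ∈ box M, (d' i).σ p ξ η
      = ∑ j ∈ Finset.univ ×ˢ box M, (d' j.1).σ j.2 ξ η := fun M ξ η => by rw [Finset.sum_product]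
  simp_rw [e1] at hK hl
  simp_rw [e1'] at hK' hl'
  have D : ∀ j : Fin R × (ℕ × ℕ), Dom s ((d j.1).σ j.2) := fun j => (hR j.1).dom hs j.2
  have D' : ∀ j : Fin R' × (ℕ × ℕ), Dom s' ((d' j.1).σ j.2) := fun j => (hR' j.1).dom hs' j.2
  have hK1 : ∀ M ξ η, ‖∑ j ∈ Finset.univ ×ˢ box M, (d j.1).σ j.2 ξ η‖ ≤
      |K| * (lam ξ ^ (s / 2) * lam η ^ (s / 2)) := fun M ξ η => by
    refine (hK M ξ η).trans ?_
    have := lam_pos ξ; have := lam_pos η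
    gcongr; exact le_abs_self K
  have T := TT_tendsto (s := s) (s' := s') (abs_nonneg K)
    (σ := fun M ξ η => ∑ j ∈ Finset.univ ×ˢ box M, (d j.1).σ j.2 ξ η)
    (σ' := fun M ξ η => ∑ j ∈ Finset.univ ×ˢ box M, (d' j.1).σ j.2 ξ η)
    (fun M => by
      have : Measurable fun z : Eu m × Eu m => ∑ j ∈ Finset.univ ×ˢ box M, Function.uncurry ((d j.1).σ j.2) z :=
        Finset.measurable_fun_sum _ fun j _ => (D j).1
      exact this)
    (fun M => by
      have : Measurable fun z : Eu k × Eu k => ∑ j ∈ Finset.univ ×ˢ box M, Function.uncurry ((d' j.1).σ j.2) z :=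
        Finset.measurable_fun_sum _ fun j _ => (D' j).1
      exact this)
    hK1 hK' hl hl' φ ψ x
  refine le_of_tendsto T.enorm (Filter.Eventually.of_forall fun M => ?_)
  have := TT_sum (s := s) (s' := s') (Finset.univ ×ˢ box M) (Finset.univ ×ˢ box M)
    (σ := fun j : Fin R × (ℕ × ℕ) => (d j.1).σ j.2) (σ' := fun j : Fin R' × (ℕ × ℕ) => (d' j.1).σ j.2)
    D D' φ ψ x
  rw [this]
  refine (enorm_sum_le _ _).trans ?_
  rw [Finset.sum_product]
  refine Finset.sum_le_sum fun i _ => ?_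
  calc _ ≤ ∑ p ∈ box M, ∑ i', ∑ p' ∈ box M, ‖TT ((d i).σ p) ((d' i').σ p') φ ψ x‖ₑ := by
        refine Finset.sum_le_sum fun p _ => (enorm_sum_le _ _).trans (le_of_eq ?_)
        rw [Finset.sum_product]
    _ = ∑ i', ∑ p ∈ box M, ∑ p' ∈ box M, ‖TT ((d i).σ p) ((d' i').σ p') φ ψ x‖ₑ := Finset.sum_comm
    _ ≤ _ := by
        refine Finset.sum_le_sum fun i' _ => ?_
        refine (Finset.sum_le_sum fun p _ => ENNReal.sum_le_tsum (box M)).trans (ENNReal.sum_le_tsum _)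

theorem TT_weight {m k : ℕ} {σ σe : Eu m → Eu m → ℂ} {σ' σe' : Eu k → Eu k → ℂ} {a b a' b' : ℝ}
    (h : ∀ ξ η, σ ξ η = σe ξ η * ((lam ξ ^ a * lam η ^ b : ℝ) : ℂ))
    (h' : ∀ ξ η, σ' ξ η = σe' ξ η * ((lam ξ ^ a' * lam η ^ b' : ℝ) : ℂ))
    (φ ψ : SchwartzMap (Eu m × Eu k) ℂ) (x : Eu m × Eu k) :
    TT σ σ' φ ψ x = TT σe σe' (wS a a' φ) (wS b b' ψ) x := by
  unfold TT
  congr 1; ext z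
  rw [h, h', wS_apply, wS_apply, lw, lw]
  push_cast; ring

theorem ec_shift {n : ℕ} (x y ξ : Eu n) : ec (-(x - y)) ξ = ec y ξ * ec (-x) ξ := by
  rw [← ec_add]; congr 1; abel

abbrev QQ (m k : ℕ) := (Eu m × Eu m × Eu m) × (Eu k × Eu k × Eu k)

theorem TT_rep {m k : ℕ} {ν : Measure (Eu m × Eu m × Eu m)} {ν' : Measure (Eu k × Eu k × Eu k)}
    [SFinite ν] [SFinite ν'] {b : Eu m × Eu m × Eu m → ℂ} {b' : Eu k × Eu k × Eu k → ℂ}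
    (hb : Measurable b) (hb' : Measurable b') (hi : Integrable b ν) (hi' : Integrable b' ν')
    {σ : Eu m → Eu m → ℂ} {σ' : Eu k → Eu k → ℂ}
    (hσ : ∀ ξ η, σ ξ η = ∫ p, b p * ec p.2.1 ξ * ec p.2.2 η ∂ν)
    (hσ' : ∀ ξ η, σ' ξ η = ∫ p, b' p * ec p.2.1 ξ * ec p.2.2 η ∂ν')
    (φ ψ : SchwartzMap (Eu m × Eu k) ℂ) (x : Eu m × Eu k) :
    TT σ σ' φ ψ x = ∫ P, b P.1 * b' P.2 * (INV φ (x.1 - P.1.2.1, x.2 - P.2.2.1) *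
      INV ψ (x.1 - P.1.2.2, x.2 - P.2.2.2)) ∂(ν.prod ν') := by
  let G : ((Eu m × Eu k) × (Eu m × Eu k)) → QQ m k → ℂ := fun z P =>
    (b P.1 * ec P.1.2.1 z.1.1 * ec P.1.2.2 z.2.1) * (b' P.2 * ec P.2.2.1 z.1.2 * ec P.2.2.2 z.2.2) *
      ((φ z.1 * EE x z.1) * (ψ z.2 * EE x z.2))
  have Gm : Measurable (Function.uncurry G) := by
    have m1 : Measurable fun w : ((Eu m × Eu k) × (Eu m × Eu k)) × QQ m k => b w.2.1 := by
      have q1 : Measurable fun w : ((Eu m × Eu k) × (Eu m × Eu k)) × QQ m k => w.2.1 := by fun_prop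
      exact hb.comp q1
    have m2 : Measurable fun w : ((Eu m × Eu k) × (Eu m × Eu k)) × QQ m k => b' w.2.2 := by
      have q1 : Measurable fun w : ((Eu m × Eu k) × (Eu m × Eu k)) × QQ m k => w.2.2 := by fun_prop
      exact hb'.comp q1
    have m3 : Measurable fun w : ((Eu m × Eu k) × (Eu m × Eu k)) × QQ m k => ec w.2.1.2.1 w.1.1.1 :=
      measurable_ec (by fun_prop) (by fun_prop)
    have m4 : Measurable fun w : ((Eu m × Eu k) × (Eu m × Eu k)) × QQ m k => ec w.2.1.2.2 w.1.2.1 :=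
      measurable_ec (by fun_prop) (by fun_prop)
    have m5 : Measurable fun w : ((Eu m × Eu k) × (Eu m × Eu k)) × QQ m k => ec w.2.2.2.1 w.1.1.2 :=
      measurable_ec (by fun_prop) (by fun_prop)
    have m6 : Measurable fun w : ((Eu m × Eu k) × (Eu m × Eu k)) × QQ m k => ec w.2.2.2.2 w.1.2.2 :=
      measurable_ec (by fun_prop) (by fun_prop)
    have c1 : Measurable fun z : (Eu m × Eu k) × (Eu m × Eu k) =>
        ((φ z.1 * EE x z.1) * (ψ z.2 * EE x z.2)) := by
      apply Continuous.measurable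
      have := φ.continuous
      have := ψ.continuous
      unfold EE
      fun_prop
    have m7 : Measurable fun w : ((Eu m × Eu k) × (Eu m × Eu k)) × QQ m k =>
      ((φ w.1.1 * EE x w.1.1) * (ψ w.1.2 * EE x w.1.2)) := c1.comp measurable_fst
    exact (((m1.mul m3).mul m4).mul ((m2.mul m5).mul m6)).mul m7
  have Gi : Integrable (Function.uncurry G) (volume.prod (ν.prod ν')) := by
    have h1 := dom_int φ ψ 1
    have h2 := hi.norm.mul_prod hi'.norm
    have h3 := h1.mul_prod h2
    refine h3.mono' Gm.aestronglyMeasurable (Filter.Eventually.of_forall fun w => le_of_eq ?_)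
    simp only [Function.uncurry, G, norm_mul, ec_norm, EE_norm]
    ring
  have e1 : ∀ z : (Eu m × Eu k) × (Eu m × Eu k), (σ z.1.1 z.2.1 * σ' z.1.2 z.2.2) *
      ((φ z.1 * EE x z.1) * (ψ z.2 * EE x z.2)) = ∫ P, G z P ∂(ν.prod ν') := by
    intro z
    rw [hσ, hσ', ← integral_prod_mul, ← integral_mul_const]
  unfold TT
  simp_rw [e1]
  rw [integral_integral_swap Gi]
  congr 1; ext P
  rw [INV, INV, ← integral_prod_mul, ← integral_const_mul]
  rw [← Measure.volume_eq_prod]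
  congr 1; ext z
  simp only [G, ec_shift, EE]
  ring

theorem TT_bound {m k : ℕ} {σ : Eu m → Eu m → ℂ} {σ' : Eu k → Eu k → ℂ} {c c' : ℝ≥0∞}
    {τ0 τ1 τ2 : Measure (Eu m)} {τ0' τ1' τ2' : Measure (Eu k)} [SFinite τ0] [SFinite τ1] [SFinite τ2]
    [SFinite τ0'] [SFinite τ1'] [SFinite τ2']
    (h : K2 σ c τ0 τ1 τ2) (h' : K2 σ' c' τ0' τ1' τ2')
    (φ ψ : SchwartzMap (Eu m × Eu k) ℂ) (x : Eu m) (x' : Eu k) :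
    ‖TT σ σ' φ ψ (x, x')‖ₑ ≤ c * c' * Av1 τ0 (Av2 τ0' (fun x y =>
      Av1 τ1 (Av2 τ1' (fun x y => ‖INV φ (x, y)‖ₑ)) x y *
      Av1 τ2 (Av2 τ2' (fun x y => ‖INV ψ (x, y)‖ₑ)) x y)) x x' := by
  obtain ⟨ν, b, hν, hb, hi, hσ, hB⟩ := h
  obtain ⟨ν', b', hν', hb', hi', hσ', hB'⟩ := h'
  rw [TT_rep hb hb' hi hi' hσ hσ']
  have meas : ∀ φ : SchwartzMap (Eu m × Eu k) ℂ, Measurable fun p => ‖INV φ p‖ₑ := by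
    intro φ
    obtain ⟨f, hf⟩ := INV_schwartz φ
    rw [← hf]
    exact f.continuous.measurable.enorm
  obtain ⟨F, hFd⟩ : ∃ F : Eu m → Eu k → ℝ≥0∞, F = fun x y => ‖INV φ (x, y)‖ₑ := ⟨_, rfl⟩
  obtain ⟨G, hGd⟩ : ∃ G : Eu m → Eu k → ℝ≥0∞, G = fun x y => ‖INV ψ (x, y)‖ₑ := ⟨_, rfl⟩
  have hF : Measurable (Function.uncurry F) := by rw [hFd]; exact meas φ
  have hG : Measurable (Function.uncurry G) := by rw [hGd]; exact meas ψ
  rw [← hFd, ← hGd]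
  have hF2 : Measurable (Function.uncurry (Av2 τ1' F)) := measurable_Av2 τ1' hF
  have hG2 : Measurable (Function.uncurry (Av2 τ2' G)) := measurable_Av2 τ2' hG
  refine (enorm_integral_le_lintegral_enorm _).trans ?_
  have hb'e : Measurable fun p => ‖b' p‖ₑ := hb'.enorm
  have hbe : Measurable fun p => ‖b p‖ₑ := hb.enorm
  have mInt : Measurable fun P : (Eu m × Eu m × Eu m) × (Eu k × Eu k × Eu k) =>
      ‖b P.1 * b' P.2 * (INV φ (x - P.1.2.1, x' - P.2.2.1) *
      INV ψ (x - P.1.2.2, x' - P.2.2.2))‖ₑ := by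
    simp only [enorm_mul]
    have q1 : Measurable fun P : (Eu m × Eu m × Eu m) × (Eu k × Eu k × Eu k) => (x - P.1.2.1, x' - P.2.2.1) := by
      fun_prop
    have q2 : Measurable fun P : (Eu m × Eu m × Eu m) × (Eu k × Eu k × Eu k) => (x - P.1.2.2, x' - P.2.2.2) := by
      fun_prop
    have r1 := (meas φ).comp q1
    have r2 := (meas ψ).comp q2
    have r3 := hbe.comp (measurable_fst : Measurable (Prod.fst : (Eu m × Eu m × Eu m) × (Eu k × Eu k × Eu k) → _))
    have r4 := hb'e.comp (measurable_snd : Measurable (Prod.snd : (Eu m × Eu m × Eu m) × (Eu k × Eu k × Eu k) → _))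
    exact (r3.mul r4).mul (r1.mul r2)
  rw [lintegral_prod _ mInt.aemeasurable]
  -- inner bound
  let H : Eu m → Eu m → ℝ≥0∞ := fun Y Z =>
    ∫⁻ u', Av2 τ1' F (x - Y) (x' - u') * Av2 τ2' G (x - Z) (x' - u') ∂τ0'
  have inner : ∀ p : Eu m × Eu m × Eu m,
      ∫⁻ p', ‖b p * b' p' * (INV φ (x - p.2.1, x' - p'.2.1) * INV ψ (x - p.2.2, x' - p'.2.2))‖ₑ ∂ν'
        ≤ c' * (‖b p‖ₑ * H p.2.1 p.2.2) := by
    intro p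
    have m1 : ∀ w, Measurable fun y' : Eu k => F w (x' - y') := fun w => by
      have q1 : Measurable fun y' : Eu k => (w, x' - y') := by fun_prop
      have q2 := hF.comp q1
      exact q2
    have m2 : ∀ w, Measurable fun y' : Eu k => G w (x' - y') := fun w => by
      have q1 : Measurable fun y' : Eu k => (w, x' - y') := by fun_prop
      have q2 := hG.comp q1
      exact q2
    have mm : Measurable (Function.uncurry fun Y' Z' : Eu k =>
        F (x - p.2.1) (x' - Y') * G (x - p.2.2) (x' - Z')) := by
      have r1 := (m1 (x - p.2.1)).comp (measurable_fst : Measurable (Prod.fst : Eu k × Eu k → Eu k))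
      have r2 := (m2 (x - p.2.2)).comp (measurable_snd : Measurable (Prod.snd : Eu k × Eu k → Eu k))
      exact r1.mul r2
    have := hB' (fun Y' Z' => F (x - p.2.1) (x' - Y') * G (x - p.2.2) (x' - Z')) mm
    calc _ = ∫⁻ p', ‖b p‖ₑ * (‖b' p'‖ₑ * (F (x - p.2.1) (x' - p'.2.1) * G (x - p.2.2) (x' - p'.2.2))) ∂ν' := by
          congr 1; ext p'
          simp only [enorm_mul, hFd, hGd]; ring
      _ = ‖b p‖ₑ * ∫⁻ p', (‖b' p'‖ₑ * (F (x - p.2.1) (x' - p'.2.1) * G (x - p.2.2) (x' - p'.2.2))) ∂ν' :=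
          lintegral_const_mul' _ _ (by finiteness)
      _ ≤ _ := by
          rw [mul_left_comm c']
          refine mul_le_mul_right (this.trans (le_of_eq ?_)) _
          simp only [H]
          congr 1
          refine lintegral_congr fun u' => ?_
          have n1 : Measurable fun y' : Eu k => F (x - p.2.1) (x' - (u' + y')) := by
            have q1 : Measurable fun y' : Eu k => u' + y' := by fun_prop
            have q2 := (m1 (x - p.2.1)).comp q1
            exact q2
          have n2 : Measurable fun y' : Eu k => G (x - p.2.2) (x' - (u' + y')) := by
            have q1 : Measurable fun y' : Eu k => u' + y' := by fun_prop
            have q2 := (m2 (x - p.2.2)).comp q1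
            exact q2
          have := lintegral_lintegral_mul (μ := τ1') (ν := τ2') n1.aemeasurable n2.aemeasurable
          rw [this]
          simp only [Av2, sub_sub]
  refine (lintegral_mono inner).trans ?_
  -- measurability of H
  have mA : Measurable fun w : (Eu m × Eu m) × Eu k => Av2 τ1' F (x - w.1.1) (x' - w.2) := by
    have q1 : Measurable fun w : (Eu m × Eu m) × Eu k => (x - w.1.1, x' - w.2) := by fun_prop
    have q2 := hF2.comp q1
    exact q2
  have mB : Measurable fun w : (Eu m × Eu m) × Eu k => Av2 τ2' G (x - w.1.2) (x' - w.2) := by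
    have q1 : Measurable fun w : (Eu m × Eu m) × Eu k => (x - w.1.2, x' - w.2) := by fun_prop
    have q2 := hG2.comp q1
    exact q2
  have mAB := mA.mul mB
  have mH : Measurable (Function.uncurry H) := by
    have := Measurable.lintegral_prod_right' (ν := τ0') mAB
    exact this
  have mbH : Measurable fun p : Eu m × Eu m × Eu m => ‖b p‖ₑ * H p.2.1 p.2.2 := by
    have q1 : Measurable fun p : Eu m × Eu m × Eu m => (p.2.1, p.2.2) := by fun_prop
    have q2 := mH.comp q1
    exact hbe.mul q2
  rw [lintegral_const_mul _ mbH, mul_comm c c', mul_assoc]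
  refine mul_le_mul_right ((hB H mH).trans ?_) _
  refine mul_le_mul_right (le_of_eq ?_) _
  have step : ∀ u, ∫⁻ y, ∫⁻ z, H (u + y) (u + z) ∂τ2 ∂τ1 =
      ∫⁻ u', (Av1 τ1 (Av2 τ1' F) (x - u) (x' - u') * Av1 τ2 (Av2 τ2' G) (x - u) (x' - u')) ∂τ0' := by
    intro u
    have mT : Measurable fun w : (Eu m × Eu m) × Eu k =>
        Av2 τ1' F (x - (u + w.1.1)) (x' - w.2) * Av2 τ2' G (x - (u + w.1.2)) (x' - w.2) := by
      have q1 : Measurable fun w : (Eu m × Eu m) × Eu k => (((u + w.1.1, u + w.1.2) : Eu m × Eu m), w.2) := by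
        fun_prop
      have q2 := mAB.comp q1
      exact q2
    simp only [H]
    have s1 : ∀ y, ∫⁻ z, ∫⁻ u', Av2 τ1' F (x - (u + y)) (x' - u') * Av2 τ2' G (x - (u + z)) (x' - u') ∂τ0' ∂τ2
        = ∫⁻ u', ∫⁻ z, Av2 τ1' F (x - (u + y)) (x' - u') * Av2 τ2' G (x - (u + z)) (x' - u') ∂τ2 ∂τ0' := by
      intro y
      apply lintegral_lintegral_swap
      have q1 : Measurable fun w : Eu m × Eu k => (((y, w.1) : Eu m × Eu m), w.2) := by fun_prop
      have q2 := mT.comp q1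
      exact q2.aemeasurable
    simp_rw [s1]
    rw [lintegral_lintegral_swap]
    · refine lintegral_congr fun u' => ?_
      have n1 : Measurable fun y : Eu m => Av2 τ1' F (x - (u + y)) (x' - u') := by
        have q1 : Measurable fun y : Eu m => (x - (u + y), x' - u') := by fun_prop
        have q2 := hF2.comp q1
        exact q2
      have n2 : Measurable fun y : Eu m => Av2 τ2' G (x - (u + y)) (x' - u') := by
        have q1 : Measurable fun y : Eu m => (x - (u + y), x' - u') := by fun_prop
        have q2 := hG2.comp q1
        exact q2
      rw [lintegral_lintegral_mul n1.aemeasurable n2.aemeasurable]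
      simp only [Av1, sub_sub]
    · have q1 : Measurable fun w : (Eu m × Eu k) × Eu m => (((w.1.1, w.2) : Eu m × Eu m), w.1.2) := by fun_prop
      have := Measurable.lintegral_prod_right' (ν := τ2) (mT.comp q1)
      exact this.aemeasurable
  simp_rw [step]
  rfl

theorem Lq_const_mul' {n : ℕ} (a : ℝ) {q : ℝ≥0∞} (hq : q ≠ 0) {c : ℝ≥0∞}
    {h : Eu n → ℝ≥0∞} (hh : Measurable h) : Lq a q (fun x => c * h x) = c * Lq a q h := by
  unfold Lq
  split_ifs with hT
  · exact ENNReal.essSup_const_mul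
  · have hq' : 0 < q.toReal := ENNReal.toReal_pos hq hT
    simp_rw [ENNReal.mul_rpow_of_nonneg _ _ hq'.le, mul_assoc]
    have hm : Measurable fun x => h x ^ q.toReal * jweight a x :=
      (hh.pow_const _).mul (measurable_jweight _)
    rw [lintegral_const_mul _ hm,
      ENNReal.mul_rpow_of_nonneg _ _ (by positivity), ← ENNReal.rpow_mul,
      mul_one_div_cancel hq'.ne', ENNReal.rpow_one]

theorem MN_const_mul' {m k : ℕ} {Q : ℝ≥0∞} {B : ℝ} {q : ℝ≥0∞} {b : ℝ} (hQ : Q ≠ 0) (hq : q ≠ 0)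
    {c : ℝ≥0∞} {H : Eu m → Eu k → ℝ≥0∞} (hH : Measurable (Function.uncurry H)) :
    MN Q B q b (fun x y => c * H x y) = c * MN Q B q b H := by
  unfold MN
  have h1 : ∀ y, Lq b q (fun x => c * H x y) = c * Lq b q (fun x => H x y) := fun y => by
    have q1 : Measurable fun x : Eu m => (x, y) := by fun_prop
    have q2 := hH.comp q1
    exact Lq_const_mul' b hq q2
  simp_rw [h1]
  exact Lq_const_mul' B hQ (measurable_Lq b q hH)

theorem tsum_rpow_le {ι : Type*} (f : ι → ℝ≥0∞) {r : ℝ} (hr : 0 < r) (hr1 : r ≤ 1) :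
    (∑' i, f i) ^ r ≤ ∑' i, f i ^ r := by
  have key : ∀ s : Finset ι, (∑ i ∈ s, f i) ^ r ≤ ∑ i ∈ s, f i ^ r := by
    intro s
    classical
    induction s using Finset.induction_on with
    | empty => simp [hr]
    | insert a s ha ih =>
      rw [Finset.sum_insert ha, Finset.sum_insert ha]
      exact (ENNReal.rpow_add_le_add_rpow _ _ hr.le hr1).trans (by gcongr)
  rw [← ENNReal.le_rpow_inv_iff hr, ENNReal.tsum_eq_iSup_sum]
  refine iSup_le fun s => ?_
  rw [ENNReal.le_rpow_inv_iff hr]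
  exact (key s).trans (ENNReal.sum_le_tsum s)

theorem MN_tri {m k : ℕ} {Q : ℝ≥0∞} {B : ℝ} {q : ℝ≥0∞} {b : ℝ} {r : ℝ} (hr : 0 < r) (hr1 : r ≤ 1)
    (hQ : ENNReal.ofReal r ≤ Q) (hq : ENNReal.ofReal r ≤ q)
    {ι : Type*} [Countable ι] {H : ι → Eu m → Eu k → ℝ≥0∞}
    (hH : ∀ i, Measurable (Function.uncurry (H i))) :
    MN Q B q b (fun x y => ∑' i, H i x y) ^ r ≤ ∑' i, MN Q B q b (H i) ^ r := by
  letI : MeasurableSpace ι := ⊤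
  haveI : DiscreteMeasurableSpace ι := ⟨fun _ => trivial⟩
  have hQ0 := ne_zero_of_ofReal_le hr hQ
  have hq0 := ne_zero_of_ofReal_le hr hq
  simp_rw [MN_pow hQ0 hq0 hr]
  refine (MN_mono fun x y => tsum_rpow_le _ hr hr1).trans ?_
  have := MN_mink (Q := Q / ENNReal.ofReal r) (B := B) (q := q / ENNReal.ofReal r) (b := b)
    (one_le_div_ofReal hr hQ) (one_le_div_ofReal hr hq) (Measure.count (α := ι))
    (F := fun i x y => H i x y ^ r) (by
      have : Measurable (Function.uncurry fun (i : ι) (z : Eu m × Eu k) => H i z.1 z.2 ^ r) := by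
        apply measurable_from_prod_countable_right
        intro i
        exact (hH i).pow_const r
      exact this)
  simp_rw [lintegral_count] at this
  exact this

theorem geo_le {x y X : ℝ≥0∞} {α : ℝ} (h0 : 0 ≤ α) (h1 : α ≤ 1) (hx : x ≤ X) (hy : y ≤ X) :
    x ^ α * y ^ (1 - α) ≤ X := by
  calc _ ≤ X ^ α * X ^ (1 - α) := mul_le_mul' (ENNReal.rpow_le_rpow hx h0)
        (ENNReal.rpow_le_rpow hy (by linarith))
    _ = X := by rw [← ENNReal.rpow_add_of_nonneg _ _ h0 (by linarith)]; simp

theorem geo_const {c x y : ℝ≥0∞} {α : ℝ} (h0 : 0 ≤ α) (h1 : α ≤ 1) :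
    (c * x) ^ α * (c * y) ^ (1 - α) = c * (x ^ α * y ^ (1 - α)) := by
  rw [ENNReal.mul_rpow_of_nonneg _ _ h0, ENNReal.mul_rpow_of_nonneg _ _ (by linarith : 0 ≤ 1 - α)]
  have : c ^ α * c ^ (1 - α) = c := by
    rw [← ENNReal.rpow_add_of_nonneg _ _ h0 (by linarith)]; simp
  calc _ = (c ^ α * c ^ (1 - α)) * (x ^ α * y ^ (1 - α)) := by ring
    _ = _ := by rw [this]

theorem pair_sum {m k : ℕ} {s A r s' A' r' : ℝ} {C0 C C0' C' : ℝ≥0∞} {r0 : ℝ} (hr0 : 0 < r0)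
    {S S' : Set (Bool × Bool)} {α α' : ℝ}
    {w w' : ℕ × ℕ → Bool × Bool → ℝ≥0∞} {σ : ℕ × ℕ → Eu m → Eu m → ℂ} {σ' : ℕ × ℕ → Eu k → Eu k → ℂ}
    (R : Region s A r C0 C r0 S α w σ) (R' : Region s' A' r' C0' C' r0 S' α' w' σ')
    (NF NG : Bool → Bool → ℝ≥0∞) (K : ℝ≥0∞) (t : ℕ × ℕ → ℕ × ℕ → ℝ≥0∞)
    (ht : ∀ p p', ∀ e ∈ S, ∀ e' ∈ S', t p p' ≤ w p e * w' p' e' * (K * (NF e.1 e'.1 * NG e.2 e'.2))) :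
    ∑' p, ∑' p', t p p' ^ r0 ≤ C * C' * (K * (NF true true * NG false false +
      NF true false * NG false true + NF false true * NG true false +
      NF false false * NG true true)) ^ r0 := by
  set X := NF true true * NG false false +
      NF true false * NG false true + NF false true * NG true false +
      NF false false * NG true true with hX
  have X1 : NF true true * NG false false ≤ X :=
    le_self_add.trans (le_self_add.trans le_self_add)
  have X2 : NF true false * NG false true ≤ X := le_add_self.trans (le_self_add.trans le_self_add)
  have X3 : NF false true * NG true false ≤ X := le_add_self.trans le_self_add
  have X4 : NF false false * NG true true ≤ X := le_add_self
  let dA : Bool → ℝ≥0∞ := fun ε => NF ε true ^ α' * NF ε false ^ (1 - α')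
  let dB : Bool → ℝ≥0∞ := fun ε => NG ε false ^ α' * NG ε true ^ (1 - α')
  have hd : ∀ e : Bool × Bool, (NF e.1 true * NG e.2 false) ^ α' * (NF e.1 false * NG e.2 true) ^ (1 - α')
      = dA e.1 * dB e.2 := fun e => by
    rw [ENNReal.mul_rpow_of_nonneg _ _ R'.a0,
      ENNReal.mul_rpow_of_nonneg (NF e.1 false) _ (by linarith [R'.a1] : 0 ≤ 1 - α')]
    simp only [dA, dB]; ring
  have step1 : ∀ p, ∀ e ∈ S, ∑' p', t p p' ^ r0 ≤ C' * (w p e * (K * (dA e.1 * dB e.2))) ^ r0 := by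
    intro p e he
    have := R'.sum (fun e' => w p e * K * (NF e.1 e'.1 * NG e.2 e'.2)) (by simp only; ring) (t p)
      (fun p' e' he' => (ht p p' e he e' he').trans (le_of_eq (by ring)))
    rw [geo_const R'.a0 R'.a1, hd, mul_assoc] at this
    exact this
  have inv0 : 0 ≤ r0⁻¹ := by positivity
  have step2 := R.sum (fun e => C' ^ r0⁻¹ * K * (dA e.1 * dB e.2)) (by simp only; ring)
    (fun p => (∑' p', t p p' ^ r0) ^ r0⁻¹) (fun p e he => by
      refine (ENNReal.rpow_le_rpow (step1 p e he) inv0).trans (le_of_eq ?_)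
      rw [ENNReal.mul_rpow_of_nonneg _ _ inv0, ENNReal.rpow_rpow_inv hr0.ne']
      ring)
  simp only [ENNReal.rpow_inv_rpow hr0.ne'] at step2
  rw [geo_const R.a0 R.a1] at step2
  refine step2.trans ?_
  have hgeo : (dA true * dB false) ^ α * (dA false * dB true) ^ (1 - α) ≤ X := by
    apply geo_le R.a0 R.a1
    · have := hd (true, false)
      simp only at this
      rw [← this]
      exact geo_le R'.a0 R'.a1 X1 X2
    · have := hd (false, true)
      simp only at this
      rw [← this]
      exact geo_le R'.a0 R'.a1 X3 X4
  calc _ ≤ C * (C' ^ r0⁻¹ * K * X) ^ r0 := by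
        exact mul_le_mul_right (ENNReal.rpow_le_rpow (mul_le_mul_right hgeo _) hr0.le) _
    _ = _ := by
        rw [mul_assoc, ENNReal.mul_rpow_of_nonneg _ _ hr0.le, ENNReal.rpow_inv_rpow hr0.ne', mul_assoc]

theorem TT_measurable {m k : ℕ} {σ : Eu m → Eu m → ℂ} {σ' : Eu k → Eu k → ℂ}
    (h : Measurable (Function.uncurry σ)) (h' : Measurable (Function.uncurry σ'))
    (φ ψ : SchwartzMap (Eu m × Eu k) ℂ) : Measurable (TT σ σ' φ ψ) := by
  have : StronglyMeasurable (TT σ σ' φ ψ) := by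
    unfold TT
    apply StronglyMeasurable.integral_prod_right (f := fun (x : Eu m × Eu k)
      (z : (Eu m × Eu k) × (Eu m × Eu k)) =>
      (σ z.1.1 z.2.1 * σ' z.1.2 z.2.2) * ((φ z.1 * EE x z.1) * (ψ z.2 * EE x z.2)))
    apply Measurable.stronglyMeasurable
    have q1 : Measurable fun w : (Eu m × Eu k) × ((Eu m × Eu k) × (Eu m × Eu k)) =>
      (w.2.1.1, w.2.2.1) := by fun_prop
    have q2 : Measurable fun w : (Eu m × Eu k) × ((Eu m × Eu k) × (Eu m × Eu k)) =>
      (w.2.1.2, w.2.2.2) := by fun_prop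
    have r1 := h.comp q1
    have r2 := h'.comp q2
    have c1 : Measurable fun w : (Eu m × Eu k) × ((Eu m × Eu k) × (Eu m × Eu k)) =>
        ((φ w.2.1 * EE w.1 w.2.1) * (ψ w.2.2 * EE w.1 w.2.2)) := by
      apply Continuous.measurable
      have := φ.continuous
      have := ψ.continuous
      unfold EE
      fun_prop
    exact (r1.mul r2).mul c1
  exact this.measurable

theorem INV_meas {m k : ℕ} (φ : SchwartzMap (Eu m × Eu k) ℂ) :
    Measurable (Function.uncurry fun (x : Eu m) (y : Eu k) => ‖INV φ (x, y)‖ₑ) := by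
  obtain ⟨f, hf⟩ := INV_schwartz φ
  rw [← hf]
  have := f.continuous.measurable.enorm
  exact this

theorem s_nonneg {n : ℕ} {s r : ℝ} (hs : max 0 ((n : ℝ) * (1 / r - 1)) < s ∨ ∃ j : ℕ, s = 2 * j) :
    0 ≤ s := by
  rcases hs with h | ⟨j, rfl⟩
  · exact (le_max_left _ _).trans h.le
  · positivity

theorem piece_bound {m k : ℕ} {p p₁ p₂ P P₁ P₂ : ℝ≥0∞} {a a₁ a₂ B B₁ B₂ : ℝ}
    (hp1 : 1 ≤ p₁) (hp2 : 1 ≤ p₂)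
    (ha : 0 ≤ a) (ha1 : 0 ≤ a₁) (ha2 : 0 ≤ a₂)
    (he : 1 / p = 1 / p₁ + 1 / p₂)
    (hw : ENNReal.ofReal a / p = ENNReal.ofReal a₁ / p₁ + ENNReal.ofReal a₂ / p₂)
    (hP1 : 1 ≤ P₁) (hP2 : 1 ≤ P₂)
    (hB : 0 ≤ B) (hB1 : 0 ≤ B₁) (hB2 : 0 ≤ B₂)
    (hE : 1 / P = 1 / P₁ + 1 / P₂)
    (hW : ENNReal.ofReal B / P = ENNReal.ofReal B₁ / P₁ + ENNReal.ofReal B₂ / P₂)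
    {r r' A : ℝ} (hr : 0 < r) (hr' : 0 < r') (hrp : ENNReal.ofReal r ≤ p)
    (hrp' : ENNReal.ofReal r' ≤ p) (hrP' : ENNReal.ofReal r' ≤ P)
    (hA : a ≤ A) (hA1 : a₁ ≤ A) (hA2 : a₂ ≤ A) (hBA : B ≤ A) (hBA1 : B₁ ≤ A) (hBA2 : B₂ ≤ A)
    {C0 C : ℝ≥0∞} (hC0 : C0 ≠ ∞) (hC : C ≠ ∞) {s s' r0 : ℝ}
    {S S' : Set (Bool × Bool)} {α α' : ℝ}
    {w w' : ℕ × ℕ → Bool × Bool → ℝ≥0∞} {σ : ℕ × ℕ → Eu m → Eu m → ℂ} {σ' : ℕ × ℕ → Eu k → Eu k → ℂ}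
    (R : Region s A r C0 C r0 S α w σ) (R' : Region s' A r' C0 C r0 S' α' w' σ')
    (φ ψ : SchwartzMap (Eu m × Eu k) ℂ) (i i' : ℕ × ℕ) :
    ∀ e ∈ S, ∀ e' ∈ S', MN P B p a (fun x y => ‖TT (σ i) (σ' i') φ ψ (x, y)‖ₑ) ≤
      w i e * w' i' e' * ((C * C) ^ (1 / r) * (C * C) ^ (1 / r') * (C * C * (C * C)) *
        (mixedNorm P₁ B₁ p₁ a₁ (INV (wS (bp s e.1) (bp s' e'.1) φ)) *
         mixedNorm P₂ B₂ p₂ a₂ (INV (wS (bp s e.2) (bp s' e'.2) ψ)))) := by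
  intro e hee e' hee'
  obtain ⟨τ0, τ1, τ2, τt, δ, G1, h1⟩ := R.piece i
  obtain ⟨τ0', τ1', τ2', τt', δ', G2, h2⟩ := R'.piece i'
  obtain ⟨σe, K1, hσ⟩ := h1 e hee
  obtain ⟨σe', K1', hσ'⟩ := h2 e' hee'
  have := G1.sf0; have := G1.sf1; have := G1.sf2
  have := G2.sf0; have := G2.sf1; have := G2.sf2
  have mF := INV_meas (wS (bp s e.1) (bp s' e'.1) φ)
  have mG := INV_meas (wS (bp s e.2) (bp s' e'.2) ψ)
  have np := NP hp1 hp2 ha ha1 ha2 he hw hP1 hP2 hB hB1 hB2 hE hW hr hr' hrp hrp' hrP' hA hA1 hA2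
    hBA hBA1 hBA2 hC0 hC G1 G2 mF mG
  have hb := fun x y => TT_bound K1 K1' (wS (bp s e.1) (bp s' e'.1) φ) (wS (bp s e.2) (bp s' e'.2) ψ) x y
  have hpw := TT_weight hσ hσ' φ ψ
  have M1 := measurable_Av1 τ1 (measurable_Av2 τ1' mF)
  have M2 := measurable_Av1 τ2 (measurable_Av2 τ2' mG)
  have M3 := M1.mul M2
  have M := measurable_Av1 τ0 (measurable_Av2 τ0' (H := fun x y =>
      Av1 τ1 (Av2 τ1' (fun x y => ‖INV (wS (bp s e.1) (bp s' e'.1) φ) (x, y)‖ₑ)) x y *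
      Av1 τ2 (Av2 τ2' (fun x y => ‖INV (wS (bp s e.2) (bp s' e'.2) ψ) (x, y)‖ₑ)) x y) M3)
  have hP0 := ne_zero_of_ofReal_le hr' hrP'
  have hp0 := ne_zero_of_ofReal_le hr' hrp'
  simp_rw [hpw]
  refine (MN_mono hb).trans ?_
  rw [MN_const_mul' hP0 hp0 M]
  exact mul_le_mul_right np _

theorem main_aux (m k : ℕ)
    (pd pdd pd₁ pdd₁ pd₂ pdd₂ : ℝ≥0∞) (ad add ad₁ add₁ ad₂ add₂ sd sdd : ℝ)
    (hpd : 2⁻¹ ≤ pd) (hpdd : 2⁻¹ ≤ pdd)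
    (hpd1 : 1 ≤ pd₁) (hpdd1 : 1 ≤ pdd₁) (hpd2 : 1 ≤ pd₂) (hpdd2 : 1 ≤ pdd₂)
    (had : 0 ≤ ad) (hadd : 0 ≤ add) (had1 : 0 ≤ ad₁) (hadd1 : 0 ≤ add₁)
    (had2 : 0 ≤ ad₂) (hadd2 : 0 ≤ add₂)
    (hexpd : 1 / pd = 1 / pd₁ + 1 / pd₂)
    (hexpdd : 1 / pdd = 1 / pdd₁ + 1 / pdd₂)
    (hwexpd : ENNReal.ofReal ad / pd = ENNReal.ofReal ad₁ / pd₁ + ENNReal.ofReal ad₂ / pd₂)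
    (hwexpdd : ENNReal.ofReal add / pdd =
      ENNReal.ofReal add₁ / pdd₁ + ENNReal.ofReal add₂ / pdd₂)
    (hsd : max 0 ((m : ℝ) * (1 / (min 1 pd).toReal - 1)) < sd ∨ ∃ j : ℕ, sd = 2 * j)
    (hsdd : max 0 ((k : ℝ) * (1 / (min 1 (min pd pdd)).toReal - 1)) < sdd ∨
      ∃ j : ℕ, sdd = 2 * j) :
    ∃ C : ℝ≥0∞, C ≠ ∞ ∧ ∀ φ ψ : SchwartzMap (Eu m × Eu k) ℂ,
      mixedNorm pdd add pd ad (JsFst sd (JsSnd sdd (fun x => INV φ x * INV ψ x))) ≤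
        C *
          (mixedNorm pdd₁ add₁ pd₁ ad₁ (JsFst sd (JsSnd sdd (INV φ))) *
              mixedNorm pdd₂ add₂ pd₂ ad₂ (INV ψ) +
            mixedNorm pdd₁ add₁ pd₁ ad₁ (JsFst sd (INV φ)) *
              mixedNorm pdd₂ add₂ pd₂ ad₂ (JsSnd sdd (INV ψ)) +
            mixedNorm pdd₁ add₁ pd₁ ad₁ (JsSnd sdd (INV φ)) *
              mixedNorm pdd₂ add₂ pd₂ ad₂ (JsFst sd (INV ψ)) +
            mixedNorm pdd₁ add₁ pd₁ ad₁ (INV φ) *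
              mixedNorm pdd₂ add₂ pd₂ ad₂ (JsFst sd (JsSnd sdd (INV ψ)))) := by
  have half : (2⁻¹ : ℝ≥0∞) ≤ 1 := by simp
  have half0 : (0 : ℝ≥0∞) < 2⁻¹ := by simp
  set A : ℝ := ad + add + ad₁ + add₁ + ad₂ + add₂ with hAdef
  have hA0 : 0 ≤ A := by positivity
  set r : ℝ := (min 1 pd).toReal with hrd
  set r0 : ℝ := (min 1 (min pd pdd)).toReal with hr0d
  have t1 : min 1 pd ≠ ∞ := ne_top_of_le_ne_top ENNReal.one_ne_top (min_le_left _ _)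
  have t2 : min 1 (min pd pdd) ≠ ∞ := ne_top_of_le_ne_top ENNReal.one_ne_top (min_le_left _ _)
  have o1 : ENNReal.ofReal r = min 1 pd := ENNReal.ofReal_toReal t1
  have o2 : ENNReal.ofReal r0 = min 1 (min pd pdd) := ENNReal.ofReal_toReal t2
  have hr : 0 < r := ENNReal.toReal_pos (half0.trans_le (le_min half hpd)).ne' t1
  have hr0 : 0 < r0 := ENNReal.toReal_pos (half0.trans_le (le_min half (le_min hpd hpdd))).ne' t2
  have hr1 : r ≤ 1 := by
    rw [← ENNReal.ofReal_le_ofReal_iff (by norm_num), o1, ENNReal.ofReal_one]; exact min_le_left _ _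
  have hr01 : r0 ≤ 1 := by
    rw [← ENNReal.ofReal_le_ofReal_iff (by norm_num), o2, ENNReal.ofReal_one]; exact min_le_left _ _
  have hrp : ENNReal.ofReal r ≤ pd := o1.trans_le (min_le_right _ _)
  have hrp' : ENNReal.ofReal r0 ≤ pd := o2.trans_le ((min_le_right _ _).trans (min_le_left _ _))
  have hrP' : ENNReal.ofReal r0 ≤ pdd := o2.trans_le ((min_le_right _ _).trans (min_le_right _ _))
  obtain ⟨C1, hC1, D1⟩ := decomp m hr0 hA0 hr hr1 hsd
  obtain ⟨C2, hC2, D2⟩ := decomp k hr0 hA0 hr0 hr01 hsdd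
  have hC0 : C1 + C2 ≠ ∞ := by finiteness
  obtain ⟨Ca, hCa, R, d, hd⟩ := D1 (C1 + C2) le_self_add hC0
  obtain ⟨Cb, hCb, R', d', hd'⟩ := D2 (C1 + C2) le_add_self hC0
  set C := Ca + Cb with hCd
  have hC : C ≠ ∞ := by finiteness
  have hs := s_nonneg hsd
  have hs' := s_nonneg hsdd
  set K := (C * C) ^ (1 / r) * (C * C) ^ (1 / r0) * (C * C * (C * C)) with hKd
  have hK : K ≠ ∞ := by
    have h1 : (C * C) ^ (1 / r) ≠ ∞ := ENNReal.rpow_ne_top_of_nonneg (by positivity) (by finiteness)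
    have h2 : (C * C) ^ (1 / r0) ≠ ∞ := ENNReal.rpow_ne_top_of_nonneg (by positivity) (by finiteness)
    finiteness
  refine ⟨(R * (R' * (C * C))) ^ (1 / r0) * K, ?_, fun φ ψ => ?_⟩
  · have h1 : (R * (R' * (C * C)) : ℝ≥0∞) ^ (1 / r0) ≠ ∞ :=
      ENNReal.rpow_ne_top_of_nonneg (by positivity) (by finiteness)
    finiteness
  have hR := fun i => (hd.1 i).mono (le_self_add : Ca ≤ C)
  have hR' := fun i => (hd'.1 i).mono (le_add_self : Cb ≤ C)
  let NF : Bool → Bool → ℝ≥0∞ := fun ε ε' => mixedNorm pdd₁ add₁ pd₁ ad₁ (INV (wS (bp sd ε) (bp sdd ε') φ))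
  let NG : Bool → Bool → ℝ≥0∞ := fun ε ε' => mixedNorm pdd₂ add₂ pd₂ ad₂ (INV (wS (bp sd ε) (bp sdd ε') ψ))
  have jj : ∀ χ : SchwartzMap (Eu m × Eu k) ℂ, JsFst sd (JsSnd sdd (INV χ)) = INV (wS (bp sd true) (bp sdd true) χ) := by
    intro χ; rw [JsSnd_INV, JsFst_INV, wS_wS]; simp [bp]
  have j1 : ∀ χ : SchwartzMap (Eu m × Eu k) ℂ, JsFst sd (INV χ) = INV (wS (bp sd true) (bp sdd false) χ) := by
    intro χ; rw [JsFst_INV]; simp [bp]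
  have j2 : ∀ χ : SchwartzMap (Eu m × Eu k) ℂ, JsSnd sdd (INV χ) = INV (wS (bp sd false) (bp sdd true) χ) := by
    intro χ; rw [JsSnd_INV]; simp [bp]
  have j0 : ∀ χ : SchwartzMap (Eu m × Eu k) ℂ, mixedNorm pdd₁ add₁ pd₁ ad₁ (INV χ) =
      mixedNorm pdd₁ add₁ pd₁ ad₁ (INV (wS (bp sd false) (bp sdd false) χ)) := by
    intro χ; simp [bp, wS_zero]
  have j0' : ∀ χ : SchwartzMap (Eu m × Eu k) ℂ, mixedNorm pdd₂ add₂ pd₂ ad₂ (INV χ) =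
      mixedNorm pdd₂ add₂ pd₂ ad₂ (INV (wS (bp sd false) (bp sdd false) χ)) := by
    intro χ; simp [bp, wS_zero]
  set X := NF true true * NG false false + NF true false * NG false true +
    NF false true * NG true false + NF false false * NG true true with hX
  suffices hmain : mixedNorm pdd add pd ad (JsFst sd (JsSnd sdd (fun x => INV φ x * INV ψ x))) ≤
      (R * (R' * (C * C))) ^ (1 / r0) * K * X by
    rw [jj φ, jj ψ, j1 φ, j1 ψ, j2 φ, j2 ψ, j0 φ, j0' ψ]
    exact hmain
  let t : Fin R → Fin R' → ℕ × ℕ → ℕ × ℕ → ℝ≥0∞ := fun i i' p p' =>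
    MN pdd add pd ad (fun x y => ‖TT ((d i).σ p) ((d' i').σ p') φ ψ (x, y)‖ₑ)
  have pairs : ∀ i i', ∑' p, ∑' p', t i i' p p' ^ r0 ≤ C * C * (K * X) ^ r0 := by
    intro i i'
    refine pair_sum hr0 (hR i) (hR' i') NF NG K (t i i') fun p p' => ?_
    exact piece_bound hpd1 hpd2 had had1 had2 hexpd hwexpd hpdd1 hpdd2 hadd hadd1 hadd2 hexpdd hwexpdd
      hr hr0 hrp hrp' hrP' (by linarith) (by linarith) (by linarith) (by linarith) (by linarith)
      (by linarith) hC0 hC (hR i) (hR' i') φ ψ p p'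
  have tri : mixedNorm pdd add pd ad (JsFst sd (JsSnd sdd (fun x => INV φ x * INV ψ x))) ^ r0 ≤
      ∑ i, ∑ i', ∑' p, ∑' p', t i i' p p' ^ r0 := by
    have h1 := MN_tri (Q := pdd) (B := add) (q := pd) (b := ad) hr0 hr01 hrP' hrp'
      (ι := Fin R × Fin R' × (ℕ × ℕ) × (ℕ × ℕ))
      (H := fun j x y => ‖TT ((d j.1).σ j.2.2.1) ((d' j.2.1).σ j.2.2.2) φ ψ (x, y)‖ₑ)
      (fun j => (TT_measurable ((hR j.1).dom hs j.2.2.1).1 ((hR' j.2.1).dom hs' j.2.2.2).1 φ ψ).enorm)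
    have h2 : mixedNorm pdd add pd ad (JsFst sd (JsSnd sdd (fun x => INV φ x * INV ψ x))) ≤
        MN pdd add pd ad (fun x y => ∑' j : Fin R × Fin R' × (ℕ × ℕ) × (ℕ × ℕ),
          ‖TT ((d j.1).σ j.2.2.1) ((d' j.2.1).σ j.2.2.2) φ ψ (x, y)‖ₑ) := by
      rw [mixedNorm_eq]
      refine MN_mono (H := fun x y => ‖JsFst sd (JsSnd sdd (fun x => INV φ x * INV ψ x)) (x, y)‖ₑ)
        fun x y => (expand hs hs' hd hd' φ ψ (x, y)).trans (le_of_eq ?_)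
      rw [ENNReal.tsum_prod', tsum_fintype]
      refine Finset.sum_congr rfl fun i _ => ?_
      rw [ENNReal.tsum_prod', tsum_fintype]
      refine Finset.sum_congr rfl fun i' _ => ?_
      exact (ENNReal.tsum_prod (f := fun p p' => ‖TT ((d i).σ p) ((d' i').σ p') φ ψ (x, y)‖ₑ)).symm
    refine (ENNReal.rpow_le_rpow h2 hr0.le).trans (h1.trans (le_of_eq ?_))
    rw [ENNReal.tsum_prod', tsum_fintype]
    refine Finset.sum_congr rfl fun i _ => ?_
    rw [ENNReal.tsum_prod', tsum_fintype]
    refine Finset.sum_congr rfl fun i' _ => ?_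
    rw [ENNReal.tsum_prod']
  have fin : mixedNorm pdd add pd ad (JsFst sd (JsSnd sdd (fun x => INV φ x * INV ψ x))) ^ r0 ≤
      (R * (R' * (C * C))) * (K * X) ^ r0 := by
    refine tri.trans ((Finset.sum_le_sum fun i _ => Finset.sum_le_sum fun i' _ => pairs i i').trans
      (le_of_eq ?_))
    simp only [Finset.sum_const, Finset.card_univ, Fintype.card_fin, nsmul_eq_mul]
    ring
  refine (rpow_le_imp hr0 fin).trans (le_of_eq ?_)
  ring

/-- **The biparameter Kato–Ponce inequality in the weighted mixed norm setting**
(Theorem 1.5). -/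
theorem weighted_biparameter_kato_ponce (m k : ℕ) (hm : 1 ≤ m) (hk : 1 ≤ k)
    (pd pdd pd₁ pdd₁ pd₂ pdd₂ : ℝ≥0∞) (ad add ad₁ add₁ ad₂ add₂ sd sdd : ℝ)
    (hpd : 2⁻¹ ≤ pd) (hpdd : 2⁻¹ ≤ pdd)
    (hpd1 : 1 ≤ pd₁) (hpdd1 : 1 ≤ pdd₁) (hpd2 : 1 ≤ pd₂) (hpdd2 : 1 ≤ pdd₂)
    (had : 0 ≤ ad) (hadd : 0 ≤ add) (had1 : 0 ≤ ad₁) (hadd1 : 0 ≤ add₁)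
    (had2 : 0 ≤ ad₂) (hadd2 : 0 ≤ add₂)
    (hexpd : 1 / pd = 1 / pd₁ + 1 / pd₂)
    (hexpdd : 1 / pdd = 1 / pdd₁ + 1 / pdd₂)
    (hwexpd : ENNReal.ofReal ad / pd = ENNReal.ofReal ad₁ / pd₁ + ENNReal.ofReal ad₂ / pd₂)
    (hwexpdd : ENNReal.ofReal add / pdd =
      ENNReal.ofReal add₁ / pdd₁ + ENNReal.ofReal add₂ / pdd₂)
    (hsd : max 0 ((m : ℝ) * (1 / (min 1 pd).toReal - 1)) < sd ∨ ∃ j : ℕ, sd = 2 * j)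
    (hsdd : max 0 ((k : ℝ) * (1 / (min 1 (min pd pdd)).toReal - 1)) < sdd ∨
      ∃ j : ℕ, sdd = 2 * j) :
    ∃ C : ℝ, 0 < C ∧ ∀ f g : SchwartzMap (Eu m × Eu k) ℂ,
      mixedNorm pdd add pd ad (JsFst sd (JsSnd sdd (fun x => f x * g x))) ≤
        ENNReal.ofReal C *
          (mixedNorm pdd₁ add₁ pd₁ ad₁ (JsFst sd (JsSnd sdd ⇑f)) *
              mixedNorm pdd₂ add₂ pd₂ ad₂ ⇑g +
            mixedNorm pdd₁ add₁ pd₁ ad₁ (JsFst sd ⇑f) *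
              mixedNorm pdd₂ add₂ pd₂ ad₂ (JsSnd sdd ⇑g) +
            mixedNorm pdd₁ add₁ pd₁ ad₁ (JsSnd sdd ⇑f) *
              mixedNorm pdd₂ add₂ pd₂ ad₂ (JsFst sd ⇑g) +
            mixedNorm pdd₁ add₁ pd₁ ad₁ ⇑f *
              mixedNorm pdd₂ add₂ pd₂ ad₂ (JsFst sd (JsSnd sdd ⇑g))) := by
  obtain ⟨C, hC, h⟩ := main_aux m k pd pdd pd₁ pdd₁ pd₂ pdd₂ ad add ad₁ add₁ ad₂ add₂ sd sdd
    hpd hpdd hpd1 hpdd1 hpd2 hpdd2 had hadd had1 hadd1 had2 hadd2 hexpd hexpdd hwexpd hwexpdd hsd hsdd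
  refine ⟨C.toReal + 1, by positivity, fun f g => ?_⟩
  obtain ⟨φ, hφ⟩ := INV_surj f
  obtain ⟨ψ, hψ⟩ := INV_surj g
  have hCC : C ≤ ENNReal.ofReal (C.toReal + 1) := by
    conv_lhs => rw [← ENNReal.ofReal_toReal hC]
    exact ENNReal.ofReal_le_ofReal (by linarith)
  have hfg : (fun x => f x * g x) = fun x => INV φ x * INV ψ x := by rw [hφ, hψ]
  rw [hfg, hφ, hψ]
  exact (h φ ψ).trans (mul_le_mul_left hCC _)
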